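/- There exists a constant b_k > 0 depending only on k such that for all sufficiently large N, the number of pairs (a, d) of positive integers with d ≥ 1 such that a, a+d, …, a+(k−1)d are all prime and all lie in the interval (W·N, W·(N+M)] is at least b_k·M²/(log N)^k. -/

import Mathlib

open Finset Filter
open scoped Classical

noncomputable section

/-- `ε_k := 1/(2^k (k+4)!)`. -/
def epsk (k : ℕ) : ℝ := 1 / (2 ^ k * (Nat.factorial (k + 4)))

/-- `W(N) := ∏_{p ≤ w(N)} p`. -/
def Wprim (w : ℕ → ℕ) (N : ℕ) : ℕ := ∏ p ∈ (Finset.range (w N + 1)).filter Nat.Prime, p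

/-- W-tricked von Mangoldt function. -/
def tildeLambda (W n : ℕ) : ℝ :=
  if Nat.Prime (W * n + 1) then (Nat.totient W : ℝ) / W * Real.log (W * n + 1) else 0

/-- truncated divisor sum `Λ_R`. -/
def LambdaR (R : ℝ) (n : ℕ) : ℝ :=
  ∑ d ∈ n.divisors.filter (fun d : ℕ => (d : ℝ) ≤ R),
    ((ArithmeticFunction.moebius d : ℤ) : ℝ) * Real.log (R / (d : ℝ))

/-- the representative of `n : ZMod m` lying in `[N, N+m)`. -/
def reprN (N : ℕ) {m : ℕ} (n : ZMod m) : ℕ := N + (n - (N : ZMod m)).val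

/-- the condition `ε_k M ≤ n - N ≤ 2 ε_k M` on the representative in `[N, N+m)`. -/
def inWindow (k N : ℕ) {m : ℕ} (n : ZMod m) : Prop :=
  epsk k * m ≤ ((n - (N : ZMod m)).val : ℝ) ∧ ((n - (N : ZMod m)).val : ℝ) ≤ 2 * epsk k * m

/-- `R := M^(1/(k 2^(k+4)))`. -/
def Rpar (k m : ℕ) : ℝ := (m : ℝ) ^ ((1 : ℝ) / (k * 2 ^ (k + 4)))

/-- the Green–Tao majorant `ν`. -/
def nuGT (k N W : ℕ) {m : ℕ} (n : ZMod m) : ℝ :=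
  if inWindow k N n then
    (Nat.totient W : ℝ) / W * (LambdaR (Rpar k m) (W * reprN N n + 1)) ^ 2 / Real.log (Rpar k m)
  else 1

/-- the function `f`. -/
def fGT (k N W : ℕ) {m : ℕ} (n : ZMod m) : ℝ :=
  if inWindow k N n then tildeLambda W (reprN N n) / (k * 2 ^ (k + 5)) else 0

/-- the set of integers `n` with `ε_k M ≤ n - N ≤ 2 ε_k M`. -/
def windowSet (k N m : ℕ) : Finset ℕ :=
  (Finset.range (N + m + 1)).filter
    (fun n => epsk k * m ≤ (n : ℝ) - N ∧ (n : ℝ) - N ≤ 2 * epsk k * m)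

/-- `E(Λ̃(n) | ε_k M ≤ n - N ≤ 2 ε_k M)`. -/
def avgWindow (k N m W : ℕ) : ℝ :=
  (∑ n ∈ windowSet k N m, tildeLambda W n) / (windowSet k N m).card

/-- `E(g(x) | x ∈ Z_m)`. -/
def avgZ (m : ℕ) (g : ZMod m → ℝ) : ℝ := (∑ x ∈ Finset.range m, g (x : ZMod m)) / m

/-- `E(g(x) g(x+r) ⋯ g(x+(k-1)r) | x, r ∈ Z_m)`. -/
def apAvg (k m : ℕ) (g : ZMod m → ℝ) : ℝ :=
  (∑ x ∈ Finset.range m, ∑ r ∈ Finset.range m,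
    ∏ i ∈ Finset.range k, g ((x : ZMod m) + (i : ZMod m) * (r : ZMod m))) / (m : ℝ) ^ 2

/-- a rational number interpreted in `ZMod m`. -/
def ratZMod (q : ℚ) (m : ℕ) : ZMod m := (q.num : ZMod m) * (q.den : ZMod m)⁻¹

/-- the `(m₀,t₀,L₀)`-linear forms condition for a family `ν = ν_N : Z_{M(N)} → ℝ`. -/
def LinearFormsCondition (M : ℕ → ℕ) (ν : ∀ N : ℕ, ZMod (M N) → ℝ) (m₀ t₀ L₀ : ℕ) : Prop :=
  ∀ m t : ℕ, m ≤ m₀ → t ≤ t₀ →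
    ∀ L : Fin m → Fin t → ℚ,
      (∀ i j, (L i j).num.natAbs ≤ L₀ ∧ (L i j).den ≤ L₀) →
      (∀ i, L i ≠ 0) →
      (∀ i i', i ≠ i' → ∀ q : ℚ, L i ≠ q • L i') →
      ∀ δ : ℝ, 0 < δ → ∃ N₀ : ℕ, ∀ N ≥ N₀, L₀ < M N →
        ∀ b : Fin m → ZMod (M N),
          |(∑ x : Fin t → Fin (M N), ∏ i : Fin m,
              ν N (∑ j : Fin t, ratZMod (L i j) (M N) * ((x j : ℕ) : ZMod (M N)) + b i)) /
              (M N : ℝ) ^ t - 1| ≤ δ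

/-- the `m₀`-correlation condition for a family `ν = ν_N : Z_{M(N)} → ℝ`. -/
def CorrelationCondition (M : ℕ → ℕ) (ν : ∀ N : ℕ, ZMod (M N) → ℝ) (m₀ : ℕ) : Prop :=
  ∀ m : ℕ, 1 < m → m ≤ m₀ →
    ∃ τ : ∀ N : ℕ, ZMod (M N) → ℝ,
      (∀ N n, 0 ≤ τ N n) ∧
      (∀ q : ℝ, 1 ≤ q → ∃ C : ℝ, ∀ N, avgZ (M N) (fun n => τ N n ^ q) ≤ C) ∧
      (∀ N : ℕ, ∀ h : Fin m → ZMod (M N),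
        avgZ (M N) (fun x => ∏ i, ν N (x + h i)) ≤
          ∑ i : Fin m, ∑ j : Fin m, if i < j then τ N (h i - h j) else 0)

/-- `k`-pseudorandom measure. -/
def Pseudorandom (k : ℕ) (M : ℕ → ℕ) (ν : ∀ N : ℕ, ZMod (M N) → ℝ) : Prop :=
  (∀ δ : ℝ, 0 < δ → ∃ N₀, ∀ N ≥ N₀, |avgZ (M N) (ν N) - 1| ≤ δ) ∧
  LinearFormsCondition M ν (k * 2 ^ (k - 1)) (3 * k - 4) k ∧
  CorrelationCondition M ν (2 ^ (k - 1))

/-- the number of pairs `(a,d)`, `a,d ≥ 1`, such that `a, a+d, …, a+(k-1)d` are all prime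
and all lie in the interval `(W·N, W·(N+M)]`. -/
def apCount (k W N M : ℕ) : ℕ :=
  ((Finset.Icc 1 (W * (N + M)) ×ˢ Finset.Icc 1 (W * (N + M))).filter
    (fun ad : ℕ × ℕ => ∀ i < k, Nat.Prime (ad.1 + i * ad.2) ∧
      W * N < ad.1 + i * ad.2 ∧ ad.1 + i * ad.2 ≤ W * (N + M))).card

/-- The mean of a real function on a finite type. -/
def avg {X : Type*} [Finite X] (f : X → ℝ) : ℝ :=
  (∑ x ∈ (Set.finite_univ (α := X)).toFinset, f x) / Nat.card X

section Avg

variable {X Y : Type*} [Finite X] [Finite Y]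

lemma avg_eq_sum_div {X : Type*} [Fintype X] (f : X → ℝ) :
    avg f = (∑ x, f x) / Fintype.card X := by
  rw [avg, Nat.card_eq_fintype_card]
  congr 1
  exact Finset.sum_congr (by ext; simp) fun _ _ => rfl

lemma sum_eq_card_mul_avg {X : Type*} [Fintype X] (f : X → ℝ) :
    ∑ x, f x = Fintype.card X * avg f := by
  rw [avg_eq_sum_div]
  rcases isEmpty_or_nonempty X with h | h
  · simp
  · field_simp

lemma avg_add (f g : X → ℝ) : (avg fun x => f x + g x) = avg f + avg g := by
  simp only [avg, Finset.sum_add_distrib, add_div]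

lemma avg_sub (f g : X → ℝ) : (avg fun x => f x - g x) = avg f - avg g := by
  simp only [avg, Finset.sum_sub_distrib, sub_div]

lemma avg_neg (f : X → ℝ) : (avg fun x => -f x) = -avg f := by
  simp only [avg, Finset.sum_neg_distrib, neg_div]

lemma avg_mul_left (c : ℝ) (f : X → ℝ) : (avg fun x => c * f x) = c * avg f := by
  simp only [avg, ← Finset.mul_sum, mul_div_assoc]

lemma avg_mul_right (c : ℝ) (f : X → ℝ) : (avg fun x => f x * c) = avg f * c := by
  simp only [avg, ← Finset.sum_mul, div_mul_eq_mul_div]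

lemma avg_const [Nonempty X] (c : ℝ) : (avg fun _ : X => c) = c := by
  have := Fintype.ofFinite X
  rw [avg_eq_sum_div]
  simp

lemma avg_zero : (avg fun _ : X => (0 : ℝ)) = 0 := by simp [avg]

lemma avg_mono {f g : X → ℝ} (h : ∀ x, f x ≤ g x) : avg f ≤ avg g :=
  div_le_div_of_nonneg_right (Finset.sum_le_sum fun x _ => h x) (Nat.cast_nonneg _)

lemma avg_nonneg {f : X → ℝ} (h : ∀ x, 0 ≤ f x) : 0 ≤ avg f :=
  div_nonneg (Finset.sum_nonneg fun x _ => h x) (Nat.cast_nonneg _)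

lemma avg_le_of_forall_le {f : X → ℝ} {c : ℝ} (hc : 0 ≤ c) (h : ∀ x, f x ≤ c) : avg f ≤ c := by
  rcases isEmpty_or_nonempty X with hX | hX
  · simpa [avg] using hc
  · exact (avg_mono h).trans_eq (avg_const c)

lemma le_avg_of_forall_le [Nonempty X] {f : X → ℝ} {c : ℝ} (h : ∀ x, c ≤ f x) : c ≤ avg f :=
  (avg_const (X := X) c).symm.le.trans (avg_mono h)

lemma exists_avg_le [Nonempty X] (f : X → ℝ) : ∃ x, avg f ≤ f x := by
  have := Fintype.ofFinite X
  obtain ⟨x, -, hx⟩ := Finset.exists_max_image univ f univ_nonempty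
  exact ⟨x, (avg_mono fun y => hx y (mem_univ y)).trans_eq (avg_const _)⟩

lemma abs_avg_le (f : X → ℝ) : |avg f| ≤ avg fun x => |f x| := by
  rw [abs_le, ← avg_neg]
  exact ⟨avg_mono fun x => neg_abs_le _, avg_mono fun x => le_abs_self _⟩

lemma avg_sum {κ : Type*} (s : Finset κ) (f : κ → X → ℝ) :
    (avg fun x => ∑ i ∈ s, f i x) = ∑ i ∈ s, avg (f i) := by
  simp only [avg, Finset.sum_comm (t := s), Finset.sum_div]

lemma avg_comm (f : X → Y → ℝ) :
    (avg fun x => avg fun y => f x y) = avg fun y => avg fun x => f x y := by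
  simp only [avg, ← Finset.sum_div]
  rw [Finset.sum_comm, div_right_comm]

lemma avg_equiv (e : X ≃ Y) (f : Y → ℝ) : (avg fun x => f (e x)) = avg f := by
  have := Fintype.ofFinite X
  have := Fintype.ofFinite Y
  rw [avg_eq_sum_div, avg_eq_sum_div, Fintype.card_congr e, e.sum_comp]

lemma avg_prod (f : X × Y → ℝ) : avg f = avg fun x => avg fun y => f (x, y) := by
  have := Fintype.ofFinite X
  have := Fintype.ofFinite Y
  simp only [avg_eq_sum_div, Fintype.sum_prod_type, ← Finset.sum_div, Fintype.card_prod]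
  push_cast
  rw [div_div, mul_comm]

lemma avg_mul_avg (f : X → ℝ) (g : Y → ℝ) :
    avg f * avg g = avg fun x => avg fun y => f x * g y := by
  simp only [avg_mul_left, avg_mul_right]

lemma avg_congr {f g : X → ℝ} (h : ∀ x, f x = g x) : avg f = avg g := by
  rw [funext h]

lemma avg_unique {X : Type*} [Unique X] (f : X → ℝ) : avg f = f default := by
  rw [avg_eq_sum_div]; simp

lemma avg_sq_le (f : X → ℝ) : avg f ^ 2 ≤ avg fun x => f x ^ 2 := by
  have := Fintype.ofFinite X
  rcases isEmpty_or_nonempty X with hX | hX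
  · simp [avg]
  rw [avg_eq_sum_div, avg_eq_sum_div, div_pow, div_le_div_iff₀ (by positivity) (by positivity)]
  have := sq_sum_le_card_mul_sum_sq (s := univ) (f := f)
  rw [Finset.card_univ] at this
  nlinarith [(Nat.cast_nonneg (Fintype.card X) : (0:ℝ) ≤ _)]

lemma avg_mul_sq_le (f g : X → ℝ) :
    (avg fun x => f x * g x) ^ 2 ≤ (avg fun x => f x ^ 2) * avg fun x => g x ^ 2 := by
  simp only [avg, div_pow, div_mul_div_comm, ← sq]
  gcongr
  exact Finset.sum_mul_sq_le_sq_mul_sq _ _ _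

/-- Weighted Cauchy–Schwarz inequality. -/
lemma avg_weight_mul_sq_le {w : X → ℝ} (hw : ∀ x, 0 ≤ w x) (g : X → ℝ) :
    (avg fun x => w x * g x) ^ 2 ≤ avg w * avg fun x => w x * g x ^ 2 := by
  have h := avg_mul_sq_le (fun x => √(w x)) (fun x => √(w x) * g x)
  simp only [← mul_assoc, mul_pow, Real.sq_sqrt (hw _), Real.mul_self_sqrt (hw _)] at h
  exact h

lemma avg_pi_prod {ι : Type*} [Fintype ι] {A : ι → Type*} [∀ i, Finite (A i)]
    (f : ∀ i, A i → ℝ) : (avg fun x : ∀ i, A i => ∏ i, f i (x i)) = ∏ i, avg (f i) := by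
  have := fun i => Fintype.ofFinite (A i)
  simp only [avg_eq_sum_div, Finset.prod_div_distrib, Finset.prod_univ_sum, Fintype.piFinset_univ,
    Fintype.card_pi, Nat.cast_prod]

lemma avg_addMonoidHom {G H : Type*} [AddCommGroup G] [AddCommGroup H] [Finite G] [Finite H]
    (φ : G →+ H) (hφ : Function.Surjective φ) (f : H → ℝ) : (avg fun x => f (φ x)) = avg f := by
  have key : (avg fun x : G => f (φ x)) = avg fun h : H => avg fun x : G => f (φ x + h) := by
    rw [← avg_const (X := H) (avg fun x : G => f (φ x))]
    refine avg_congr fun h => ?_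
    obtain ⟨g, rfl⟩ := hφ h
    rw [← avg_equiv (Equiv.addRight g) (fun x => f (φ x))]
    simp
  rw [key, avg_comm]
  have : ∀ x, (avg fun h => f (φ x + h)) = avg f := fun x =>
    avg_equiv (Equiv.addLeft (φ x)) f
  simp only [this]
  exact avg_const _

end Avg

/-- The density of a set in a finite type. -/
def setDens {X : Type*} [Finite X] (A : Set X) : ℝ := avg fun x => if x ∈ A then 1 else 0

section Dens

variable {X Y κ : Type*} [Finite X] [Finite Y] [Finite κ]

lemma setDens_nonneg (A : Set X) : 0 ≤ setDens A := avg_nonneg fun x => by split_ifs <;> norm_num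

lemma setDens_le_one (A : Set X) : setDens A ≤ 1 :=
  avg_le_of_forall_le zero_le_one fun x => by split_ifs <;> norm_num

lemma setDens_mono {A B : Set X} (h : A ⊆ B) : setDens A ≤ setDens B :=
  avg_mono fun x => by
    by_cases hx : x ∈ A
    · simp [hx, h hx]
    · simp only [hx, if_false]; split_ifs <;> norm_num

lemma setDens_empty : setDens (∅ : Set X) = 0 := by simp [setDens, avg_zero]

lemma nonempty_of_setDens_pos {A : Set X} (h : 0 < setDens A) : A.Nonempty := by
  by_contra h'
  rw [Set.not_nonempty_iff_eq_empty.1 h', setDens_empty] at h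
  exact h.false

lemma setDens_equiv (e : X ≃ Y) (A : Set Y) : setDens {x | e x ∈ A} = setDens A :=
  avg_equiv e fun y => if y ∈ A then (1 : ℝ) else 0

lemma setDens_prod (A : Set (X × Y)) : setDens A = avg fun y => setDens {x | (x, y) ∈ A} := by
  rw [setDens, avg_prod, avg_comm]; rfl

lemma setDens_prod' (A : Set (X × Y)) : setDens A = avg fun x => setDens {y | (x, y) ∈ A} := by
  rw [setDens, avg_prod]; rfl

lemma half_le_setDens_setOf_half_le {f : X → ℝ} (hf : ∀ x, f x ≤ 1) {δ : ℝ} (hδ : 0 < δ)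
    (h : δ ≤ avg f) : δ / 2 ≤ setDens {x | δ / 2 ≤ f x} := by
  have : avg f ≤ avg fun x => (if x ∈ {x | δ / 2 ≤ f x} then 1 else 0) + δ / 2 :=
    avg_mono fun x => by
      by_cases hx : δ / 2 ≤ f x
      · simp only [Set.mem_ofPred_eq, hx, if_true]; linarith [hf x]
      · simp only [Set.mem_ofPred_eq, hx, if_false]; linarith
  have hX : Nonempty X := by
    by_contra hX
    rw [not_nonempty_iff] at hX
    have : avg f = 0 := by simp [avg]
    linarith
  rw [avg_add, avg_const] at this
  change avg f ≤ setDens _ + _ at this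
  linarith

lemma setDens_iUnion_le (A : κ → Set X) : setDens {x | ∃ c, x ∈ A c} ≤ Nat.card κ * avg fun c => setDens (A c) := by
  have := Fintype.ofFinite κ
  rw [Nat.card_eq_fintype_card, ← sum_eq_card_mul_avg]
  simp only [setDens]
  rw [← avg_sum]
  refine avg_mono fun x => ?_
  have h0 : ∀ c ∈ univ, (0 : ℝ) ≤ if x ∈ A c then 1 else 0 := fun c _ => by split_ifs <;> norm_num
  split_ifs with h
  · obtain ⟨c, hc⟩ := h
    exact (by simp [hc] : (1 : ℝ) ≤ if x ∈ A c then 1 else 0).trans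
      (Finset.single_le_sum h0 (mem_univ c))
  · exact Finset.sum_nonneg h0

lemma exists_setDens_ge_of_forall_exists {A : κ → Set X} {δ : ℝ} (hδ : 0 < δ)
    (h : δ ≤ setDens {x | ∃ c, x ∈ A c}) : ∃ c, δ / Nat.card κ ≤ setDens (A c) := by
  have h1 := h.trans (setDens_iUnion_le A)
  have : Nonempty κ := by
    by_contra hX
    rw [not_nonempty_iff] at hX
    simp at h1
    linarith
  obtain ⟨c, hc⟩ := exists_avg_le fun c => setDens (A c)
  refine ⟨c, le_trans ?_ hc⟩
  rw [div_le_iff₀ (by exact_mod_cast Nat.card_pos)]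
  linarith

end Dens

section DensityHalesJewett

open Combinatorics

variable {α β η η' ι ι' κ : Type}

instance [Finite η] [Finite α] [Finite ι] : Finite (Subspace η α ι) :=
  Finite.of_injective (fun l => l.idxFun) fun l m h => by
    cases l; cases m; simp_all

/-- The product of two combinatorial subspaces. -/
def subspaceSum (S : Subspace η α ι) (T : Subspace η' α ι') : Subspace (η ⊕ η') α (ι ⊕ ι') where
  idxFun := Sum.elim (fun i => (S.idxFun i).map id Sum.inl) (fun i => (T.idxFun i).map id Sum.inr)
  proper e := by
    rcases e with e | e
    · obtain ⟨i, hi⟩ := S.proper e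
      exact ⟨Sum.inl i, by simp [hi]⟩
    · obtain ⟨i, hi⟩ := T.proper e
      exact ⟨Sum.inr i, by simp [hi]⟩

lemma subspaceSum_apply (S : Subspace η α ι) (T : Subspace η' α ι') (t : η ⊕ η' → α) :
    subspaceSum S T t = Sum.elim (S (t ∘ Sum.inl)) (T (t ∘ Sum.inr)) := by
  funext i
  rcases i with i | i
  · cases h : S.idxFun i <;> simp [subspaceSum, Subspace.apply_def, h]
  · cases h : T.idxFun i <;> simp [subspaceSum, Subspace.apply_def, h]

/-- The composition of two combinatorial subspaces. -/
def subspaceComp (S : Subspace η α ι) (T : Subspace η' α η) : Subspace η' α ι where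
  idxFun i := (S.idxFun i).elim Sum.inl T.idxFun
  proper e := by
    obtain ⟨j, hj⟩ := T.proper e
    obtain ⟨i, hi⟩ := S.proper j
    exact ⟨i, by simp [hi, hj]⟩

lemma subspaceComp_apply (S : Subspace η α ι) (T : Subspace η' α η) (t : η' → α) :
    subspaceComp S T t = S (T t) := by
  funext i
  cases h : S.idxFun i <;> simp [subspaceComp, Subspace.apply_def, h]

/-- Prepending fixed values to a combinatorial subspace. -/
def subspaceCons (u : ι → α) (T : Subspace η α ι') : Subspace η α (ι ⊕ ι') where
  idxFun := Sum.elim (fun i => Sum.inl (u i)) T.idxFun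
  proper e := by
    obtain ⟨i, hi⟩ := T.proper e
    exact ⟨Sum.inr i, by simp [hi]⟩

lemma subspaceCons_apply (u : ι → α) (T : Subspace η α ι') (t : η → α) :
    subspaceCons u T t = Sum.elim u (T t) := by
  funext i
  rcases i with i | i <;> simp [subspaceCons, Subspace.apply_def]

/-- Appending fixed values to a combinatorial subspace. -/
def subspaceSnoc (T : Subspace η α ι) (u : ι' → α) : Subspace η α (ι ⊕ ι') where
  idxFun := Sum.elim T.idxFun (fun i => Sum.inl (u i))
  proper e := by
    obtain ⟨i, hi⟩ := T.proper e
    exact ⟨Sum.inl i, by simp [hi]⟩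

lemma subspaceSnoc_apply (T : Subspace η α ι) (u : ι' → α) (t : η → α) :
    subspaceSnoc T u t = Sum.elim (T t) u := by
  funext i
  rcases i with i | i <;> simp [subspaceSnoc, Subspace.apply_def]

/-- Changing the coordinates of a combinatorial subspace. -/
def subspacePull (e : ι ≃ ι') (S : Subspace η α ι') : Subspace η α ι :=
  S.reindex (Equiv.refl _) (Equiv.refl _) e.symm

lemma subspacePull_apply (e : ι ≃ ι') (S : Subspace η α ι') (t : η → α) :
    subspacePull e S t = S t ∘ e := by
  funext i
  simp [subspacePull]

lemma exists_equiv_fin_sum [Finite ι] {n m : ℕ} (h : n + m ≤ Nat.card ι) :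
    ∃ l, m ≤ l ∧ Nonempty (ι ≃ Fin n ⊕ Fin l) := by
  refine ⟨Nat.card ι - n, by omega, ⟨(Finite.equivFin ι).trans ?_⟩⟩
  exact (finCongr (by omega)).trans finSumFinEquiv.symm

lemma avg_comp_equiv [Finite ι] [Finite ι'] [Finite α] (e : ι ≃ ι') (f : (ι → α) → ℝ) :
    (avg fun x : ι' → α => f (x ∘ e)) = avg f :=
  avg_equiv (e.symm.arrowCongr (Equiv.refl α)) f

lemma avg_sum_arrow [Finite ι] [Finite ι'] [Finite α] (f : (ι ⊕ ι' → α) → ℝ) :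
    avg f = avg fun x => avg fun y => f (Sum.elim x y) := by
  rw [← avg_equiv (Equiv.sumArrowEquivProdArrow ι ι' α).symm, avg_prod]
  rfl

lemma setDens_comp_equiv [Finite ι] [Finite ι'] [Finite α] (e : ι ≃ ι') (A : Set (ι → α)) :
    setDens {x : ι' → α | x ∘ e ∈ A} = setDens A :=
  avg_comp_equiv e fun x => if x ∈ A then 1 else 0

lemma setDens_sum_arrow [Finite ι] [Finite ι'] [Finite α] (A : Set (ι ⊕ ι' → α)) :
    setDens A = avg fun y : ι' → α => setDens {x : ι → α | Sum.elim x y ∈ A} := by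
  rw [setDens, avg_sum_arrow, avg_comm]
  rfl

lemma setDens_sum_arrow' [Finite ι] [Finite ι'] [Finite α] (A : Set (ι ⊕ ι' → α)) :
    setDens A = avg fun x : ι → α => setDens {y : ι' → α | Sum.elim x y ∈ A} := by
  rw [setDens, avg_sum_arrow]
  rfl

/-- Dense sets of words contain subspaces with parameters indexed by `η`. -/
def DensityHJ (η α : Type) [Finite α] : Prop :=
  ∀ δ : ℝ, 0 < δ → ∃ n : ℕ, ∀ (ι : Type) [Finite ι], n ≤ Nat.card ι → ∀ A : Set (ι → α),
    δ ≤ setDens A → ∃ S : Subspace η α ι, ∀ t, S t ∈ A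

/-- If every dense set in a class of sets over `n` coordinates contains a subspace, then
every dense set has many fibres over one common subspace. -/
lemma exists_subspace_setDens_fibre [Finite α] [Finite η] [Finite ι] [Finite ι'] {δ : ℝ} (hδ : 0 < δ)
    (A : Set (ι ⊕ ι' → α)) (hA : δ ≤ setDens A)
    (h : ∀ y : ι' → α, δ / 2 ≤ setDens {x : ι → α | Sum.elim x y ∈ A} →
      ∃ S : Subspace η α ι, ∀ t, Sum.elim (S t) y ∈ A) :
    ∃ S : Subspace η α ι, δ / 2 / Nat.card (Subspace η α ι) ≤
      setDens {y : ι' → α | ∀ t, Sum.elim (S t) y ∈ A} := by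
  rw [setDens_sum_arrow] at hA
  have h1 := half_le_setDens_setOf_half_le (fun y => setDens_le_one _) hδ hA
  exact exists_setDens_ge_of_forall_exists (half_pos hδ)
    (h1.trans (setDens_mono fun y hy => h y hy))

lemma DensityHJ.sum [Finite α] [Finite η] (h : DensityHJ η α) (h' : DensityHJ η' α) :
    DensityHJ (η ⊕ η') α := by
  intro δ hδ
  obtain ⟨n, hn⟩ := h (δ / 2) (half_pos hδ)
  by_cases hK : Nat.card (Subspace η α (Fin n)) = 0
  · refine ⟨n, fun ι _ hι A hA => ?_⟩
    obtain ⟨l, -, ⟨e⟩⟩ := exists_equiv_fin_sum (n := n) (m := 0) hι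
    rw [← setDens_comp_equiv e] at hA
    obtain ⟨S, hS⟩ := exists_subspace_setDens_fibre hδ _ hA fun y hy => hn (Fin n) (by simp) _ hy
    have : Nonempty (Subspace η α (Fin n)) := ⟨S⟩
    exact absurd hK Nat.card_pos.ne'
  · obtain ⟨m, hm⟩ := h' (δ / 2 / Nat.card (Subspace η α (Fin n))) (by positivity)
    refine ⟨n + m, fun ι _ hι A hA => ?_⟩
    obtain ⟨l, hl, ⟨e⟩⟩ := exists_equiv_fin_sum hι
    rw [← setDens_comp_equiv e] at hA
    obtain ⟨S, hS⟩ := exists_subspace_setDens_fibre hδ _ hA fun y hy => hn (Fin n) (by simp) _ hy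
    obtain ⟨T, hT⟩ := hm (Fin l) (by simpa) _ hS
    refine ⟨subspacePull e (subspaceSum S T), fun t => ?_⟩
    rw [subspacePull_apply, subspaceSum_apply]
    exact hT (t ∘ Sum.inr) (t ∘ Sum.inl)

lemma DensityHJ.congr [Finite α] (e : η ≃ η') (h : DensityHJ η α) : DensityHJ η' α := by
  intro δ hδ
  obtain ⟨n, hn⟩ := h δ hδ
  refine ⟨n, fun ι _ hι A hA => ?_⟩
  obtain ⟨S, hS⟩ := hn ι hι A hA
  refine ⟨S.reindex e (Equiv.refl _) (Equiv.refl _), fun t => ?_⟩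
  convert hS (t ∘ e)
  ext i
  simp

lemma DensityHJ.congr_alphabet [Finite α] [Finite β] (e : α ≃ β) (h : DensityHJ η α) :
    DensityHJ η β := by
  intro δ hδ
  obtain ⟨n, hn⟩ := h δ hδ
  refine ⟨n, fun ι _ hι A hA => ?_⟩
  obtain ⟨S, hS⟩ := hn ι hι {x | e ∘ x ∈ A} (hA.trans_eq
    (setDens_equiv ((Equiv.refl ι).arrowCongr e) A).symm)
  refine ⟨S.reindex (Equiv.refl _) e (Equiv.refl _), fun t => ?_⟩
  have h1 : e ∘ S (e.symm ∘ t) ∈ A := hS (e.symm ∘ t)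
  convert h1
  ext i
  simp

lemma DensityHJ.multidim [Finite α] (h : DensityHJ Unit α) (r : ℕ) : DensityHJ (Fin r) α := by
  induction r with
  | zero =>
    refine fun δ hδ => ⟨0, fun ι _ _ A hA => ?_⟩
    obtain ⟨x, hx⟩ := nonempty_of_setDens_pos (hδ.trans_le hA)
    exact ⟨⟨fun i => Sum.inl (x i), fun e => e.elim0⟩, fun t => hx⟩
  | succ r ih =>
    exact (ih.sum h).congr ((Equiv.sumCongr (Equiv.refl _) (Equiv.ofUnique Unit (Fin 1))).trans
      finSumFinEquiv)

/-- Replacing every occurrence of `none` by the letter `a`. -/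
def replaceNone (a : α) (x : ι → Option α) : ι → Option α := fun i => some ((x i).getD a)

/-- Membership in `D` does not change when `none` is replaced by `a`. -/
def Insensitive (a : α) (D : Set (ι → Option α)) : Prop := ∀ x, x ∈ D ↔ replaceNone a x ∈ D

lemma Insensitive.preimage {a : α} {D : Set (ι → Option α)} (hD : Insensitive a D)
    (S : Subspace η (Option α) ι) : Insensitive a {t | S t ∈ D} := by
  intro t
  change S t ∈ D ↔ S (replaceNone a t) ∈ D
  rw [hD (S t), hD (S (replaceNone a t))]
  have : replaceNone a (S t) = replaceNone a (S (replaceNone a t)) := by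
    funext i
    cases h : S.idxFun i <;> simp [replaceNone, Subspace.apply_def, h]
  rw [this]

lemma Insensitive.compl {a : α} {D : Set (ι → Option α)} (hD : Insensitive a D) :
    Insensitive a Dᶜ := fun x => (hD x).not

/-- Few words have few coordinates that differ from `none`. -/
lemma setDens_card_ne_none_lt [Finite α] [Nonempty α] [Finite ι] (n : ℕ) :
    setDens {c : ι → Option α | Nat.card {i // c i ≠ none} < n} ≤
      2 ^ n * (3 / 4 : ℝ) ^ Nat.card ι := by
  have := Fintype.ofFinite ι
  have := Fintype.ofFinite α
  let f : Option α → ℝ := fun z => if z = none then 1 else 1 / 2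
  have hf : avg f ≤ 3 / 4 := by
    rw [avg_eq_sum_div, Fintype.sum_option, Fintype.card_option]
    have : (1 : ℝ) ≤ Fintype.card α := by exact_mod_cast Fintype.card_pos
    simp only [f, if_true, reduceCtorEq, if_false, Finset.sum_const, Finset.card_univ,
      nsmul_eq_mul]
    push_cast
    rw [div_le_div_iff₀ (by positivity) (by norm_num)]
    linarith
  have hf0 : 0 ≤ avg f := avg_nonneg fun z => by simp only [f]; split_ifs <;> norm_num
  calc _ ≤ avg fun c : ι → Option α => 2 ^ n * ∏ i, f (c i) := by
        refine avg_mono fun c => ?_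
        have h : ∏ i, f (c i) = (1 / 2) ^ Nat.card {i // c i ≠ none} := by
          simp only [f, Finset.prod_ite, Finset.prod_const_one, one_mul, Finset.prod_const]
          rw [Nat.card_eq_fintype_card, Fintype.card_subtype]
        rw [h]
        split_ifs with hc
        · have hc : Nat.card {i // c i ≠ none} < n := hc
          calc (1 : ℝ) = 2 ^ n * (1 / 2) ^ n := by rw [← mul_pow]; norm_num
            _ ≤ _ := by
              gcongr 2 ^ n * ?_
              exact pow_le_pow_of_le_one (by norm_num) (by norm_num) hc.le
        · positivity
    _ = 2 ^ n * avg f ^ Nat.card ι := by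
        rw [avg_mul_left, avg_pi_prod (fun _ => f), Finset.prod_const, Finset.card_univ,
          Nat.card_eq_fintype_card]
    _ ≤ _ := by gcongr

/-- Overwriting the non-`none` letters of `c`. -/
def overwrite (c : ι → Option α) (u : ι → α) : ι → Option α :=
  fun i => if c i = none then none else some (u i)

lemma avg_overwrite [Finite α] [Finite ι] [Nonempty α] (f : (ι → Option α) → ℝ) :
    (avg fun c => avg fun u => f (overwrite c u)) = avg f := by
  let s : Option α × α → Option α × α := fun p => p.1.elim (none, p.2) fun v => (some p.2, v)
  have hs : Function.Involutive s := by
    rintro ⟨_ | v, u⟩ <;> rfl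
  let e : (ι → Option α) × (ι → α) ≃ (ι → Option α) × (ι → α) :=
    (Equiv.arrowProdEquivProdArrow ι (fun _ => Option α) (fun _ => α)).symm.trans
      (((Equiv.refl ι).arrowCongr hs.toPerm).trans
        (Equiv.arrowProdEquivProdArrow ι (fun _ => Option α) (fun _ => α)))
  have h := avg_equiv e fun p => f p.1
  rw [avg_prod, avg_prod] at h
  simp only [avg_const] at h
  rw [← h]
  refine avg_congr fun c => avg_congr fun u => congrArg f (funext fun i => ?_)
  change _ = (s (c i, u i)).1
  cases hc : c i <;> simp [s, overwrite, hc]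

/-- Dense insensitive sets contain subspaces over the larger alphabet. -/
lemma exists_subspace_of_insensitive [Finite α] [Nonempty α] (h : DensityHJ η α) {γ : ℝ}
    (hγ : 0 < γ) : ∃ n : ℕ, ∀ (ι : Type) [Finite ι], n ≤ Nat.card ι → ∀ (a : α)
      (D : Set (ι → Option α)), Insensitive a D → γ ≤ setDens D →
      ∃ S : Subspace η (Option α) ι, ∀ t, S t ∈ D := by
  obtain ⟨n, hn⟩ := h (γ / 2) (half_pos hγ)
  have hlim := (tendsto_pow_atTop_nhds_zero_of_lt_one (by norm_num : (0 : ℝ) ≤ 3 / 4)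
    (by norm_num)).const_mul ((2 : ℝ) ^ n)
  rw [mul_zero] at hlim
  obtain ⟨M, hM⟩ := eventually_atTop.1 (hlim.eventually_lt_const (half_pos hγ))
  refine ⟨M, fun ι _ hι a D hD hdens => ?_⟩
  obtain ⟨B, hB⟩ : ∃ B, B = {c : ι → Option α | Nat.card {i // c i ≠ none} < n} := ⟨_, rfl⟩
  have hsmall := (setDens_card_ne_none_lt (α := α) (ι := ι) n).trans_lt (hM (Nat.card ι) hι)
  rw [← hB] at hsmall
  obtain ⟨c, hc, hcD⟩ : ∃ c : ι → Option α, n ≤ Nat.card {i // c i ≠ none} ∧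
      γ / 2 ≤ setDens {u : ι → α | overwrite c u ∈ D} := by
    by_contra! hcon
    have : setDens D ≤ avg fun c : ι → Option α => (if c ∈ B then 1 else 0) + γ / 2 := by
      rw [setDens, ← avg_overwrite]
      refine avg_mono fun c => ?_
      by_cases hc : c ∈ B
      · simp only [hc, if_true]
        exact (setDens_le_one {u : ι → α | overwrite c u ∈ D}).trans (by linarith)
      · simp only [hc, if_false, zero_add]
        rw [hB] at hc
        exact (hcon c (not_lt.1 hc)).le
    rw [avg_add, avg_const] at this
    change _ ≤ setDens B + _ at this
    linarith
  let e : ι ≃ {i // c i ≠ none} ⊕ {i // ¬c i ≠ none} := (Equiv.sumCompl fun i => c i ≠ none).symm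
  rw [← setDens_comp_equiv e, setDens_sum_arrow] at hcD
  obtain ⟨y, hy⟩ := exists_avg_le (X := {i // ¬c i ≠ none} → α) fun y =>
    setDens (X := {i // c i ≠ none} → α) {x : {i // c i ≠ none} → α | overwrite c (Sum.elim x y ∘ e) ∈ D}
  obtain ⟨S, hS⟩ := hn {i // c i ≠ none} hc _ (hcD.trans hy)
  refine ⟨⟨fun i => if hi : c i ≠ none then (S.idxFun ⟨i, hi⟩).map some id else Sum.inl none,
    fun j => ?_⟩, fun t => ?_⟩
  · obtain ⟨i, hi⟩ := S.proper j
    exact ⟨i.1, by simp [i.2, hi]⟩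
  · have h1 := hS fun j => (t j).getD a
    change overwrite c (Sum.elim _ y ∘ e) ∈ D at h1
    rw [hD] at h1 ⊢
    convert h1 using 1
    funext i
    by_cases hi : c i = none
    · simp [replaceNone, Subspace.apply_def, overwrite, hi]
    · have he : e i = Sum.inl ⟨i, hi⟩ := by
        simp only [e]
        rw [Equiv.symm_apply_eq]; rfl
      cases hS : S.idxFun ⟨i, hi⟩ <;>
        simp [replaceNone, Subspace.apply_def, overwrite, hi, he, hS]

end DensityHalesJewett

section DensityHalesJewett

open Combinatorics

variable {α β η η' ι ι' κ : Type}

lemma subspace_injective (S : Subspace η α ι) : Function.Injective S := fun t t' h => by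
  funext j
  obtain ⟨i, hi⟩ := S.proper j
  simpa [Subspace.apply_def, hi] using congrFun h i

lemma avg_ite_range {X Y : Type*} [Finite X] [Finite Y] {φ : X → Y} (hφ : Function.Injective φ)
    {R : Set Y} (hR : R = Set.range φ) (f : Y → ℝ) : (avg fun y => if y ∈ R then f y else 0) =
      Nat.card X / Nat.card Y * avg fun x => f (φ x) := by
  have := Fintype.ofFinite X
  have := Fintype.ofFinite Y
  have h : (∑ y, if y ∈ R then f y else 0) = ∑ x, f (φ x) := by
    rw [← Finset.sum_filter, ← Finset.sum_image (f := f) (g := φ) (s := univ) hφ.injOn]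
    exact Finset.sum_congr (by ext; simp [hR]) fun _ _ => rfl
  rw [avg_eq_sum_div, avg_eq_sum_div, h, Nat.card_eq_fintype_card, Nat.card_eq_fintype_card]
  rcases isEmpty_or_nonempty X with hX | hX
  · simp
  · field_simp

lemma ite_eq_ite_add_ite {P Q X Y : Prop} [Decidable P] [Decidable Q] [Decidable X] [Decidable Y]
    (v : ℝ) (hQ : Q ↔ P ∧ ¬(X ∧ Y)) (h : X → Y → P) : (if P then v else 0) =
      (if Q then v else 0) + if X then (if Y then v else 0) else 0 := by
  by_cases hX : X <;> by_cases hY : Y <;> by_cases hP : P <;> simp_all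

/-- A function whose mean is nonpositive on every subspace inside an insensitive set has a
small mean over that set. -/
lemma avg_insensitive_le [Finite α] [Nonempty α] (h : DensityHJ Unit α) (r : ℕ) {γ : ℝ}
    (hγ : 0 < γ) : ∃ M : ℕ, ∀ (ι : Type) [Finite ι], M ≤ Nat.card ι →
      ∀ (a : α) (D : Set (ι → Option α)) (g : (ι → Option α) → ℝ), Insensitive a D →
      (∀ x, g x ≤ 1) →
      (∀ S : Subspace (Fin r) (Option α) ι, (∀ t, S t ∈ D) → (avg fun t => g (S t)) ≤ 0) →
      (avg fun x => if x ∈ D then g x else 0) ≤ γ := by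
  obtain ⟨n, hn⟩ := exists_subspace_of_insensitive (h.multidim r) (half_pos (half_pos hγ))
  set K := Nat.card (Subspace (Fin r) (Option α) (Fin n)) with hK
  set c : ℝ := (1 / Nat.card (Fin n → Option α)) * (γ / 2 / 2 / (K + 1)) with hc
  have hBpos : (0 : ℝ) < Nat.card (Fin n → Option α) := by exact_mod_cast Nat.card_pos
  have hBone : (1 : ℝ) ≤ Nat.card (Fin n → Option α) := by exact_mod_cast Nat.card_pos
  have hcpos : 0 < c := by positivity
  suffices H : γ / 2 < 1 → ∀ q : ℕ, ∃ M : ℕ, ∀ (ι : Type) [Finite ι], M ≤ Nat.card ι →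
      ∀ (a : α) (D : Set (ι → Option α)) (g : (ι → Option α) → ℝ), Insensitive a D →
      (∀ x, g x ≤ 1) →
      (∀ S : Subspace (Fin r) (Option α) ι, (∀ t, S t ∈ D) → (avg fun t => g (S t)) ≤ 0) →
      (avg fun x => if x ∈ D then g x else 0) ≤ γ / 2 + (1 - c) ^ q * setDens D by
    by_cases h2 : γ / 2 < 1
    · have hc1 : c < 1 := by
        have h1 : 1 / (Nat.card (Fin n → Option α) : ℝ) ≤ 1 := by
          rw [div_le_one hBpos]; exact hBone
        have h3 : γ / 2 / 2 / ((K : ℝ) + 1) ≤ γ / 2 / 2 :=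
          div_le_self (by positivity) (by linarith [(Nat.cast_nonneg K : (0:ℝ) ≤ K)])
        calc c ≤ 1 * (γ / 2 / 2 / ((K : ℝ) + 1)) := by
              rw [hc]; gcongr
          _ < 1 := by linarith
      obtain ⟨q, hq⟩ := exists_pow_lt_of_lt_one (half_pos hγ) (by linarith : 1 - c < 1)
      obtain ⟨M, hM⟩ := H h2 q
      refine ⟨M, fun ι _ hι a D g hD hg hS => (hM ι hι a D g hD hg hS).trans ?_⟩
      have : (1 - c) ^ q * setDens D ≤ (1 - c) ^ q * 1 := by
        have : 0 ≤ 1 - c := by linarith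
        gcongr
        exact setDens_le_one D
      linarith
    · refine ⟨0, fun ι _ _ a D g hD hg hS => ?_⟩
      refine (avg_le_of_forall_le zero_le_one fun x => ?_).trans (by linarith : 1 ≤ γ)
      split_ifs
      exacts [hg x, zero_le_one]
  intro hγ1 q
  have hbasic : ∀ (ι : Type) [Finite ι] (D : Set (ι → Option α)) (g : (ι → Option α) → ℝ),
      (∀ x, g x ≤ 1) → (avg fun x => if x ∈ D then g x else 0) ≤ setDens D := by
    intro ι _ D g hg
    refine avg_mono fun x => ?_
    split_ifs
    exacts [hg x, le_rfl]
  induction q with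
  | zero =>
    refine ⟨0, fun ι _ _ a D g hD hg hS => (hbasic ι D g hg).trans ?_⟩
    rw [pow_zero, one_mul]
    linarith
  | succ q ih =>
    obtain ⟨M, hM⟩ := ih
    refine ⟨n + M, fun ι _ hι a D g hD hg hS => ?_⟩
    have hc1 : 0 ≤ 1 - c := by
      have h1 : 1 / (Nat.card (Fin n → Option α) : ℝ) ≤ 1 := by
        rw [div_le_one hBpos]; exact hBone
      have h3 : γ / 2 / 2 / ((K : ℝ) + 1) ≤ γ / 2 / 2 :=
        div_le_self (by positivity) (by linarith [(Nat.cast_nonneg K : (0:ℝ) ≤ K)])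
      have : c ≤ 1 * (γ / 2 / 2 / ((K : ℝ) + 1)) := by
        rw [hc]; gcongr
      linarith
    rcases le_or_gt (setDens D) (γ / 2) with hsmall | hbig
    · refine (hbasic ι D g hg).trans (hsmall.trans ?_)
      have := mul_nonneg (pow_nonneg hc1 (q + 1)) (setDens_nonneg D)
      linarith
    obtain ⟨l, hl, ⟨e⟩⟩ := exists_equiv_fin_sum hι
    obtain ⟨D', hD'⟩ : ∃ D' : Set (Fin n ⊕ Fin l → Option α), D' = {x | x ∘ e ∈ D} := ⟨_, rfl⟩
    have hDD : setDens D' = setDens D := by rw [hD', setDens_comp_equiv]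
    have hD'i : Insensitive a D' := fun x => by rw [hD']; exact hD (x ∘ e)
    have hS' : ∀ S : Subspace (Fin r) (Option α) (Fin n ⊕ Fin l), (∀ t, S t ∈ D') →
        (avg fun t => g (S t ∘ e)) ≤ 0 := fun S hSD => by
      have := hS (subspacePull e S) fun t => by
        rw [subspacePull_apply]
        have := hSD t
        rw [hD'] at this
        exact this
      simpa only [subspacePull_apply] using this
    obtain ⟨S, hSdens⟩ := exists_subspace_setDens_fibre (half_pos hγ) D' (hDD ▸ hbig.le)
      fun y hy => hn (Fin n) (by simp) a {x | Sum.elim x y ∈ D'} (fun x => by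
        have h1 := hD'i (Sum.elim x y)
        have h2 := hD'i (Sum.elim (replaceNone a x) y)
        have h3 : replaceNone a (Sum.elim x y) =
            replaceNone a (Sum.elim (replaceNone a x) y) := by
          funext i; rcases i with i | i <;> simp [replaceNone]
        change Sum.elim x y ∈ D' ↔ Sum.elim (replaceNone a x) y ∈ D'
        rw [h1, h2, h3]) hy
    obtain ⟨Y, hY⟩ : ∃ Y : Set (Fin l → Option α), Y = {y | ∀ t, Sum.elim (S t) y ∈ D'} := ⟨_, rfl⟩
    rw [← hY, ← hK] at hSdens
    have hYi : Insensitive a Y := fun y => by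
      rw [hY]
      refine forall_congr' fun t => ?_
      have h1 := hD'i (Sum.elim (S t) y)
      have h2 := hD'i (Sum.elim (S t) (replaceNone a y))
      have h3 : replaceNone a (Sum.elim (S t) y) =
          replaceNone a (Sum.elim (S t) (replaceNone a y)) := by
        funext i; rcases i with i | i <;> simp [replaceNone]
      rw [h1, h2, h3]
    obtain ⟨R, hR⟩ : ∃ R : Set (Fin n → Option α), R = Set.range S := ⟨_, rfl⟩
    obtain ⟨E, hE⟩ : ∃ E : (Fin n → Option α) → Set (Fin l → Option α),
      E = fun x => {y | Sum.elim x y ∈ D' ∧ ¬(x ∈ R ∧ y ∈ Y)} := ⟨_, rfl⟩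
    have hEi : ∀ x, Insensitive a (E x) := fun x y => by
      have h1 := hD'i (Sum.elim x y)
      have h2 := hD'i (Sum.elim x (replaceNone a y))
      have h3 : replaceNone a (Sum.elim x y) =
          replaceNone a (Sum.elim x (replaceNone a y)) := by
        funext i; rcases i with i | i <;> simp [replaceNone]
      rw [hE]
      change (_ ∧ _) ↔ (_ ∧ _)
      rw [← hYi y, h1, h2, h3]
    have hYD : ∀ x y, x ∈ R → y ∈ Y → Sum.elim x y ∈ D' := by
      rw [hR]
      rintro x y ⟨t, rfl⟩ hy
      rw [hY] at hy
      exact hy t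
    rw [← hDD, ← avg_comp_equiv e, avg_sum_arrow]
    have hEiff : ∀ x y, y ∈ E x ↔ Sum.elim x y ∈ D' ∧ ¬(x ∈ R ∧ y ∈ Y) := fun x y => by
      rw [hE]; rfl
    have hsplit : ∀ x y, (if Sum.elim x y ∘ e ∈ D then g (Sum.elim x y ∘ e) else 0) =
        (if y ∈ E x then g (Sum.elim x y ∘ e) else 0) +
        (if x ∈ R then (if y ∈ Y then g (Sum.elim x y ∘ e) else 0) else 0) := fun x y =>
      ite_eq_ite_add_ite _ ((hEiff x y).trans (by rw [hD']; rfl))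
        fun hx hy => by simpa [hD'] using hYD x y hx hy
    have hsplit' : ∀ x y, (if Sum.elim x y ∈ D' then (1 : ℝ) else 0) =
        (if y ∈ E x then 1 else 0) + (if x ∈ R then (if y ∈ Y then 1 else 0) else 0) :=
      fun x y => ite_eq_ite_add_ite _ (hEiff x y) (hYD x y)
    simp only [hsplit, avg_add]
    have hout : ∀ (x : Fin n → Option α) (f : (Fin l → Option α) → ℝ),
        (avg fun y => if x ∈ R then f y else 0) =
          if x ∈ R then avg f else 0 := fun x f => by
      split_ifs <;> simp [avg_zero]
    have hdens : setDens D' = (avg fun x => setDens (E x)) +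
        Nat.card (Fin r → Option α) / Nat.card (Fin n → Option α) * setDens Y := by
      rw [setDens, avg_sum_arrow]
      simp only [hsplit', avg_add, hout]
      congr 1
      exact (avg_ite_range (subspace_injective S) hR fun _ => setDens Y).trans
        (by rw [avg_const])
    have h1 : (avg fun x => avg fun y => if y ∈ E x then g (Sum.elim x y ∘ e) else 0) ≤
        γ / 2 + (1 - c) ^ q * avg fun x => setDens (E x) := by
      rw [← avg_mul_left, ← avg_const (X := Fin n → Option α) (γ / 2), ← avg_add]
      refine avg_mono fun x => ?_
      refine hM (Fin l) (by simpa) a (E x) (fun y => g (Sum.elim x y ∘ e)) (hEi x)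
        (fun y => hg _) fun T hT => ?_
      have := hS' (subspaceCons x T) fun t => by
        rw [subspaceCons_apply]
        have := hT t
        rw [hE] at this
        exact this.1
      simpa only [subspaceCons_apply] using this
    have h2 : (avg fun x => avg fun y => if x ∈ R then
        (if y ∈ Y then g (Sum.elim x y ∘ e) else 0) else 0) ≤ 0 := by
      simp only [hout]
      rw [avg_ite_range (subspace_injective S) hR fun x => avg fun y =>
        if y ∈ Y then g (Sum.elim x y ∘ e) else 0, avg_comm]
      refine mul_nonpos_of_nonneg_of_nonpos (by positivity)
        (avg_le_of_forall_le le_rfl fun y => ?_)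
      by_cases hy : y ∈ Y
      · simp only [hy, if_true]
        have := hS' (subspaceSnoc S y) fun t => by
          rw [subspaceSnoc_apply]
          exact hYD _ _ (hR ▸ ⟨t, rfl⟩) hy
        simpa only [subspaceSnoc_apply] using this
      · simp only [hy, if_false, avg_zero, le_refl]
    have h3 : c * setDens D' ≤ Nat.card (Fin r → Option α) / Nat.card (Fin n → Option α) *
        setDens Y := by
      have hr : (1 : ℝ) ≤ Nat.card (Fin r → Option α) := by exact_mod_cast Nat.card_pos
      have hKpos : (0 : ℝ) < K := by
        have : Nonempty (Subspace (Fin r) (Option α) (Fin n)) := ⟨S⟩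
        rw [hK]
        exact_mod_cast Nat.card_pos
      calc c * setDens D' ≤ c * 1 := by gcongr; exact setDens_le_one _
        _ ≤ (1 / Nat.card (Fin n → Option α)) * (γ / 2 / 2 / K) := by
          rw [hc, mul_one]
          gcongr
          linarith
        _ ≤ _ := by gcongr
    have h4 : (1 - c) ^ q * (avg fun x => setDens (E x)) ≤ (1 - c) ^ (q + 1) * setDens D' := by
      rw [pow_succ, mul_assoc]
      gcongr
      linarith
    linarith

/-- A function whose mean is nonpositive on every subspace inside an intersection of insensitive
sets has a small mean over that intersection. -/
lemma avg_iInter_insensitive_le [Finite α] [Nonempty α] (h : DensityHJ Unit α) (s : Finset α) :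
    ∀ (r : ℕ) {γ : ℝ}, 0 < γ → ∃ M : ℕ, ∀ (ι : Type) [Finite ι], M ≤ Nat.card ι →
      ∀ (D : α → Set (ι → Option α)) (g : (ι → Option α) → ℝ), (∀ a ∈ s, Insensitive a (D a)) →
      (∀ x, g x ≤ 1) →
      (∀ S : Subspace (Fin r) (Option α) ι, (∀ t, ∀ a ∈ s, S t ∈ D a) →
        (avg fun t => g (S t)) ≤ 0) →
      (avg fun x => if ∀ a ∈ s, x ∈ D a then g x else 0) ≤ γ := by
  induction s using Finset.induction_on with
  | empty =>
    intro r γ hγ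
    obtain ⟨M, hM⟩ := avg_insensitive_le h r hγ
    refine ⟨M, fun ι _ hι D g _ hg hS => ?_⟩
    have := hM ι hι (Classical.arbitrary α) Set.univ g (fun _ => by simp) hg
      fun S _ => hS S (by simp)
    simpa using this
  | insert b s hb ih =>
    intro r γ hγ
    obtain ⟨r', hr'⟩ := ih r (half_pos hγ)
    obtain ⟨M, hM⟩ := avg_insensitive_le h r' (half_pos hγ)
    refine ⟨M, fun ι _ hι D g hD hg hS => ?_⟩
    have := hM ι hι b (D b) (fun x => (if ∀ a ∈ s, x ∈ D a then g x else 0) - γ / 2)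
      (hD b (mem_insert_self _ _)) (fun x => by
        split_ifs <;> linarith [hg x]) (fun S hSb => by
        rw [avg_sub, avg_const, sub_nonpos]
        refine hr' (Fin r') (by simp) (fun a => {t | S t ∈ D a}) (fun t => g (S t))
          (fun a ha => (hD a (mem_insert_of_mem ha)).preimage S) (fun t => hg _) fun T hT => ?_
        have := hS (subspaceComp S T) fun t a ha => by
          rw [subspaceComp_apply]
          rcases Finset.mem_insert.1 ha with rfl | ha
          · exact hSb _
          · exact hT t a ha
        simpa only [subspaceComp_apply] using this)
    have h2 : (avg fun x => if ∀ a ∈ insert b s, x ∈ D a then g x else 0) ≤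
        avg fun x => (if x ∈ D b then (if ∀ a ∈ s, x ∈ D a then g x else 0) - γ / 2 else 0) +
          γ / 2 := by
      refine avg_mono fun x => ?_
      simp only [Finset.forall_mem_insert]
      by_cases h1 : x ∈ D b <;> by_cases h2 : ∀ a ∈ s, x ∈ D a
      · simp [h1]
      · rw [if_neg (fun h => h2 h.2), if_pos h1, if_neg h2]; linarith
      · rw [if_neg (fun h => h1 h.1), if_neg h1]; linarith
      · rw [if_neg (fun h => h1 h.1), if_neg h1]; linarith
    rw [avg_add, avg_const] at h2
    linarith

/-- Evaluating a subspace over `α` at parameters in `Option α`. -/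
def extendWord (V : Subspace η α ι) (t : η → Option α) : ι → Option α :=
  fun i => (V.idxFun i).elim some t

/-- Given finitely many sets of words over `Option α`, either one of them contains a large subspace
having `none` among its constants, or they all miss the proper templates of some subspace
over `α`. -/
lemma exists_subspace_or_avoiding [Finite α] [Nonempty α] (r : ℕ) : ∀ (κ : Type) [Finite κ] (m : ℕ),
    ∃ M : ℕ, ∀ (ι : Type) [Finite ι], M ≤ Nat.card ι → ∀ good : κ → Set (ι → Option α),
      (∃ c, ∃ U : Subspace (Fin m) (Option α) ι, (∃ i, U.idxFun i = Sum.inl none) ∧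
        ∀ t, U t ∈ good c) ∨
      (∃ V : Subspace (Fin r) α ι, ∀ t : Fin r → Option α, (∃ j, t j = none) →
        ∀ c, extendWord V t ∉ good c) := by
  induction r with
  | zero =>
    intro κ _ m
    exact ⟨0, fun ι _ _ good => Or.inr
      ⟨⟨fun _ => Sum.inl (Classical.arbitrary α), fun e => e.elim0⟩, fun t ⟨j, _⟩ => j.elim0⟩⟩
  | succ r ih =>
    intro κ _ m
    obtain ⟨M', hM'⟩ := ih (κ × α) m
    obtain ⟨n, hn⟩ := Subspace.exists_mono_in_high_dimension_fin (Option α) (κ → Prop)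
      (Fin (max M' m))
    refine ⟨n + 1, fun ι _ hι good => ?_⟩
    obtain ⟨l, hl, ⟨e⟩⟩ := exists_equiv_fin_sum hι
    obtain ⟨S, C, hSC⟩ := hn fun x c => (Sum.elim x (fun _ => none)) ∘ e ∈ good c
    have hmono : ∀ x c, (Sum.elim (S x) (fun _ => none)) ∘ e ∈ good c ↔ C c := fun x c => by
      rw [← congrFun (hSC x) c]
    by_cases hC : ∃ c, C c
    · obtain ⟨c, hc⟩ := hC
      left
      let T : Subspace (Fin m) (Option α) (Fin (max M' m)) :=
        ⟨fun i => if h : (i : ℕ) < m then Sum.inr ⟨i, h⟩ else Sum.inl none, fun j =>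
          ⟨⟨j, j.2.trans_le (le_max_right _ _)⟩, by simp⟩⟩
      refine ⟨c, subspacePull e (subspaceSnoc (subspaceComp S T) (fun _ => none)),
        ⟨e.symm (Sum.inr ⟨0, hl⟩), by simp [subspacePull, subspaceSnoc, Subspace.reindex]⟩,
        fun t => ?_⟩
      rw [subspacePull_apply, subspaceSnoc_apply, subspaceComp_apply, hmono]
      exact hc
    push Not at hC
    let W : Option α → (Fin (max M' m) → Option α) → ι → Option α := fun z t i =>
      Sum.elim (fun i => (S.idxFun i).elim (fun b => b.elim z some) t) (fun _ => z) (e i)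
    rcases hM' (Fin (max M' m)) (by simp) (fun p => {t | W (some p.2) t ∈ good p.1}) with
      ⟨⟨c, a⟩, U, ⟨i, hi⟩, hU⟩ | ⟨V, hV⟩
    · left
      refine ⟨c, ⟨fun i => Sum.elim (fun i => (S.idxFun i).elim
        (fun b => Sum.inl (b.elim (some a) some)) U.idxFun) (fun _ => Sum.inl (some a)) (e i),
        fun j => ?_⟩, ?_, fun t => ?_⟩
      · obtain ⟨j', hj'⟩ := U.proper j
        obtain ⟨i', hi'⟩ := S.proper j'
        exact ⟨e.symm (Sum.inl i'), by simp [hi', hj']⟩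
      · obtain ⟨i', hi'⟩ := S.proper i
        exact ⟨e.symm (Sum.inl i'), by simp [hi', hi]⟩
      · have h1 : W (some a) (U t) ∈ good c := hU t
        convert h1 using 1
        funext i
        simp only [Subspace.apply_def, W]
        rcases e i with i | i
        · cases h : S.idxFun i <;> simp [h, Subspace.apply_def]
        · simp
    · right
      refine ⟨⟨fun i => Sum.elim (fun i => (S.idxFun i).elim
        (fun b => b.elim (Sum.inr 0) Sum.inl) (fun j => (V.idxFun j).map id Fin.succ))
        (fun _ => Sum.inr 0) (e i), fun j => ?_⟩, fun t ht c => ?_⟩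
      · refine Fin.cases ⟨e.symm (Sum.inr ⟨0, hl⟩), by simp⟩ (fun j => ?_) j
        obtain ⟨j', hj'⟩ := V.proper j
        obtain ⟨i', hi'⟩ := S.proper j'
        exact ⟨e.symm (Sum.inl i'), by simp [hi', hj']⟩
      · have hW : ∀ (h : _), extendWord (⟨fun i => Sum.elim (fun i => (S.idxFun i).elim
          (fun b => b.elim (Sum.inr 0) Sum.inl) (fun j => (V.idxFun j).map id Fin.succ))
          (fun _ => Sum.inr 0) (e i), h⟩ : Subspace (Fin (r + 1)) α ι) t =
            W (t 0) (extendWord V fun j => t j.succ) := by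
          intro h
          funext i
          simp only [extendWord, W]
          rcases e i with i | i
          · rcases h : S.idxFun i with (_ | b) | j
            · simp [h]
            · simp [h]
            · rcases h' : V.idxFun j with b | j' <;> simp [h, h', extendWord]
          · simp
        rw [hW]
        rcases h0 : t 0 with _ | a
        · have h1 : W none (extendWord V fun j => t j.succ) =
              Sum.elim (S (extendWord V fun j => t j.succ)) (fun _ => none) ∘ e := by
            funext i
            simp only [W, Function.comp]
            rcases e i with i | i
            · rcases h : S.idxFun i with (_ | b) | j <;> simp [h, Subspace.apply_def]
            · simp
          rw [h1, hmono]
          exact hC c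
        · obtain ⟨j, hj⟩ := ht
          have hj0 : j ≠ 0 := by
            rintro rfl
            simp [h0] at hj
          obtain ⟨j', rfl⟩ := Fin.exists_succ_eq.2 hj0
          exact hV (fun j => t j.succ) ⟨j', hj⟩ (c, a)

end DensityHalesJewett

section DensityHalesJewett

open Combinatorics

variable {α β η η' ι ι' κ : Type}

/-- A function whose mean is nonpositive on every subspace has small mean over the complement of an
intersection of insensitive sets. -/
lemma avg_compl_insensitive_le [Finite α] [Nonempty α] (h : DensityHJ Unit α) (r : ℕ) {γ : ℝ}
    (hγ : 0 < γ) : ∃ M : ℕ, ∀ (ι : Type) [Finite ι], M ≤ Nat.card ι →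
      ∀ (D : α → Set (ι → Option α)) (g : (ι → Option α) → ℝ), (∀ a, Insensitive a (D a)) →
      (∀ x, g x ≤ 1) →
      (∀ S : Subspace (Fin r) (Option α) ι, (avg fun t => g (S t)) ≤ 0) →
      (avg fun x => if ∀ a, x ∈ D a then 0 else g x) ≤ γ := by
  have := Fintype.ofFinite α
  have hpos : 0 < γ / (Fintype.card α : ℝ) := div_pos hγ (by exact_mod_cast Fintype.card_pos)
  choose M hM using fun s : Finset α => avg_iInter_insensitive_le h s r hpos
  refine ⟨univ.sup M, fun ι _ hι D g hD hg hS => ?_⟩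
  have key : ∀ s : Finset α, (avg fun x => if ∀ a ∈ s, x ∈ D a then 0 else g x) ≤
      #s * (γ / Fintype.card α) := by
    intro s
    induction s using Finset.induction_on with
    | empty => simp [avg_zero]
    | insert b s hb ih =>
      have h1 := hM (insert b s) ι ((Finset.le_sup (mem_univ _)).trans hι)
        (fun a => if a = b then (D b)ᶜ else D a) g (fun a _ => by
          split_ifs with h
          · rw [h]; exact (hD b).compl
          · exact hD a) hg (fun S _ => hS S)
      rw [Finset.card_insert_of_notMem hb]
      push_cast
      rw [add_mul, one_mul]
      refine le_trans (le_of_eq ?_) (add_le_add ih h1)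
      rw [← avg_add]
      refine avg_congr fun x => ?_
      have h2 : (∀ a ∈ insert b s, x ∈ if a = b then (D b)ᶜ else D a) ↔
          x ∉ D b ∧ ∀ a ∈ s, x ∈ D a := by
        rw [Finset.forall_mem_insert]
        refine and_congr (by simp) (forall₂_congr fun a ha => ?_)
        rw [if_neg (by rintro rfl; exact hb ha)]
      have h3 : (∀ a ∈ insert b s, x ∈ D a) ↔ x ∈ D b ∧ ∀ a ∈ s, x ∈ D a := by
        rw [Finset.forall_mem_insert]
      by_cases h5 : ∀ a ∈ s, x ∈ D a
      · by_cases h4 : x ∈ D b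
        · rw [if_pos (h3.2 ⟨h4, h5⟩), if_pos h5, if_neg fun h => (h2.1 h).1 h4, add_zero]
        · rw [if_neg fun h => h4 (h3.1 h).1, if_pos h5, if_pos (h2.2 ⟨h4, h5⟩), zero_add]
      · rw [if_neg fun h => h5 (h3.1 h).2, if_neg h5, if_neg fun h => h5 (h2.1 h).2, add_zero]
  have := key univ
  rw [Finset.card_univ, mul_div_cancel₀ _ (by positivity)] at this
  refine (avg_congr fun x => ?_).trans_le this
  by_cases h : ∀ a, x ∈ D a
  · rw [if_pos h, if_pos fun a _ => h a]
  · rw [if_neg h, if_neg fun h' => h fun a => h' a (mem_univ a)]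

/-- The template of a line over `α`, as a word over `Option α`. -/
lemma exists_template (V : Subspace η α ι) (l : Subspace Unit α η) :
    ∃ t : η → Option α, (∃ j, t j = none) ∧
      ∀ a, replaceNone a (extendWord V t) = fun i => some (V (l fun _ => a) i) := by
  refine ⟨fun j => (l.idxFun j).elim some fun _ => none, ?_, fun a => ?_⟩
  · obtain ⟨j, hj⟩ := l.proper ()
    exact ⟨j, by simp [hj]⟩
  · funext i
    rcases h : V.idxFun i with b | j
    · simp [replaceNone, extendWord, Subspace.apply_def, h]
    · cases h' : l.idxFun j <;>
        simp [replaceNone, extendWord, Subspace.apply_def, h', h]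

/-- A word over `Option α` with at least one `none` is the template of a line. -/
def lineOfWord (u : ι → Option α) (hu : ∃ i, u i = none) : Subspace Unit (Option α) ι where
  idxFun i := (u i).elim (Sum.inr ()) fun a => Sum.inl (some a)
  proper _ := by
    obtain ⟨i, hi⟩ := hu
    exact ⟨i, by simp [hi]⟩

lemma lineOfWord_apply (u : ι → Option α) (hu : ∃ i, u i = none) (t : Unit → Option α) :
    lineOfWord u hu t = (t ()).elim u fun a => replaceNone a u := by
  funext i
  rcases h : t () with _ | a <;> cases h' : u i <;>
    simp [lineOfWord, Subspace.apply_def, h, h', replaceNone]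

lemma le_of_le_avg_of_forall_le {X : Type*} [Finite X] {f : X → ℝ} {p q : ℝ}
    (h : p ≤ avg f) (hf : ∀ x, f x ≤ q) (x : X) : q - Nat.card X * (q - p) ≤ f x := by
  have := Fintype.ofFinite X
  have hX : Nonempty X := ⟨x⟩
  have h1 : ∑ y, (q - f y) = Fintype.card X * (q - avg f) := by
    rw [sum_eq_card_mul_avg, avg_sub, avg_const]
  have h2 : q - f x ≤ ∑ y, (q - f y) :=
    Finset.single_le_sum (f := fun y => q - f y) (fun y _ => sub_nonneg.2 (hf y)) (mem_univ x)
  rw [Nat.card_eq_fintype_card]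
  have h3 : (Fintype.card X : ℝ) * (q - avg f) ≤ Fintype.card X * (q - p) := by gcongr
  linarith

lemma DensityHJ.option [Finite α] [Nonempty α] (h : DensityHJ Unit α) :
    DensityHJ Unit (Option α) := by
  let P : ℝ → Prop := fun δ => ∃ n : ℕ, ∀ (ι : Type) [Finite ι], n ≤ Nat.card ι →
    ∀ A : Set (ι → Option α), δ ≤ setDens A → ∃ S : Subspace Unit (Option α) ι, ∀ t, S t ∈ A
  have hP2 : P 2 := ⟨0, fun ι _ _ A hA => by linarith [setDens_le_one A]⟩
  have hPmono : ∀ δ δ', δ ≤ δ' → P δ → P δ' := fun δ δ' hδ ⟨n, hn⟩ =>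
    ⟨n, fun ι _ hι A hA => hn ι hι A (hδ.trans hA)⟩
  by_contra hcon
  obtain ⟨δ₀, hδ₀, hPδ₀⟩ : ∃ δ, 0 < δ ∧ ¬P δ := by
    by_contra! h'
    exact hcon h'
  have hbdd : BddBelow {δ | P δ} := ⟨δ₀, fun δ hδ => by
    by_contra! hlt
    exact hPδ₀ (hPmono _ _ hlt.le hδ)⟩
  obtain ⟨d, hd⟩ : ∃ d, d = sInf {δ | P δ} := ⟨_, rfl⟩
  have hd0 : 0 < d := hδ₀.trans_le (hd ▸ le_csInf ⟨2, hP2⟩ fun δ hδ => by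
    by_contra! hlt
    exact hPδ₀ (hPmono _ _ hlt.le hδ))
  have hgt : ∀ δ, d < δ → P δ := fun δ hδ => by
    obtain ⟨δ', h1, h2⟩ := exists_lt_of_csInf_lt ⟨2, hP2⟩ (hd ▸ hδ)
    exact hPmono _ _ h2.le h1
  have hlt : ∀ δ, δ < d → ¬P δ := fun δ hδ hPδ => (csInf_le hbdd hPδ).not_gt (hd ▸ hδ)
  have hd1 : d ≤ 1 := by
    by_contra! h1
    refine hlt ((d + 1) / 2) (by linarith) ⟨0, fun ι _ _ A hA => ?_⟩
    linarith [setDens_le_one A]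
  obtain ⟨m₀, hm₀⟩ := h (d / 2 / 2) (by positivity)
  set K := Nat.card (Subspace Unit α (Fin m₀)) with hK
  obtain ⟨θ, hθ⟩ : ∃ θ : ℝ, θ = d / 2 / 2 / (K + 1) := ⟨_, rfl⟩
  have hθ0 : 0 < θ := by rw [hθ]; positivity
  have hθ1 : θ ≤ 1 := by
    rw [hθ, div_le_one (by positivity)]
    linarith [(Nat.cast_nonneg K : (0 : ℝ) ≤ K)]
  have hdθ : 0 < d * θ := by positivity
  have hdθ1 : d * θ ≤ d := by nlinarith
  obtain ⟨n₁, hn₁⟩ := hgt (d + d * θ / 8) (by linarith)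
  obtain ⟨m, hm⟩ := avg_compl_insensitive_le h n₁ (by positivity : 0 < d * θ / 4)
  obtain ⟨M, hM⟩ := exists_subspace_or_avoiding (α := α) m₀ Unit m
  set B := Nat.card (Fin M → Option α) with hB
  have hB0 : (1 : ℝ) ≤ B := by exact_mod_cast Nat.card_pos
  obtain ⟨e, he⟩ : ∃ e : ℝ, e = d * θ / 16 / B := ⟨_, rfl⟩
  have he0 : 0 < e := by rw [he]; positivity
  have heB : B * e = d * θ / 16 := by rw [he]; field_simp
  obtain ⟨n₂, hn₂⟩ := hgt (d + e) (by linarith)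
  have hfail := hlt (d - e) (by linarith)
  simp only [P, not_exists, not_forall] at hfail
  obtain ⟨ι, _, hι, A, hA, hline⟩ := hfail (M + n₂)
  obtain ⟨l, hl, ⟨f⟩⟩ := exists_equiv_fin_sum hι
  have hline' : ∀ S : Subspace Unit (Option α) (Fin M ⊕ Fin l), ∃ t, S t ∘ f ∉ A := fun S => by
    have := hline (subspacePull f S)
    simpa only [subspacePull_apply] using this
  rw [← setDens_comp_equiv f, setDens_sum_arrow'] at hA
  obtain ⟨s, hs⟩ : ∃ s : (Fin M → Option α) → Set (Fin l → Option α),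
    s = fun w => {y | Sum.elim w y ∘ f ∈ A} := ⟨_, rfl⟩
  have hslice : ∀ w, d - d * θ / 8 ≤ setDens (s w) := by
    intro w
    have h1 : ∀ w, setDens (s w) ≤ d + e := fun w => by
      by_contra! hw
      obtain ⟨S, hS⟩ := hn₂ (Fin l) (by simpa) (s w) hw.le
      obtain ⟨t, ht⟩ := hline' (subspaceCons w S)
      rw [subspaceCons_apply] at ht
      have := hS t
      rw [hs] at this
      exact ht this
    have h2 : d - e ≤ avg fun w => setDens (s w) := by rw [hs]; exact hA
    have h3 := le_of_le_avg_of_forall_le h2 h1 w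
    rw [← hB] at h3
    have h4 : d + e - B * (d + e - (d - e)) = d + e - 2 * (B * e) := by ring
    rw [h4, heB] at h3
    linarith
  obtain ⟨good, hgood⟩ : ∃ good : Set (Fin M → Option α),
    good = {t | θ ≤ setDens {y | ∀ a, y ∈ s (replaceNone a t)}} := ⟨_, rfl⟩
  obtain ⟨-, U, hU0, hU⟩ | ⟨V, hV⟩ := hM (Fin M) (by simp) fun _ => good
  swap
  · obtain ⟨A', hA'⟩ : ∃ A' : Set ((Fin m₀ → α) × (Fin l → Option α)),
      A' = {p | p.2 ∈ s fun i => some (V p.1 i)} := ⟨_, rfl⟩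
    have h1 : d / 2 ≤ avg fun y => setDens {x | (x, y) ∈ A'} := by
      rw [← setDens_prod, setDens_prod', hA']
      refine le_avg_of_forall_le fun x => ?_
      have := hslice fun i => some (V x i)
      exact le_trans (by linarith) this
    have h2 := half_le_setDens_setOf_half_le (fun y => setDens_le_one _) (half_pos hd0) h1
    obtain ⟨S, hS⟩ := exists_setDens_ge_of_forall_exists (half_pos (half_pos hd0))
      (A := fun S : Subspace Unit α (Fin m₀) => {y | ∀ t, (S t, y) ∈ A'})
      (h2.trans (setDens_mono fun y hy => hm₀ (Fin m₀) (by simp) _ hy))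
    obtain ⟨t, ht, hta⟩ := exists_template V S
    refine hV t ht () ?_
    rw [hgood]
    change θ ≤ setDens {y | ∀ a, y ∈ s (replaceNone a (extendWord V t))}
    have hK0 : (0 : ℝ) < K := by
      have : Nonempty (Subspace Unit α (Fin m₀)) := ⟨S⟩
      rw [hK]
      exact_mod_cast Nat.card_pos
    calc θ ≤ d / 2 / 2 / K := by
          rw [hθ]
          gcongr
          linarith
      _ ≤ _ := hS
      _ ≤ _ := setDens_mono fun y hy => by
        rw [Set.mem_ofPred_eq] at hy ⊢
        intro a
        rw [hta]
        have := hy fun _ => a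
        rw [hA'] at this
        exact this
  let D : (Fin l → Option α) → α → Set (Fin m → Option α) := fun y a =>
    {t | y ∈ s (replaceNone a (U t))}
  have hD : ∀ y a, Insensitive a (D y a) := fun y a t => by
    have : replaceNone a (U t) = replaceNone a (U (replaceNone a t)) := by
      funext i
      cases h : U.idxFun i <;> simp [replaceNone, Subspace.apply_def, h]
    change y ∈ s _ ↔ y ∈ s _
    rw [this]
  have hDA : ∀ y t, (∀ a, t ∈ D y a) → y ∉ s (U t) := fun y t hty hy => by
    have hnone : ∃ i, U t i = none := by
      obtain ⟨i, hi⟩ := hU0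
      exact ⟨i, by simp [Subspace.apply_def, hi]⟩
    obtain ⟨z, hz⟩ := hline' (subspaceSnoc (lineOfWord (U t) hnone) y)
    rw [subspaceSnoc_apply, lineOfWord_apply] at hz
    rw [hs] at hy
    rcases h : z () with _ | a
    · rw [h] at hz
      exact hz hy
    · rw [h] at hz
      have := hty a
      change y ∈ s _ at this
      rw [hs] at this
      exact hz this
  let g : (Fin l → Option α) → (Fin m → Option α) → ℝ := fun y t =>
    (if y ∈ s (U t) then 1 else 0) - (d + d * θ / 8)
  have hg1 : ∀ y t, g y t ≤ 1 := fun y t => by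
    simp only [g]; split_ifs <;> linarith
  have hmain : d * θ / 2 ≤ avg fun y => avg fun t => if ∀ a, t ∈ D y a then 0 else g y t := by
    have h1 : ∀ y t, (if ∀ a, t ∈ D y a then 0 else g y t) = (if y ∈ s (U t) then 1 else 0) -
        (d + d * θ / 8) + (d + d * θ / 8) * if ∀ a, t ∈ D y a then 1 else 0 := fun y t => by
      by_cases h1 : ∀ a, t ∈ D y a
      · rw [if_pos h1, if_pos h1, if_neg (hDA y t h1)]; ring
      · rw [if_neg h1, if_neg h1]; simp [g]
    rw [avg_comm]
    refine le_avg_of_forall_le fun t => ?_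
    simp only [h1]
    rw [avg_add, avg_sub, avg_const, avg_mul_left]
    have h2 : d - d * θ / 8 ≤ avg fun y => if y ∈ s (U t) then (1 : ℝ) else 0 := hslice (U t)
    have h3 : θ ≤ avg fun y => if ∀ a, t ∈ D y a then (1 : ℝ) else 0 := by
      have := hU t
      rw [hgood] at this
      exact this.trans (by rw [setDens]; exact avg_mono fun y => le_of_eq (by congr))
    nlinarith
  obtain ⟨y, hy⟩ := exists_avg_le fun y => avg fun t => if ∀ a, t ∈ D y a then 0 else g y t
  have hne : ¬∀ S : Subspace (Fin n₁) (Option α) (Fin m), (avg fun t => g y (S t)) ≤ 0 := fun hS => by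
    have := hm (Fin m) (by simp) (D y) (g y) (hD y) (hg1 y) hS
    linarith
  push Not at hne
  obtain ⟨S, hS⟩ := hne
  simp only [g] at hS
  rw [avg_sub, avg_const, sub_pos] at hS
  obtain ⟨T, hT⟩ := hn₁ (Fin n₁) (by simp) {t | y ∈ s (U (S t))}
    (hS.le.trans (by rw [setDens]; exact avg_mono fun y => le_of_eq (by congr)))
  obtain ⟨t, ht⟩ := hline' (subspaceSnoc (subspaceComp U (subspaceComp S T)) y)
  rw [subspaceSnoc_apply, subspaceComp_apply, subspaceComp_apply] at ht
  have := hT t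
  rw [Set.mem_ofPred_eq, hs] at this
  exact ht this

/-- The density Hales–Jewett theorem. -/
theorem densityHJ_unit (α : Type) [Finite α] [Nonempty α] : DensityHJ Unit α := by
  have hsub : ∀ (α : Type) [Finite α] [Subsingleton α], DensityHJ Unit α := fun α _ _ δ hδ =>
    ⟨1, fun ι _ hι A hA => by
      obtain ⟨x, hx⟩ := nonempty_of_setDens_pos (hδ.trans_le hA)
      have : Nonempty ι := (Nat.card_pos_iff.1 (by omega)).1
      exact ⟨⟨fun _ => Sum.inr (), fun _ => ⟨Classical.arbitrary ι, rfl⟩⟩, fun t => by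
        rwa [Subsingleton.elim (Subspace.toFun _ t) x]⟩⟩
  suffices H : ∀ (α : Type) [Finite α], ∀ _ : Finite α, DensityHJ Unit α ∨ IsEmpty α from
    (H α inferInstance).resolve_right (not_isEmpty_iff.2 inferInstance)
  refine Finite.induction_empty_option ?_ ?_ ?_
  · intro α β e h hβ
    have := Finite.of_equiv _ e.symm
    rcases h this with h | h
    · exact Or.inl (h.congr_alphabet e)
    · exact Or.inr e.symm.isEmpty
  · exact fun _ => Or.inr inferInstance
  · intro α _ h hα
    rcases h inferInstance with h | h
    · left
      rcases isEmpty_or_nonempty α with hα | hα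
      · exact hsub _
      · exact h.option
    · exact Or.inl (hsub _)

end DensityHalesJewett

section Varnavides

open Combinatorics

/-- The base point and the difference of the arithmetic progression which is the image of a
combinatorial line under `w ↦ x + ∑ i, w i • d i`, as a function of `(x, d)`. -/
def lineToProgression {k n : ℕ} (S : Subspace Unit (Fin k) (Fin n)) (G : Type) [AddCommGroup G] :
    G × (Fin n → G) →+ G × G where
  toFun p := (p.1 + ∑ i, (S.idxFun i).elim (fun c : Fin k => (c : ℕ) • p.2 i) fun _ => 0,
    ∑ i, (S.idxFun i).elim (fun _ => 0) fun _ => p.2 i)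
  map_zero' := by
    have : ∀ x : Fin k ⊕ Unit, x.elim (fun _ => (0 : G)) (fun _ => 0) = 0 := fun x => by
      cases x <;> rfl
    simp [this]
  map_add' p q := by
    ext
    · simp only [Prod.fst_add, Prod.snd_add, Pi.add_apply]
      rw [add_add_add_comm, ← Finset.sum_add_distrib]
      congr 2
      funext i
      cases S.idxFun i <;> simp
    · simp only [Prod.snd_add, Pi.add_apply]
      rw [← Finset.sum_add_distrib]
      congr 1
      funext i
      cases S.idxFun i <;> simp

lemma lineToProgression_surjective {k n : ℕ} (S : Subspace Unit (Fin k) (Fin n)) (G : Type)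
    [AddCommGroup G] : Function.Surjective (lineToProgression S G) := by
  rintro ⟨a, r⟩
  obtain ⟨i₀, hi₀⟩ := S.proper ()
  refine ⟨(a, Pi.single i₀ r), ?_⟩
  ext
  · simp only [lineToProgression, AddMonoidHom.coe_mk, ZeroHom.coe_mk, add_eq_left]
    refine Finset.sum_eq_zero fun i _ => ?_
    rcases eq_or_ne i i₀ with rfl | h
    · simp [hi₀]
    · cases S.idxFun i <;> simp [h]
  · simp only [lineToProgression, AddMonoidHom.coe_mk, ZeroHom.coe_mk]
    rw [Finset.sum_eq_single i₀ (fun i _ h => by cases S.idxFun i <;> simp [h])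
      fun h => absurd (mem_univ _) h]
    simp [hi₀]

lemma add_sum_subspace_smul {k n : ℕ} (S : Subspace Unit (Fin k) (Fin n)) {G : Type}
    [AddCommGroup G] (p : G × (Fin n → G)) (j : Fin k) :
    p.1 + ∑ i, (S (fun _ => j) i : ℕ) • p.2 i =
      (lineToProgression S G p).1 + (j : ℕ) • (lineToProgression S G p).2 := by
  simp only [lineToProgression, AddMonoidHom.coe_mk, ZeroHom.coe_mk]
  rw [Finset.smul_sum, add_assoc, ← Finset.sum_add_distrib]
  congr 2
  funext i
  cases h : S.idxFun i <;> simp [Subspace.apply_def, h]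

/-- Szemerédi's theorem in Varnavides' form, in an arbitrary finite abelian group. -/
theorem exists_pos_le_avg_prod_progression (k : ℕ) (hk : 0 < k) {δ : ℝ} (hδ : 0 < δ) :
    ∃ c : ℝ, 0 < c ∧ ∀ (G : Type) [AddCommGroup G] [Finite G] (f : G → ℝ), (∀ x, 0 ≤ f x) →
      (∀ x, f x ≤ 1) → δ ≤ avg f →
      c ≤ avg fun p : G × G => ∏ j : Fin k, f (p.1 + (j : ℕ) • p.2) := by
  have : Nonempty (Fin k) := ⟨⟨0, hk⟩⟩
  obtain ⟨n, hn⟩ := densityHJ_unit (Fin k) (δ / 2 / 2) (by positivity)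
  set K := Nat.card (Subspace Unit (Fin k) (Fin n)) with hK
  refine ⟨(δ / 2) ^ k * (δ / 2 / 2 / (K + 1)), by positivity, fun G _ _ f hf0 hf1 hf => ?_⟩
  obtain ⟨A, hA⟩ : ∃ A : Set G, A = {x | δ / 2 ≤ f x} := ⟨_, rfl⟩
  have hAd : δ / 2 ≤ setDens A := hA ▸ half_le_setDens_setOf_half_le hf1 hδ hf
  have h1 : δ / 2 ≤ avg fun p : G × (Fin n → G) =>
      setDens {v : Fin n → Fin k | p.1 + ∑ i, (v i : ℕ) • p.2 i ∈ A} := by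
    unfold setDens
    rw [avg_comm]
    refine le_avg_of_forall_le fun v => ?_
    rw [avg_prod, avg_comm]
    refine le_avg_of_forall_le fun d => hAd.trans (le_of_eq ?_)
    exact (avg_equiv (Equiv.addRight (∑ i, (v i : ℕ) • d i)) fun x => if x ∈ A then (1 : ℝ) else 0).symm
  have h2 := half_le_setDens_setOf_half_le (fun y => setDens_le_one _) (half_pos hδ) h1
  obtain ⟨S, hS⟩ := exists_setDens_ge_of_forall_exists (half_pos (half_pos hδ))
    (A := fun S : Subspace Unit (Fin k) (Fin n) =>
      {p : G × (Fin n → G) | ∀ t, p.1 + ∑ i, (S t i : ℕ) • p.2 i ∈ A})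
    (h2.trans (setDens_mono fun p hp => hn (Fin n) (by simp) _ hp))
  have hK0 : (0 : ℝ) < K := by
    have : Nonempty (Subspace Unit (Fin k) (Fin n)) := ⟨S⟩
    rw [hK]
    exact_mod_cast Nat.card_pos
  rw [← avg_addMonoidHom _ (lineToProgression_surjective S G)]
  have h3 : δ / 2 / 2 / (K + 1) ≤ δ / 2 / 2 / K := by gcongr; linarith
  have h4 := h3.trans hS
  refine (mul_le_mul_of_nonneg_left h4 (by positivity)).trans ?_
  unfold setDens
  rw [← avg_mul_left]
  refine avg_mono fun p => ?_
  split_ifs with hp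
  · rw [mul_one]
    have : (δ / 2) ^ k = ∏ _j : Fin k, δ / 2 := by rw [prod_const, card_univ, Fintype.card_fin]
    rw [this]
    refine Finset.prod_le_prod (fun _ _ => by positivity) fun j _ => ?_
    rw [← add_sum_subspace_smul]
    have := hp fun _ => j
    rw [hA] at this
    exact this
  · rw [mul_zero]
    exact Finset.prod_nonneg fun _ _ => hf0 _

end Varnavides

section GowersCauchySchwarz

variable {G : Type} [Finite G]

/-- The vertex `ω` of the combinatorial cube spanned by `x`. -/
def cubeVertex {n : ℕ} (x : Fin n → Bool → G) (ω : Fin n → Bool) : Fin n → G := fun i => x i (ω i)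

/-- `f` does not depend on the `j`-th coordinate. -/
def IndepCoord {n : ℕ} (j : Fin n) (f : (Fin n → G) → ℝ) : Prop :=
  ∀ x t, f (Function.update x j t) = f x

lemma avg_insertNth {n : ℕ} {K : Type} [Finite K] (e : Fin (n + 1)) (F : (Fin (n + 1) → K) → ℝ) :
    avg F = avg fun y : K => avg fun x : Fin n → K => F (e.insertNth y x) := by
  rw [← avg_equiv (Fin.insertNthEquiv (fun _ => K) e) F, avg_prod]
  rfl

lemma prod_insertNth {n : ℕ} (e : Fin (n + 1)) (F : (Fin (n + 1) → Bool) → ℝ) :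
    ∏ ω, F ω = ∏ ω : Fin n → Bool, ∏ b : Bool, F (e.insertNth b ω) := by
  rw [← (Fin.insertNthEquiv (fun _ => Bool) e).prod_comp, Fintype.prod_prod_type, Finset.prod_comm]
  rfl

lemma cubeVertex_insertNth {n : ℕ} (e : Fin (n + 1)) (z : Bool → G) (x : Fin n → Bool → G)
    (b : Bool) (ω : Fin n → Bool) :
    cubeVertex (e.insertNth (α := fun _ => Bool → G) z x) (e.insertNth (α := fun _ => Bool) b ω) =
      e.insertNth (α := fun _ => G) (z b) (cubeVertex x ω) := by
  rw [Fin.eq_insertNth_iff]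
  refine ⟨by simp [cubeVertex], ?_⟩
  funext i
  simp [cubeVertex, Fin.removeNth]

lemma avg_bool_arrow (K : Bool → G → ℝ) :
    (avg fun z : Bool → G => K false (z false) * K true (z true)) = avg (K false) * avg (K true) := by
  have := avg_pi_prod (A := fun _ : Bool => G) K
  simpa only [Fintype.prod_bool, mul_comm] using this

lemma avg_bool_arrow₂ (K L : G → ℝ) :
    (avg fun z : Bool → G => K (z false) * L (z true)) = avg K * avg L :=
  avg_bool_arrow fun b => cond b L K

lemma avg_eval {ι : Type} [Fintype ι] [Nonempty G] (i : ι) (F : G → ℝ) :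
    (avg fun z : ι → G => F (z i)) = avg F := by
  have := avg_pi_prod (A := fun _ : ι => G) fun j => if j = i then F else fun _ => 1
  rw [Finset.prod_eq_single i (fun j _ h => by rw [if_neg h, avg_const]) (by simp), if_pos rfl] at this
  rw [← this]
  refine avg_congr fun z => ?_
  rw [Finset.prod_eq_single i (fun j _ h => by rw [if_neg h]) (by simp), if_pos rfl]

lemma avg_cubeVertex [Nonempty G] {n : ℕ} (ω : Fin n → Bool) (F : (Fin n → G) → ℝ) :
    (avg fun x : Fin n → Bool → G => F (cubeVertex x ω)) = avg F := by
  induction n with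
  | zero => rw [avg_unique, avg_unique]; congr 1; exact Subsingleton.elim _ _
  | succ n ih =>
    obtain ⟨b, ω', rfl⟩ : ∃ b ω', ω = (0 : Fin (n + 1)).insertNth (α := fun _ => Bool) b ω' :=
      ⟨ω 0, Fin.removeNth 0 ω, (Fin.insertNth_self_removeNth 0 ω).symm⟩
    rw [avg_insertNth 0, avg_insertNth 0 F]
    simp only [cubeVertex_insertNth]
    have := fun y : Bool → G => ih ω' fun x => F ((0 : Fin (n + 1)).insertNth (α := fun _ => G) (y b) x)
    simp only [this]
    exact avg_eval b fun y => avg fun x => F ((0 : Fin (n + 1)).insertNth (α := fun _ => G) y x)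

lemma IndepCoord.insertNth_eq {n : ℕ} {e : Fin (n + 1)} {f : (Fin (n + 1) → G) → ℝ}
    (h : IndepCoord e f) (y y' : G) (x : Fin n → G) :
    f (e.insertNth y x) = f (e.insertNth y' x) := by
  have := h (e.insertNth (α := fun _ => G) y' x) y
  rwa [Fin.update_insertNth] at this

lemma IndepCoord.insertNth_succAbove {n : ℕ} {e : Fin (n + 1)} {i : Fin n}
    {f : (Fin (n + 1) → G) → ℝ} (h : IndepCoord (e.succAbove i) f) (y : G) :
    IndepCoord i fun x => f (e.insertNth y x) := by
  intro x t
  change f _ = f _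
  rw [← h (e.insertNth y x) t]
  congr 1
  rw [eq_comm, Fin.eq_insertNth_iff]
  refine ⟨by simp [(Fin.succAbove_ne e i).symm], ?_⟩
  funext j
  rw [Fin.removeNth_apply]
  rcases eq_or_ne j i with rfl | hj
  · simp
  · rw [Function.update_of_ne (by simpa using hj), Function.update_of_ne hj]
    simp

theorem gowers_cauchy_schwarz [Nonempty G] (n : ℕ) : ∀ {P : Type} [Finite P]
    (H : P → (Fin n → G) → ℝ) (c μ : Fin n → P → (Fin n → G) → ℝ),
    (∀ j p, IndepCoord j (c j p)) → (∀ j p, IndepCoord j (μ j p)) →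
    (∀ j p x, |c j p x| ≤ μ j p x) →
    (∀ A : Fin n → (Fin n → Bool) → Bool, (∀ j ω, A j ω → ω j = false) →
      (avg fun p => avg fun x : Fin n → Bool → G =>
        ∏ j, ∏ ω, if A j ω then μ j p (cubeVertex x ω) else 1) ≤ 2) →
    (avg fun p => avg fun x => H p x * ∏ j, c j p x) ^ 2 ^ n ≤ 2 ^ (2 ^ n - 1) *
      avg fun p => avg fun x : Fin n → Bool → G => (∏ ω, H p (cubeVertex x ω)) *
        ∏ j, ∏ ω : Fin n → Bool, if ω j = false then μ j p (cubeVertex x ω) else 1 := by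
  induction n with
  | zero =>
    intro P _ H c μ _ _ _ _
    simp only [pow_zero, pow_one, tsub_self, univ_eq_empty, prod_empty, mul_one, one_mul,
      univ_unique, prod_singleton]
    refine le_of_eq (avg_congr fun p => ?_)
    rw [avg_unique, avg_unique]
    congr 1
    exact Subsingleton.elim _ _
  | succ n ih =>
    intro P _ H c μ hci hμi hc hBP
    let y₀ : G := Classical.arbitrary G
    let ins : G → (Fin n → G) → Fin (n + 1) → G := fun y x =>
      (0 : Fin (n + 1)).insertNth (α := fun _ => G) y x
    let H' : P × (Bool → G) → (Fin n → G) → ℝ := fun q x =>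
      (∏ b, H q.1 (ins (q.2 b) x)) * μ 0 q.1 (ins (q.2 false) x)
    let c' : Fin n → P × (Bool → G) → (Fin n → G) → ℝ := fun j q x =>
      ∏ b, c j.succ q.1 (ins (q.2 b) x)
    let μ' : Fin n → P × (Bool → G) → (Fin n → G) → ℝ := fun j q x =>
      ∏ b, μ j.succ q.1 (ins (q.2 b) x)
    have hindep : ∀ (f : P → (Fin (n + 1) → G) → ℝ) (j : Fin n), (∀ p, IndepCoord j.succ (f p)) →
        ∀ q : P × (Bool → G), IndepCoord j fun x => ∏ b, f q.1 (ins (q.2 b) x) :=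
      fun f j hf q x t => Finset.prod_congr rfl fun b _ =>
        IndepCoord.insertNth_succAbove (e := 0) (i := j) (by simpa using hf q.1) (q.2 b) x t
    have key := ih H' c' μ' (fun j q => hindep _ j (hci _) q) (fun j q => hindep _ j (hμi _) q)
      (fun j q x => by
        simp only [c', μ', Finset.abs_prod]
        exact Finset.prod_le_prod (fun _ _ => abs_nonneg _) fun b _ => hc _ _ _) ?_
    · set A := avg fun p => avg fun x => H p x * ∏ j, c j p x with hA
      set A' := avg fun p => avg fun x => H' p x * ∏ j, c' j p x with hA'
      have hmain : A ^ 2 ≤ 2 * A' := by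
        let K : P × (Fin n → G) → G → ℝ := fun q y =>
          H q.1 (ins y q.2) * ∏ j : Fin n, c j.succ q.1 (ins y q.2)
        have h1 : A = avg fun q : P × (Fin n → G) => c 0 q.1 (ins y₀ q.2) * avg (K q) := by
          rw [hA, avg_prod]
          refine avg_congr fun p => ?_
          rw [avg_insertNth 0, avg_comm]
          refine avg_congr fun x => ?_
          rw [← avg_mul_left]
          refine avg_congr fun y => ?_
          rw [Fin.prod_univ_succ, (hci 0 p).insertNth_eq y y₀]
          simp only [K, ins]
          ring
        have h2 : A' = avg fun q : P × (Fin n → G) => μ 0 q.1 (ins y₀ q.2) * avg (K q) ^ 2 := by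
          rw [hA', avg_prod, avg_prod]
          refine avg_congr fun p => ?_
          rw [avg_comm]
          refine avg_congr fun x => ?_
          rw [pow_two, ← avg_bool_arrow fun _ => K (p, x), ← avg_mul_left]
          refine avg_congr fun z => ?_
          simp only [H', c', K, Fintype.prod_bool, Finset.prod_mul_distrib]
          rw [(hμi 0 p).insertNth_eq (z false) y₀]
          ring
        have h3 : (avg fun q : P × (Fin n → G) => μ 0 q.1 (ins y₀ q.2)) ≤ 2 := by
          refine le_trans (le_of_eq ?_) (hBP (fun j ω => decide (j = 0 ∧ ω = fun _ => false)) ?_)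
          · rw [avg_prod]
            refine avg_congr fun p => ?_
            have : ∀ x : Fin (n + 1) → Bool → G, (∏ j, ∏ ω, if (decide (j = (0 : Fin (n + 1)) ∧
                ω = fun _ => false)) = true then μ j p (cubeVertex x ω) else 1) =
                μ 0 p (cubeVertex x fun _ => false) := fun x => by
              rw [Finset.prod_eq_single 0 (fun j _ hj => by simp [hj]) (by simp),
                Finset.prod_eq_single (fun _ => false) (fun ω _ hω => by simp [hω]) (by simp)]
              simp
            simp only [this]
            rw [avg_cubeVertex, avg_insertNth 0, avg_comm]
            refine avg_congr fun x => ?_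
            rw [← avg_const (X := G) (μ 0 p (ins y₀ x))]
            exact avg_congr fun y => (hμi 0 p).insertNth_eq _ _ x
          · intro j ω h
            simp only [decide_eq_true_eq] at h
            rw [h.2]
        have hμ0 : ∀ q : P × (Fin n → G), 0 ≤ μ 0 q.1 (ins y₀ q.2) := fun q =>
          (abs_nonneg _).trans (hc 0 q.1 _)
        have h4 : |A| ≤ avg fun q : P × (Fin n → G) => μ 0 q.1 (ins y₀ q.2) * |avg (K q)| := by
          rw [h1]
          refine (abs_avg_le _).trans (avg_mono fun q => ?_)
          rw [abs_mul]
          exact mul_le_mul_of_nonneg_right (hc _ _ _) (abs_nonneg _)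
        have h5 := avg_weight_mul_sq_le hμ0 fun q => |avg (K q)|
        simp only [sq_abs] at h5
        rw [← h2] at h5
        have h6 : 0 ≤ A' := by
          rw [h2]; exact avg_nonneg fun q => mul_nonneg (hμ0 q) (sq_nonneg _)
        calc A ^ 2 = |A| ^ 2 := (sq_abs A).symm
          _ ≤ _ := pow_le_pow_left₀ (abs_nonneg _) h4 2
          _ ≤ _ := h5
          _ ≤ _ := by gcongr
      have hR : (avg fun p => avg fun x : Fin n → Bool → G => (∏ ω, H' p (cubeVertex x ω)) *
          ∏ j, ∏ ω : Fin n → Bool, if ω j = false then μ' j p (cubeVertex x ω) else 1) =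
          avg fun p => avg fun x : Fin (n + 1) → Bool → G => (∏ ω, H p (cubeVertex x ω)) *
          ∏ j, ∏ ω : Fin (n + 1) → Bool, if ω j = false then μ j p (cubeVertex x ω) else 1 := by
        rw [avg_prod]
        refine avg_congr fun p => ?_
        rw [avg_insertNth 0]
        refine avg_congr fun z => avg_congr fun x => ?_
        rw [Fin.prod_univ_succ]
        simp only [prod_insertNth 0, cubeVertex_insertNth, Fintype.prod_bool]
        have hite : ∀ (q : Prop) [Decidable q] (a b : ℝ), (if q then a * b else 1) =
            (if q then a else 1) * if q then b else 1 := fun q _ a b => by split_ifs <;> simp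
        simp only [Fin.insertNth_zero', Fin.cons_zero, Fin.cons_succ, H', μ', ins, hite,
          Finset.prod_mul_distrib, Fintype.prod_bool, Bool.true_eq_false, if_false, if_true,
          one_mul]
        ring
      rw [hR] at key
      have h2 : (2 : ℝ) ^ (2 ^ (n + 1) - 1) = 2 ^ 2 ^ n * 2 ^ (2 ^ n - 1) := by
        rw [← pow_add]
        congr 1
        have := Nat.one_le_two_pow (n := n)
        rw [pow_succ]
        omega
      rw [h2, mul_assoc, show 2 ^ (n + 1) = 2 * 2 ^ n by ring, pow_mul]
      calc (A ^ 2) ^ 2 ^ n ≤ (2 * A') ^ 2 ^ n := pow_le_pow_left₀ (sq_nonneg _) hmain _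
        _ = 2 ^ 2 ^ n * A' ^ 2 ^ n := mul_pow _ _ _
        _ ≤ _ := by gcongr
    · intro A hA
      refine le_trans (le_of_eq ?_) (hBP (fun j ω => Fin.cases false
        (fun i => A i (Fin.removeNth 0 ω)) j) fun j ω => ?_)
      · rw [avg_prod]
        refine avg_congr fun p => ?_
        rw [avg_insertNth 0]
        refine avg_congr fun z => avg_congr fun x => ?_
        rw [Fin.prod_univ_succ]
        simp only [prod_insertNth 0, cubeVertex_insertNth, Fintype.prod_bool]
        simp only [Fin.cases_zero, Fin.cases_succ, Fin.removeNth_insertNth, μ', ins,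
          Fintype.prod_bool, Bool.false_eq_true, if_false, mul_one, Finset.prod_const_one, one_mul]
        refine Finset.prod_congr rfl fun j _ => Finset.prod_congr rfl fun ω _ => ?_
        split_ifs <;> simp
      · refine Fin.cases (by simp) (fun i hi => ?_) j
        exact hA _ _ hi

end GowersCauchySchwarz

section AlternatingCube

variable {G : Type} [Finite G]

/-- A function of mean one with pseudorandomness on cubes is orthogonal to products of
lower-dimensional functions with pseudorandom majorants. -/
theorem abs_avg_sub_one_mul_prod_pow_le [Nonempty G] {n : ℕ} (hn : n ≠ 0) {P : Type} [Finite P]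
    [Nonempty P] {η : ℝ} (hη1 : η ≤ 1) (h : P → (Fin n → G) → ℝ)
    (c μ : Fin n → P → (Fin n → G) → ℝ) (hci : ∀ j p, IndepCoord j (c j p))
    (hμi : ∀ j p, IndepCoord j (μ j p)) (hc : ∀ j p x, |c j p x| ≤ μ j p x)
    (hLF : ∀ (S : (Fin n → Bool) → Bool) (A : Fin n → (Fin n → Bool) → Bool),
      (∀ j ω, A j ω → ω j = false) →
      |(avg fun p => avg fun x : Fin n → Bool → G =>
        (∏ ω, if S ω then h p (cubeVertex x ω) else 1) *
        ∏ j, ∏ ω, if A j ω then μ j p (cubeVertex x ω) else 1) - 1| ≤ η) :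
    |avg fun p => avg fun x => (h p x - 1) * ∏ j, c j p x| ^ 2 ^ n ≤ 4 ^ 2 ^ n * η := by
  have heven : Even (2 ^ n) := (Nat.even_pow.2 ⟨even_two, hn⟩)
  rw [heven.pow_abs]
  refine (gowers_cauchy_schwarz n (fun p x => h p x - 1) c μ hci hμi hc fun A hA => ?_).trans ?_
  · have := (abs_le.1 (hLF (fun _ => false) A hA)).2
    simp only [Bool.false_eq_true, if_false, Finset.prod_const_one, one_mul] at this
    linarith
  have hA : ∀ (j : Fin n) (ω : Fin n → Bool), decide (ω j = false) = true → ω j = false :=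
    fun j ω => by simp
  have hη : 0 ≤ η := (abs_nonneg _).trans (hLF (fun _ => false) _ hA)
  have key : |avg fun p => avg fun x : Fin n → Bool → G => (∏ ω, (h p (cubeVertex x ω) - 1)) *
      ∏ j, ∏ ω : Fin n → Bool, if ω j = false then μ j p (cubeVertex x ω) else 1| ≤
      2 ^ 2 ^ n * η := by
    have hexp : ∀ p (x : Fin n → Bool → G), (∏ ω, (h p (cubeVertex x ω) - 1)) *
        (∏ j, ∏ ω : Fin n → Bool, if ω j = false then μ j p (cubeVertex x ω) else 1) =
        ∑ t : Finset (Fin n → Bool), (-1) ^ #t *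
        ((∏ ω, if decide (ω ∉ t) = true then h p (cubeVertex x ω) else 1) *
        ∏ j, ∏ ω : Fin n → Bool, if decide (ω j = false) = true then μ j p (cubeVertex x ω) else 1) := by
      intro p x
      rw [Finset.prod_sub, Finset.sum_mul, Finset.powerset_univ]
      refine Finset.sum_congr rfl fun t _ => ?_
      simp only [Finset.prod_const_one, mul_one, decide_eq_true_eq]
      rw [mul_assoc]
      congr 2
      rw [Finset.prod_ite, Finset.prod_const_one, mul_one]
      refine Finset.prod_congr ?_ fun _ _ => rfl
      ext; simp
    simp only [hexp, avg_sum]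
    have hz : ∑ t : Finset (Fin n → Bool), (-1 : ℝ) ^ #t = 0 := by
      have := Finset.prod_sub (fun _ : Fin n → Bool => (1 : ℝ)) (fun _ => 1) univ
      simp only [sub_self, Finset.prod_const_one, mul_one, Finset.powerset_univ] at this
      rw [← this, Finset.prod_const, zero_pow]
      simp
    rw [← sub_zero (∑ _ ∈ _, _), ← hz, ← Finset.sum_sub_distrib]
    refine (Finset.abs_sum_le_sum_abs _ _).trans ?_
    have hterm : ∀ t : Finset (Fin n → Bool), |(avg fun p => avg fun x : Fin n → Bool → G =>
        (-1) ^ #t * ((∏ ω, if decide (ω ∉ t) = true then h p (cubeVertex x ω) else 1) *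
        ∏ j, ∏ ω : Fin n → Bool,
          if decide (ω j = false) = true then μ j p (cubeVertex x ω) else 1)) - (-1) ^ #t| ≤ η := by
      intro t
      simp only [avg_mul_left]
      rw [← mul_sub_one, abs_mul, abs_pow, abs_neg, abs_one, one_pow, one_mul]
      exact hLF (fun ω => decide (ω ∉ t)) (fun j ω => decide (ω j = false)) hA
    refine (Finset.sum_le_sum fun t _ => hterm t).trans (le_of_eq ?_)
    simp
  calc _ ≤ (2 : ℝ) ^ (2 ^ n - 1) * (2 ^ 2 ^ n * η) := by
        gcongr
        exact (le_abs_self _).trans key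
    _ ≤ 2 ^ 2 ^ n * (2 ^ 2 ^ n * η) := by
        gcongr
        · norm_num
        · exact Nat.sub_le _ _
    _ = 4 ^ 2 ^ n * η := by
        rw [← mul_assoc, ← mul_pow]; norm_num

end AlternatingCube

section Counting

variable {G : Type} [Finite G]

lemma abs_avg_sub_le {X : Type*} [Finite X] [Nonempty X] {f : X → ℝ} {a η : ℝ}
    (h : ∀ x, |f x - a| ≤ η) : |avg f - a| ≤ η := by
  obtain ⟨x⟩ := ‹Nonempty X›
  rw [show avg f - a = avg fun x => f x - a by rw [avg_sub, avg_const]]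
  exact (abs_avg_le _).trans (avg_le_of_forall_le ((abs_nonneg _).trans (h x)) h)

/-- The mean of every partial product of the family over a discrete cube, with the `j`-th function
evaluated at vertices with vanishing `j`-th coordinate, is within `η` of `1`. -/
def CubePseudorandom {n : ℕ} (ν : Fin n → (Fin n → G) → ℝ) (η : ℝ) : Prop :=
  ∀ A : Fin n → (Fin n → Bool) → Bool, (∀ j ω, A j ω → ω j = false) →
    |(avg fun x : Fin n → Bool → G =>
      ∏ j, ∏ ω, if A j ω then ν j (cubeVertex x ω) else 1) - 1| ≤ η

lemma CubePseudorandom.update_one {n : ℕ} {ν : Fin n → (Fin n → G) → ℝ} {η : ℝ}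
    (h : CubePseudorandom ν η) (e : Fin n) :
    CubePseudorandom (Function.update ν e fun _ => 1) η := fun A hA => by
  refine le_trans (le_of_eq ?_) (h (fun j ω => A j ω && decide (j ≠ e)) fun j ω hj =>
    hA j ω (by simp only [Bool.and_eq_true] at hj; exact hj.1))
  congr 2
  refine avg_congr fun x => Finset.prod_congr rfl fun j _ => Finset.prod_congr rfl fun ω _ => ?_
  rcases eq_or_ne j e with rfl | hj
  · simp
  · simp [hj]

lemma CubePseudorandom.half_one_add [Nonempty G] {n : ℕ} {ν : Fin n → (Fin n → G) → ℝ} {η : ℝ}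
    (h : CubePseudorandom ν η) : CubePseudorandom (fun j x => (1 + ν j x) / 2) η := fun A hA => by
  have h1 : ∀ x : Fin n → Bool → G,
      (∏ j, ∏ ω, if A j ω then (1 + ν j (cubeVertex x ω)) / 2 else 1) =
      avg fun B : Fin n × (Fin n → Bool) → Bool =>
        ∏ j, ∏ ω, if (A j ω && B (j, ω)) then ν j (cubeVertex x ω) else 1 := fun x => by
    have := avg_pi_prod (A := fun _ : Fin n × (Fin n → Bool) => Bool) fun q b =>
      if (A q.1 q.2 && b) then ν q.1 (cubeVertex x q.2) else 1
    simp only [Fintype.prod_prod_type] at this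
    rw [this]
    refine Finset.prod_congr rfl fun j _ => Finset.prod_congr rfl fun ω _ => ?_
    rw [avg_eq_sum_div]
    cases A j ω <;> simp [add_comm]
  simp only [h1]
  rw [avg_comm]
  refine abs_avg_sub_le fun B => ?_
  exact h (fun j ω => A j ω && B (j, ω)) fun j ω hj => hA j ω (by
      simp only [Bool.and_eq_true] at hj; exact hj.1)

variable {d : ℕ}

lemma CubePseudorandom.abs_insertNth_le {ν : Fin (d + 1) → (Fin (d + 1) → G) → ℝ} {η : ℝ}
    (h : CubePseudorandom ν η) (e : Fin (d + 1)) (S : (Fin d → Bool) → Bool)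
    (B : Fin d → (Fin d → Bool) → Bool → Bool) (hB : ∀ i ω b, B i ω b → ω i = false) :
    |(avg fun p : Bool → G => avg fun x : Fin d → Bool → G =>
      (∏ ω, if S ω then ν e (e.insertNth (p false) (cubeVertex x ω)) else 1) *
      ∏ i, ∏ ω, ∏ b, if B i ω b then
        ν (e.succAbove i) (e.insertNth (p b) (cubeVertex x ω)) else 1) - 1| ≤ η := by
  refine le_trans (le_of_eq ?_) (h (e.insertNth (α := fun _ => (Fin (d + 1) → Bool) → Bool)
    (fun ω => !ω e && S (e.removeNth ω)) fun i ω => B i (e.removeNth ω) (ω e)) ?_)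
  · congr 2
    rw [avg_insertNth e]
    refine avg_congr fun p => avg_congr fun x => ?_
    rw [Fin.prod_univ_succAbove _ e]
    simp only [prod_insertNth e, cubeVertex_insertNth, Fin.insertNth_apply_same,
      Fin.insertNth_apply_succAbove, Fin.removeNth_insertNth]
    congr 1
    exact Finset.prod_congr rfl fun ω _ => by simp
  · intro j ω
    obtain rfl | ⟨i, rfl⟩ := e.eq_self_or_eq_succAbove j
    · rw [Fin.insertNth_apply_same]
      intro h
      simp only [Bool.and_eq_true, Bool.not_eq_true'] at h
      exact h.1
    · rw [Fin.insertNth_apply_succAbove]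
      intro h
      simpa [Fin.removeNth] using hB _ _ _ h

/-- The average over the `e`-th coordinate of the product of the remaining functions. -/
def fiberAvg (e : Fin (d + 1)) (f : Fin (d + 1) → (Fin (d + 1) → G) → ℝ) (x : Fin d → G) : ℝ :=
  avg fun y => ∏ i, f (e.succAbove i) (e.insertNth y x)

lemma avg_mul_prod_succAbove (e : Fin (d + 1)) (q : (Fin (d + 1) → G) → ℝ)
    (hq : IndepCoord e q) (f : Fin (d + 1) → (Fin (d + 1) → G) → ℝ) (y₀ : G) :
    (avg fun x => q x * ∏ i, f (e.succAbove i) x) =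
      avg fun x : Fin d → G => q (e.insertNth y₀ x) * fiberAvg e f x := by
  rw [avg_insertNth e, avg_comm]
  refine avg_congr fun x => ?_
  rw [fiberAvg, ← avg_mul_left]
  exact avg_congr fun y => by rw [hq.insertNth_eq y y₀]

lemma avg_eq_avg_insertNth [Nonempty G] (e : Fin (d + 1)) (q : (Fin (d + 1) → G) → ℝ)
    (hq : IndepCoord e q) (y₀ : G) : avg q = avg fun x : Fin d → G => q (e.insertNth y₀ x) := by
  rw [avg_insertNth e, avg_comm]
  refine avg_congr fun x => ?_
  rw [← avg_const (X := G) (q (e.insertNth y₀ x))]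
  exact avg_congr fun y => hq.insertNth_eq y y₀ x

lemma CubePseudorandom.avg_le_two [Nonempty G] {ν : Fin (d + 1) → (Fin (d + 1) → G) → ℝ} {η : ℝ}
    (h : CubePseudorandom ν η) (hη : η ≤ 1) (e : Fin (d + 1)) : avg (ν e) ≤ 2 := by
  have := (abs_le.1 (h (fun j ω => decide (j = e ∧ ω = fun _ => false)) fun j ω hj => by
    simp only [decide_eq_true_eq] at hj; rw [hj.2])).2
  have h1 : ∀ x : Fin (d + 1) → Bool → G, (∏ j, ∏ ω, if (decide (j = e ∧
      ω = fun _ => false)) = true then ν j (cubeVertex x ω) else 1) =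
      ν e (cubeVertex x fun _ => false) := fun x => by
    rw [Finset.prod_eq_single e (fun j _ hj => by simp [hj]) (by simp),
      Finset.prod_eq_single (fun _ => false) (fun ω _ hω => by simp [hω]) (by simp)]
    simp
  simp only [h1] at this
  rw [avg_cubeVertex] at this
  linarith

lemma CubePseudorandom.avg_fiberAvg_sub_one_sq_le [Nonempty G]
    {ν : Fin (d + 1) → (Fin (d + 1) → G) → ℝ} {η : ℝ} (h : CubePseudorandom ν η)
    (e : Fin (d + 1)) : (avg fun x => (fiberAvg e ν x - 1) ^ 2) ≤ 3 * η := by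
  have h1 := h.abs_insertNth_le e (fun _ => false)
    (fun _ ω b => decide (ω = fun _ => false) && !b) (fun i ω b hb => by
      simp only [Bool.and_eq_true, decide_eq_true_eq] at hb; rw [hb.1])
  have h2 := h.abs_insertNth_le e (fun _ => false)
    (fun _ ω _ => decide (ω = fun _ => false)) (fun i ω b hb => by
      simp only [decide_eq_true_eq] at hb; rw [hb])
  have h3 : ∀ (p : Bool → G) (x : Fin d → Bool → G), ((∏ ω : Fin d → Bool,
      if false = true then ν e (e.insertNth (p false) (cubeVertex x ω)) else 1) *
      ∏ i, ∏ ω, ∏ b, if (decide (ω = fun _ => false) && !b) = true then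
        ν (e.succAbove i) (e.insertNth (p b) (cubeVertex x ω)) else 1) =
      ∏ i, ν (e.succAbove i) (e.insertNth (p false) (cubeVertex x fun _ => false)) := fun p x => by
    simp only [Bool.false_eq_true, if_false, Finset.prod_const_one, one_mul]
    refine Finset.prod_congr rfl fun i _ => ?_
    rw [Finset.prod_eq_single (fun _ => false) (fun ω _ hω => by simp [hω]) (by simp)]
    simp
  have h4 : ∀ (p : Bool → G) (x : Fin d → Bool → G), ((∏ ω : Fin d → Bool,
      if false = true then ν e (e.insertNth (p false) (cubeVertex x ω)) else 1) *
      ∏ i, ∏ ω, ∏ b, if (decide (ω = fun _ => false)) = true then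
        ν (e.succAbove i) (e.insertNth (p b) (cubeVertex x ω)) else 1) =
      (∏ i, ν (e.succAbove i) (e.insertNth (p false) (cubeVertex x fun _ => false))) *
      ∏ i, ν (e.succAbove i) (e.insertNth (p true) (cubeVertex x fun _ => false)) := fun p x => by
    simp only [Bool.false_eq_true, if_false, Finset.prod_const_one, one_mul]
    rw [← Finset.prod_mul_distrib]
    refine Finset.prod_congr rfl fun i _ => ?_
    rw [Finset.prod_eq_single (fun _ => false) (fun ω _ hω => by simp [hω]) (by simp)]
    simp [mul_comm]
  simp only [h3] at h1
  simp only [h4] at h2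
  rw [avg_comm] at h1 h2
  have h5 : ∀ x : Fin d → G, (avg fun p : Bool → G => ∏ i, ν (e.succAbove i)
      (e.insertNth (p false) x)) = fiberAvg e ν x := fun x =>
    avg_eval false fun y => ∏ i, ν (e.succAbove i) (e.insertNth (α := fun _ => G) y x)
  have h6 : ∀ x : Fin d → G, (avg fun p : Bool → G => (∏ i, ν (e.succAbove i)
      (e.insertNth (p false) x)) * ∏ i, ν (e.succAbove i) (e.insertNth (p true) x)) =
      fiberAvg e ν x ^ 2 := fun x => by
    rw [pow_two]
    exact avg_bool_arrow fun _ y => ∏ i, ν (e.succAbove i) (e.insertNth (α := fun _ => G) y x)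
  simp only [h5] at h1
  simp only [h6] at h2
  rw [avg_cubeVertex (fun _ => false) (fiberAvg e ν)] at h1
  rw [avg_cubeVertex (fun _ => false) fun x => fiberAvg e ν x ^ 2] at h2
  have h7 : (avg fun x => (fiberAvg e ν x - 1) ^ 2) =
      (avg fun x => fiberAvg e ν x ^ 2) - 2 * avg (fiberAvg e ν) + 1 := by
    rw [← avg_mul_left, ← avg_sub, ← avg_const (X := Fin d → G) (1 : ℝ), ← avg_add]
    exact avg_congr fun x => by rw [avg_const]; ring
  rw [h7]
  linarith [(abs_le.1 h1).1, (abs_le.1 h2).2]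

lemma CubePseudorandom.abs_avg_sub_one_mul_fiberAvg_pow_le [Nonempty G] (hd : d ≠ 0)
    {ν : Fin (d + 1) → (Fin (d + 1) → G) → ℝ} {η : ℝ} (h : CubePseudorandom ν η) (hη : η ≤ 1)
    (hν : ∀ j, IndepCoord j (ν j)) (e : Fin (d + 1)) (y₀ : G)
    (a b : Fin (d + 1) → (Fin (d + 1) → G) → ℝ) (ha : ∀ j, IndepCoord j (a j))
    (hb : ∀ j, IndepCoord j (b j)) (ha0 : ∀ j x, 0 ≤ a j x) (hb0 : ∀ j x, 0 ≤ b j x)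
    (haν : ∀ j x, a j x ≤ ν j x) (hbν : ∀ j x, b j x ≤ ν j x) :
    |avg fun x => (ν e (e.insertNth y₀ x) - 1) * (fiberAvg e a x * fiberAvg e b x)| ^ 2 ^ d ≤
      4 ^ 2 ^ d * η := by
  have hcast : ∀ (f : Fin (d + 1) → (Fin (d + 1) → G) → ℝ), (∀ j, IndepCoord j (f j)) →
      ∀ (i : Fin d) (y : G), IndepCoord i fun x => f (e.succAbove i) (e.insertNth y x) :=
    fun f hf i y => (hf _).insertNth_succAbove y
  refine le_trans (le_of_eq ?_) (abs_avg_sub_one_mul_prod_pow_le (P := Bool → G) hd hη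
    (fun p x => ν e (e.insertNth (p false) x))
    (fun i p x => a (e.succAbove i) (e.insertNth (p false) x) *
      b (e.succAbove i) (e.insertNth (p true) x))
    (fun i p x => ∏ b, ν (e.succAbove i) (e.insertNth (p b) x)) ?_ ?_ ?_ ?_)
  · congr 2
    rw [avg_comm]
    refine avg_congr fun x => ?_
    rw [fiberAvg, fiberAvg, ← avg_bool_arrow₂, ← avg_mul_left]
    refine avg_congr fun p => ?_
    simp only [Finset.prod_mul_distrib]
    rw [(hν e).insertNth_eq y₀ (p false)]
  · intro i p x t
    have h1 := hcast a ha i (p false) x t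
    have h2 := hcast b hb i (p true) x t
    simp only at h1 h2 ⊢
    rw [h1, h2]
  · intro i p x t
    exact Finset.prod_congr rfl fun b _ => hcast ν hν i (p b) x t
  · intro i p x
    rw [abs_of_nonneg (mul_nonneg (ha0 _ _) (hb0 _ _)), Fintype.prod_bool, mul_comm]
    exact mul_le_mul (hbν _ _) (haν _ _) (ha0 _ _) ((hb0 _ _).trans (hbν _ _))
  · intro S A hA
    refine le_trans (le_of_eq ?_) (h.abs_insertNth_le e S (fun i ω _ => A i ω)
      fun i ω _ => hA i ω)
    congr 2
    refine avg_congr fun p => avg_congr fun x => ?_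
    congr 1
    refine Finset.prod_congr rfl fun i _ => Finset.prod_congr rfl fun ω _ => ?_
    split_ifs <;> simp

end Counting

section CountingLemma

variable {G : Type} [Finite G] {d : ℕ}

lemma fiberAvg_nonneg {e : Fin (d + 1)} {f : Fin (d + 1) → (Fin (d + 1) → G) → ℝ}
    (hf : ∀ j x, 0 ≤ f j x) (x : Fin d → G) : 0 ≤ fiberAvg e f x :=
  avg_nonneg fun _ => Finset.prod_nonneg fun _ _ => hf _ _

lemma fiberAvg_mono {e : Fin (d + 1)} {f g : Fin (d + 1) → (Fin (d + 1) → G) → ℝ}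
    (hf : ∀ j x, 0 ≤ f j x) (hfg : ∀ j x, f j x ≤ g j x) (x : Fin d → G) :
    fiberAvg e f x ≤ fiberAvg e g x :=
  avg_mono fun _ => Finset.prod_le_prod (fun _ _ => hf _ _) fun _ _ => hfg _ _

lemma indepCoord_comp_removeNth (e : Fin (d + 1)) (q : (Fin d → G) → ℝ) :
    IndepCoord e fun x => q (e.removeNth x) := fun x t => by
  change q _ = q _
  congr 1
  funext i
  simp [Fin.removeNth]

/-- Hypotheses of the counting lemma: `f` is majorised by a pseudorandom family `ν`, the family `g`
is bounded, and `f - g` correlates with no product of bounded lower-dimensional functions. -/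
structure DenseModel (ν f g : Fin (d + 1) → (Fin (d + 1) → G) → ℝ) (η : ℝ) : Prop where
  indep_majorant : ∀ j, IndepCoord j (ν j)
  indep_left : ∀ j, IndepCoord j (f j)
  indep_right : ∀ j, IndepCoord j (g j)
  left_nonneg : ∀ j x, 0 ≤ f j x
  right_nonneg : ∀ j x, 0 ≤ g j x
  left_le : ∀ j x, f j x ≤ ν j x
  right_le : ∀ j x, g j x ≤ ν j x
  right_le_one : ∀ j x, g j x ≤ 1
  pseudorandom : CubePseudorandom ν η
  cut : ∀ j (u : Fin (d + 1) → (Fin (d + 1) → G) → ℝ), (∀ i, IndepCoord i (u i)) →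
    (∀ i x, 0 ≤ u i x) → (∀ i x, u i x ≤ 1) →
    |avg fun x => (f j x - g j x) * ∏ i, u (j.succAbove i) x| ≤ η

lemma DenseModel.update {ν f g : Fin (d + 1) → (Fin (d + 1) → G) → ℝ} {η : ℝ}
    (h : DenseModel ν f g η) (hη : 0 ≤ η) (e : Fin (d + 1)) {q : (Fin (d + 1) → G) → ℝ}
    (hqe : IndepCoord e q) (hq0 : ∀ x, 0 ≤ q x) (hq1 : ∀ x, q x ≤ 1) :
    DenseModel (Function.update ν e fun _ => 1) (Function.update f e q) (Function.update g e q) η where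
  indep_majorant j := by
    rcases eq_or_ne j e with rfl | hj
    · simp [IndepCoord]
    · rw [Function.update_of_ne hj]; exact h.indep_majorant j
  indep_left j := by
    rcases eq_or_ne j e with rfl | hj
    · simpa using hqe
    · rw [Function.update_of_ne hj]; exact h.indep_left j
  indep_right j := by
    rcases eq_or_ne j e with rfl | hj
    · simpa using hqe
    · rw [Function.update_of_ne hj]; exact h.indep_right j
  left_nonneg j x := by
    rcases eq_or_ne j e with rfl | hj
    · simpa using hq0 x
    · rw [Function.update_of_ne hj]; exact h.left_nonneg j x
  right_nonneg j x := by
    rcases eq_or_ne j e with rfl | hj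
    · simpa using hq0 x
    · rw [Function.update_of_ne hj]; exact h.right_nonneg j x
  left_le j x := by
    rcases eq_or_ne j e with rfl | hj
    · simpa using hq1 x
    · rw [Function.update_of_ne hj, Function.update_of_ne hj]; exact h.left_le j x
  right_le j x := by
    rcases eq_or_ne j e with rfl | hj
    · simpa using hq1 x
    · rw [Function.update_of_ne hj, Function.update_of_ne hj]; exact h.right_le j x
  right_le_one j x := by
    rcases eq_or_ne j e with rfl | hj
    · simpa using hq1 x
    · rw [Function.update_of_ne hj]; exact h.right_le_one j x
  pseudorandom := h.pseudorandom.update_one e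
  cut j u hu h0 h1 := by
    rcases eq_or_ne j e with rfl | hj
    · simpa [avg_zero] using hη
    · rw [Function.update_of_ne hj, Function.update_of_ne hj]; exact h.cut j u hu h0 h1

lemma avg_prod_update [Nonempty G] (e : Fin (d + 1)) (f : Fin (d + 1) → (Fin (d + 1) → G) → ℝ)
    (q : (Fin d → G) → ℝ) :
    (avg fun x => ∏ j, Function.update f e (fun x => q (e.removeNth x)) j x) =
      avg fun x => q x * fiberAvg e f x := by
  have h1 := avg_mul_prod_succAbove e _ (indepCoord_comp_removeNth e q) f (Classical.arbitrary G)
  simp only [Fin.removeNth_insertNth] at h1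
  rw [← h1]
  refine avg_congr fun x => ?_
  rw [Fin.prod_univ_succAbove _ e]
  simp [Fin.succAbove_ne]

lemma DenseModel.abs_avg_prod_sub_le_of_bounded {f g : Fin (d + 1) → (Fin (d + 1) → G) → ℝ} {η : ℝ}
    {ν : Fin (d + 1) → (Fin (d + 1) → G) → ℝ} (h : DenseModel ν f g η) (hν : ∀ j x, ν j x = 1) :
    |(avg fun x => ∏ j, f j x) - avg fun x => ∏ j, g j x| ≤ (d + 1) * η := by
  have key : ∀ T : Finset (Fin (d + 1)), |(avg fun x => ∏ j, f j x) -
      avg fun x => ∏ j, (if j ∈ T then g j else f j) x| ≤ #T * η := by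
    intro T
    induction T using Finset.induction_on with
    | empty => simp
    | insert e T he ih =>
      have h1 := h.cut e (fun i => if i ∈ T then g i else f i)
        (fun i => by split_ifs; exacts [h.indep_right i, h.indep_left i])
        (fun i x => by split_ifs; exacts [h.right_nonneg i x, h.left_nonneg i x])
        (fun i x => by
          split_ifs; exacts [h.right_le_one i x, (h.left_le i x).trans (hν i x).le])
      rw [Finset.card_insert_of_notMem he]
      push_cast
      have h2 : (avg fun x => (f e x - g e x) * ∏ i,
          (if e.succAbove i ∈ T then g (e.succAbove i) else f (e.succAbove i)) x) =
          (avg fun x => ∏ j, (if j ∈ T then g j else f j) x) -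
          avg fun x => ∏ j, (if j ∈ insert e T then g j else f j) x := by
        rw [← avg_sub]
        refine avg_congr fun x => ?_
        rw [Fin.prod_univ_succAbove _ e, Fin.prod_univ_succAbove _ e, if_neg he,
          if_pos (Finset.mem_insert_self e T)]
        simp only [Finset.mem_insert, Fin.succAbove_ne, false_or]
        ring
      rw [h2] at h1
      calc _ ≤ _ := abs_sub_le _ (avg fun x => ∏ j, (if j ∈ T then g j else f j) x) _
        _ ≤ _ := add_le_add ih h1
        _ = _ := by ring
  simpa using key univ

theorem abs_avg_prod_sub_le (hd : d ≠ 0) (m : ℕ) : ∀ ε : ℝ, 0 < ε → ∃ η : ℝ, 0 < η ∧ η ≤ 1 ∧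
    ∀ (G : Type) [Finite G] [Nonempty G] (ν f g : Fin (d + 1) → (Fin (d + 1) → G) → ℝ),
    DenseModel ν f g η → ∀ T : Finset (Fin (d + 1)), (∀ j ∉ T, ∀ x, ν j x = 1) → #T = m →
    |(avg fun x => ∏ j, f j x) - avg fun x => ∏ j, g j x| ≤ ε := by
  induction m with
  | zero =>
    intro ε hε
    refine ⟨min 1 (ε / (d + 1)), lt_min one_pos (by positivity), min_le_left _ _,
      fun G _ _ ν f g h T hT hT0 => ?_⟩
    rw [Finset.card_eq_zero] at hT0
    refine (h.abs_avg_prod_sub_le_of_bounded fun j => hT j (by simp [hT0])).trans ?_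
    calc _ ≤ (d + 1) * (ε / (d + 1)) := by gcongr; exact min_le_right _ _
      _ = ε := by field_simp
  | succ m ih =>
    intro ε hε
    obtain ⟨θ, hθ⟩ : ∃ θ : ℝ, θ = ε ^ 2 / 100 := ⟨_, rfl⟩
    have hθ0 : 0 < θ := by rw [hθ]; positivity
    obtain ⟨η₁, hη₁, -, hη₁'⟩ := ih θ hθ0
    obtain ⟨η, hη⟩ : ∃ η : ℝ, η = min (min (min 1 (ε / 2)) (min η₁ (θ / 3)))
      (min (θ ^ 2 / 3) (θ ^ 2 ^ d / 4 ^ 2 ^ d)) := ⟨_, rfl⟩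
    have hη0 : 0 < η := by rw [hη]; positivity
    have hη1 : η ≤ 1 := hη.trans_le ((min_le_left _ _).trans ((min_le_left _ _).trans (min_le_left _ _)))
    have hη2 : η ≤ ε / 2 :=
      hη.trans_le ((min_le_left _ _).trans ((min_le_left _ _).trans (min_le_right _ _)))
    have hη3 : η ≤ η₁ :=
      hη.trans_le ((min_le_left _ _).trans ((min_le_right _ _).trans (min_le_left _ _)))
    have hη4 : 3 * η ≤ θ := by
      have : η ≤ θ / 3 :=
        hη.trans_le ((min_le_left _ _).trans ((min_le_right _ _).trans (min_le_right _ _)))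
      linarith
    have hη5 : 3 * η ≤ θ ^ 2 := by
      have : η ≤ θ ^ 2 / 3 := hη.trans_le ((min_le_right _ _).trans (min_le_left _ _))
      linarith
    have hη6 : 4 ^ 2 ^ d * η ≤ θ ^ 2 ^ d := by
      have : η ≤ θ ^ 2 ^ d / 4 ^ 2 ^ d := hη.trans_le ((min_le_right _ _).trans (min_le_right _ _))
      rwa [le_div_iff₀ (by positivity), mul_comm] at this
    clear hη
    refine ⟨η, hη0, hη1, fun G _ _ ν f g h T hT hTm => ?_⟩
    obtain ⟨e, he⟩ : T.Nonempty := Finset.card_pos.1 (by omega)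
    let y₀ : G := Classical.arbitrary G
    let F := fiberAvg e f
    let K := fiberAvg e g
    let V := fiberAvg e ν
    have hν0 : ∀ j x, 0 ≤ ν j x := fun j x => (h.left_nonneg j x).trans (h.left_le j x)
    have hF0 : ∀ x, 0 ≤ F x := fiberAvg_nonneg h.left_nonneg
    have hK0 : ∀ x, 0 ≤ K x := fiberAvg_nonneg h.right_nonneg
    have hFV : ∀ x, F x ≤ V x := fiberAvg_mono h.left_nonneg h.left_le
    have hK1 : ∀ x, K x ≤ 1 := fun x => avg_le_of_forall_le zero_le_one fun y =>
      Finset.prod_le_one (fun _ _ => h.right_nonneg _ _) fun _ _ => h.right_le_one _ _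
    have hIH : ∀ q : (Fin d → G) → ℝ, (∀ x, 0 ≤ q x) → (∀ x, q x ≤ 1) →
        |avg fun x => q x * (F x - K x)| ≤ θ := by
      intro q hq0 hq1
      have h1 := h.update hη0.le e (indepCoord_comp_removeNth e q) (fun x => hq0 _) fun x => hq1 _
      have h2 := hη₁' G _ _ _ ⟨h1.1, h1.2, h1.3, h1.4, h1.5, h1.6, h1.7, h1.8,
        fun A hA => (h1.9 A hA).trans hη3, fun j u hu h0 h1' => (h1.10 j u hu h0 h1').trans hη3⟩
        (T.erase e) (fun j hj x => by
          rcases eq_or_ne j e with rfl | hje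
          · simp
          · rw [Function.update_of_ne hje]
            exact hT j (fun hjT => hj (Finset.mem_erase.2 ⟨hje, hjT⟩)) x)
        (by rw [Finset.card_erase_of_mem he, hTm]; rfl)
      rw [avg_prod_update, avg_prod_update, ← avg_sub] at h2
      simpa only [mul_sub] using h2
    have hV : (avg fun x => (V x - 1) ^ 2) ≤ 3 * η := h.pseudorandom.avg_fiberAvg_sub_one_sq_le e
    have hV1 : (avg fun x => |V x - 1|) ≤ θ := by
      refine abs_le_of_sq_le_sq' ?_ hθ0.le |>.2
      have h1 := avg_sq_le fun x => |V x - 1|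
      simp only [sq_abs] at h1
      exact h1.trans (hV.trans hη5)
    have hD : (avg fun x => (F x - K x) ^ 2) ≤ 5 * θ := by
      have h1 := hIH K hK0 hK1
      have h2 := hIH (fun x => min (F x) 1) (fun x => le_min (hF0 x) zero_le_one)
        fun x => min_le_right _ _
      have h3 : (avg fun x => (F x - min (F x) 1) * (F x - K x)) ≤ 3 * η + 2 * θ := by
        calc _ ≤ avg fun x => (V x - 1) ^ 2 + 2 * |V x - 1| := avg_mono fun x => by
              have h4 : F x - min (F x) 1 ≤ |V x - 1| := by
                rcases min_cases (F x) 1 with h | h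
                · rw [h.1, sub_self]; exact abs_nonneg _
                · rw [h.1]; exact (sub_le_sub_right (hFV x) 1).trans (le_abs_self _)
              have h5 : 0 ≤ F x - min (F x) 1 := sub_nonneg.2 (min_le_left _ _)
              have h6 : F x - K x ≤ |V x - 1| + 2 := by
                linarith [hFV x, hK0 x, le_abs_self (V x - 1)]
              calc _ ≤ (F x - min (F x) 1) * (|V x - 1| + 2) := mul_le_mul_of_nonneg_left h6 h5
                _ ≤ |V x - 1| * (|V x - 1| + 2) := by gcongr
                _ = _ := by rw [mul_add, ← sq, sq_abs]; ring
          _ ≤ _ := by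
              rw [avg_add, avg_mul_left]
              linarith
      have h7 : (avg fun x => (F x - K x) ^ 2) = (avg fun x => (F x - min (F x) 1) * (F x - K x)) +
          (avg fun x => min (F x) 1 * (F x - K x)) - avg fun x => K x * (F x - K x) := by
        rw [← avg_add, ← avg_sub]
        exact avg_congr fun x => by ring
      rw [h7]
      linarith [(abs_le.1 h1).1, (abs_le.1 h2).2]
    have hcross : ∀ a b : Fin (d + 1) → (Fin (d + 1) → G) → ℝ, (∀ j, IndepCoord j (a j)) →
        (∀ j, IndepCoord j (b j)) → (∀ j x, 0 ≤ a j x) → (∀ j x, 0 ≤ b j x) →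
        (∀ j x, a j x ≤ ν j x) → (∀ j x, b j x ≤ ν j x) →
        |avg fun x => (ν e (e.insertNth y₀ x) - 1) * (fiberAvg e a x * fiberAvg e b x)| ≤ θ :=
      fun a b ha hb ha0 hb0 haν hbν => le_of_pow_le_pow_left₀ (n := 2 ^ d) (by positivity) hθ0.le
        ((h.pseudorandom.abs_avg_sub_one_mul_fiberAvg_pow_le hd hη1 h.indep_majorant e y₀ a b ha hb
          ha0 hb0 haν hbν).trans hη6)
    have hE : (avg fun x => (ν e (e.insertNth y₀ x) - 1) * (F x - K x) ^ 2) ≤ 4 * θ := by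
      have h1 := hcross f f h.indep_left h.indep_left h.left_nonneg h.left_nonneg h.left_le h.left_le
      have h2 := hcross f g h.indep_left h.indep_right h.left_nonneg h.right_nonneg h.left_le
        h.right_le
      have h3 := hcross g g h.indep_right h.indep_right h.right_nonneg h.right_nonneg h.right_le
        h.right_le
      have h4 : (avg fun x => (ν e (e.insertNth y₀ x) - 1) * (F x - K x) ^ 2) =
          (avg fun x => (ν e (e.insertNth y₀ x) - 1) * (F x * F x)) -
          2 * (avg fun x => (ν e (e.insertNth y₀ x) - 1) * (F x * K x)) +
          avg fun x => (ν e (e.insertNth y₀ x) - 1) * (K x * K x) := by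
        rw [← avg_mul_left, ← avg_sub, ← avg_add]
        exact avg_congr fun x => by ring
      rw [h4]
      linarith [(abs_le.1 h1).2, (abs_le.1 h2).1, (abs_le.1 h3).2]
    have hmain : |avg fun x => f e (e.insertNth y₀ x) * (F x - K x)| ≤ ε / 2 := by
      have h1 : |avg fun x => f e (e.insertNth y₀ x) * (F x - K x)| ≤
          avg fun x => ν e (e.insertNth y₀ x) * |F x - K x| := by
        refine (abs_avg_le _).trans (avg_mono fun x => ?_)
        rw [abs_mul, abs_of_nonneg (h.left_nonneg _ _)]
        exact mul_le_mul_of_nonneg_right (h.left_le _ _) (abs_nonneg _)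
      have h2 := avg_weight_mul_sq_le (w := fun x : Fin d → G => ν e (e.insertNth y₀ x))
        (fun x => hν0 _ _) fun x => |F x - K x|
      simp only [sq_abs] at h2
      rw [← avg_eq_avg_insertNth e _ (h.indep_majorant e)] at h2
      have h3 : (avg fun x => ν e (e.insertNth y₀ x) * (F x - K x) ^ 2) ≤ 9 * θ := by
        calc _ = (avg fun x => (ν e (e.insertNth y₀ x) - 1) * (F x - K x) ^ 2) +
              avg fun x => (F x - K x) ^ 2 := by
              rw [← avg_add]
              exact avg_congr fun x => by ring
          _ ≤ _ := by linarith
      have h4 : 0 ≤ avg fun x => ν e (e.insertNth y₀ x) * (F x - K x) ^ 2 :=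
        avg_nonneg fun x => mul_nonneg (hν0 _ _) (sq_nonneg _)
      refine h1.trans (abs_le_of_sq_le_sq' ?_ (by positivity)).2
      calc _ ≤ _ := h2
        _ ≤ 2 * (9 * θ) := mul_le_mul (h.pseudorandom.avg_le_two hη1 e) h3 h4 zero_le_two
        _ ≤ _ := by rw [hθ]; nlinarith [sq_nonneg ε]
    have h1 : (avg fun x => ∏ j, f j x) = avg fun x => f e (e.insertNth y₀ x) * F x := by
      rw [← avg_mul_prod_succAbove e _ (h.indep_left e)]
      exact avg_congr fun x => Fin.prod_univ_succAbove _ e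
    have h2 : (avg fun x => ∏ j, g j x) = avg fun x => g e (e.insertNth y₀ x) * K x := by
      rw [← avg_mul_prod_succAbove e _ (h.indep_right e)]
      exact avg_congr fun x => Fin.prod_univ_succAbove _ e
    have h3 : |avg fun x => (f e (e.insertNth y₀ x) - g e (e.insertNth y₀ x)) * K x| ≤ ε / 2 := by
      refine le_trans (le_of_eq ?_) ((h.cut e g h.indep_right h.right_nonneg h.right_le_one).trans hη2)
      rw [avg_mul_prod_succAbove e (fun x => f e x - g e x) (fun x t => by
        change f e _ - g e _ = f e _ - g e _
        rw [h.indep_left e x t, h.indep_right e x t]) g y₀]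
    have h4 : (avg fun x => ∏ j, f j x) - (avg fun x => ∏ j, g j x) =
        (avg fun x => f e (e.insertNth y₀ x) * (F x - K x)) +
        avg fun x => (f e (e.insertNth y₀ x) - g e (e.insertNth y₀ x)) * K x := by
      rw [h1, h2, ← avg_sub, ← avg_add]
      exact avg_congr fun x => by ring
    rw [h4]
    exact (abs_add_le _ _).trans (by linarith)

end CountingLemma

/-- Truncation to the unit interval. -/
def unitClip (t : ℝ) : ℝ := max 0 (min 1 t)

/-- The antiderivative of `unitClip` vanishing at the origin. -/
def unitClipPrim (t : ℝ) : ℝ := t * unitClip t - unitClip t ^ 2 / 2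

lemma unitClip_nonneg (t : ℝ) : 0 ≤ unitClip t := le_max_left _ _

lemma unitClip_le_one (t : ℝ) : unitClip t ≤ 1 := max_le zero_le_one (min_le_left _ _)

lemma unitClipPrim_zero : unitClipPrim 0 = 0 := by simp [unitClipPrim, unitClip]

lemma unitClip_cases (t : ℝ) :
    (t ≤ 0 ∧ unitClip t = 0) ∨ (0 ≤ t ∧ t ≤ 1 ∧ unitClip t = t) ∨ (1 ≤ t ∧ unitClip t = 1) := by
  unfold unitClip
  rcases le_total t 0 with h | h
  · left; exact ⟨h, max_eq_left ((min_le_right _ _).trans h)⟩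
  rcases le_total t 1 with h' | h'
  · right; left; exact ⟨h, h', by rw [min_eq_right h', max_eq_right h]⟩
  · right; right; exact ⟨h', by rw [min_eq_left h', max_eq_right zero_le_one]⟩

lemma unitClipPrim_add_le (t h : ℝ) :
    unitClipPrim (t + h) ≤ unitClipPrim t + unitClip t * h + h ^ 2 / 2 := by
  unfold unitClipPrim
  rcases unitClip_cases t with ⟨h1, h2⟩ | ⟨h1, h1', h2⟩ | ⟨h1, h2⟩ <;>
  rcases unitClip_cases (t + h) with ⟨h3, h4⟩ | ⟨h3, h3', h4⟩ | ⟨h3, h4⟩ <;>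
  rw [h2, h4] <;> nlinarith [sq_nonneg h]

lemma max_zero_le_unitClipPrim_add_half (t : ℝ) : max t 0 ≤ unitClipPrim t + 1 / 2 := by
  unfold unitClipPrim
  rcases unitClip_cases t with ⟨h1, h2⟩ | ⟨h1, h1', h2⟩ | ⟨h1, h2⟩ <;> rw [h2] <;>
  refine max_le ?_ ?_ <;> nlinarith [sq_nonneg (t - 1)]

section DenseModelTheorem

variable {X : Type} [Finite X] {𝓕 : Set (X → ℝ)}

lemma abs_avg_mul_pow_add_le {D Ψ Φ : X → ℝ} {κ η B : ℝ} (hη : |η| ≤ κ) {c : ℝ}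
    (hmul : ∀ F ∈ 𝓕, ∀ H ∈ 𝓕, (fun x => F x * H x) ∈ 𝓕) (hΦ : Φ ∈ 𝓕)
    (h : ∀ j : ℕ, ∀ F ∈ 𝓕, |avg fun x => D x * (Ψ x ^ j * F x)| ≤ c * B ^ j) (j : ℕ) :
    ∀ i : ℕ, ∀ F ∈ 𝓕, |avg fun x => D x * ((Ψ x + η * Φ x) ^ j * (Ψ x ^ i * F x))| ≤
      c * ((B + κ) ^ j * B ^ i) := by
  have hκ : 0 ≤ κ := (abs_nonneg _).trans hη
  induction j with
  | zero => intro i F hF; simpa using h i F hF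
  | succ j ih =>
    intro i F hF
    have h1 : (avg fun x => D x * ((Ψ x + η * Φ x) ^ (j + 1) * (Ψ x ^ i * F x))) =
        (avg fun x => D x * ((Ψ x + η * Φ x) ^ j * (Ψ x ^ (i + 1) * F x))) +
        η * avg fun x => D x * ((Ψ x + η * Φ x) ^ j * (Ψ x ^ i * (Φ x * F x))) := by
      rw [← avg_mul_left, ← avg_add]
      exact avg_congr fun x => by ring
    rw [h1]
    calc _ ≤ _ := abs_add_le _ _
      _ ≤ c * ((B + κ) ^ j * B ^ (i + 1)) + κ * (c * ((B + κ) ^ j * B ^ i)) := by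
        rw [abs_mul]
        exact add_le_add (ih _ F hF)
          (mul_le_mul hη (ih i _ (hmul Φ hΦ F hF)) (abs_nonneg _) hκ)
      _ = _ := by ring

/-- Dense model theorem: a function bounded by `ν`, where `ν - 1` is almost orthogonal to a
multiplicatively closed family of test functions, is indistinguishable by that family from a
function with values in the unit interval. -/
theorem exists_dense_model {η : ℝ} (hη : 0 < η) : ∃ κ : ℝ, 0 < κ ∧
    ∀ (X : Type) [Finite X] [Nonempty X] (𝓕 : Set (X → ℝ)) (ν f : X → ℝ),
    (fun _ => 1) ∈ 𝓕 → (∀ F ∈ 𝓕, ∀ H ∈ 𝓕, (fun x => F x * H x) ∈ 𝓕) →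
    (∀ F ∈ 𝓕, ∀ x, |F x| ≤ 1) → (∀ F ∈ 𝓕, |avg fun x => (ν x - 1) * F x| ≤ κ) →
    (∀ x, 0 ≤ f x) → (∀ x, f x ≤ ν x) →
    ∃ g : X → ℝ, (∀ x, 0 ≤ g x) ∧ (∀ x, g x ≤ 1) ∧
      ∀ F ∈ 𝓕, |avg fun x => (f x - g x) * F x| ≤ η := by
  obtain ⟨T, hT⟩ := exists_nat_ge (2 / η ^ 2)
  rw [div_le_iff₀ (by positivity)] at hT
  obtain ⟨p, hp⟩ := exists_polynomial_near_of_continuousOn (-(T * η)) (T * η) (fun t => max t 0)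
    (by fun_prop) (1 / 16) (by norm_num)
  obtain ⟨C, hC⟩ : ∃ C : ℝ, C = ∑ j ∈ range (p.natDegree + 1), |p.coeff j| * (T * η) ^ j := ⟨_, rfl⟩
  have hC0 : 0 ≤ C := by rw [hC]; positivity
  refine ⟨min 1 (1 / (8 * (C + 1))), by positivity, fun X _ _ 𝓕 ν f hone hmul hbd hν hf0 hfν => ?_⟩
  obtain ⟨κ, hκ⟩ : ∃ κ : ℝ, κ = min 1 (1 / (8 * (C + 1))) := ⟨_, rfl⟩
  rw [← hκ] at hν
  have hκ0 : 0 ≤ κ := by rw [hκ]; positivity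
  have hκ1 : κ ≤ 1 := by rw [hκ]; exact min_le_left _ _
  have hκC : C * κ ≤ 1 / 8 := by
    calc C * κ ≤ (C + 1) * (1 / (8 * (C + 1))) := by
          gcongr
          · linarith
          · rw [hκ]; exact min_le_right _ _
      _ = 1 / 8 := by field_simp
  by_contra! hno
  have key : ∀ t : ℕ, ∃ Ψ : X → ℝ,
      (∀ j : ℕ, ∀ F ∈ 𝓕, |avg fun x => (ν x - 1) * (Ψ x ^ j * F x)| ≤ κ * (t * η) ^ j) ∧
      (∀ x, |Ψ x| ≤ t * η) ∧
      t * η ^ 2 / 2 ≤ (avg fun x => f x * Ψ x) - avg fun x => unitClipPrim (Ψ x) := by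
    intro t
    induction t with
    | zero =>
      refine ⟨fun _ => 0, fun j F hF => ?_, by simp, by simp [unitClipPrim_zero, avg_zero]⟩
      rcases Nat.eq_zero_or_pos j with rfl | hj
      · simpa using hν F hF
      · simp [hj.ne', avg_zero]
    | succ t ih =>
      obtain ⟨Ψ, h1, h2, h3⟩ := ih
      obtain ⟨F, hF, hgap⟩ := hno (fun x => unitClip (Ψ x)) (fun x => unitClip_nonneg _)
        fun x => unitClip_le_one _
      obtain ⟨s, hs, hs'⟩ : ∃ s : ℝ, |s| = 1 ∧
          η < s * avg fun x => (f x - unitClip (Ψ x)) * F x := by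
        rcases abs_cases (avg fun x => (f x - unitClip (Ψ x)) * F x) with ⟨h, -⟩ | ⟨h, -⟩
        · exact ⟨1, by simp, by linarith⟩
        · exact ⟨-1, by simp, by linarith⟩
      have hsη : |η * s| = η := by rw [abs_mul, hs, mul_one, abs_of_pos hη]
      refine ⟨fun x => Ψ x + (η * s) * F x, fun j H hH => ?_, fun x => ?_, ?_⟩
      · have := abs_avg_mul_pow_add_le (D := fun x => ν x - 1) hsη.le hmul hF h1
          j 0 H hH
        simp only [pow_zero, one_mul, mul_one] at this
        convert this using 3
        push_cast; ring
      · calc _ ≤ |Ψ x| + |(η * s) * F x| := abs_add_le _ _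
          _ ≤ t * η + η * 1 := by
            rw [abs_mul _ (F x), hsη]
            gcongr
            exacts [h2 x, hbd F hF x]
          _ = _ := by push_cast; ring
      · have h4 : (avg fun x => unitClipPrim (Ψ x + (η * s) * F x)) ≤
            (avg fun x => unitClipPrim (Ψ x)) +
            (η * s) * (avg fun x => unitClip (Ψ x) * F x) + η ^ 2 / 2 := by
          rw [← avg_mul_left, ← avg_add, ← avg_const (X := X) (η ^ 2 / 2), ← avg_add]
          refine avg_mono fun x => (unitClipPrim_add_le _ _).trans ?_
          have : ((η * s) * F x) ^ 2 ≤ η ^ 2 := by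
            rw [sq_le_sq, abs_mul, hsη, abs_of_pos hη]
            exact mul_le_of_le_one_right hη.le (hbd F hF x)
          linarith
        have h5 : (avg fun x => f x * (Ψ x + (η * s) * F x)) = (avg fun x => f x * Ψ x) +
            (η * s) * avg fun x => f x * F x := by
          rw [← avg_mul_left, ← avg_add]
          exact avg_congr fun x => by ring
        have h6 : (avg fun x => (f x - unitClip (Ψ x)) * F x) = (avg fun x => f x * F x) -
            avg fun x => unitClip (Ψ x) * F x := by
          rw [← avg_sub]
          exact avg_congr fun x => by ring
        rw [h6] at hs'
        rw [h5]
        push_cast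
        have h7 := mul_lt_mul_of_pos_left hs' hη
        nlinarith
  obtain ⟨Ψ, h1, h2, h3⟩ := key T
  have hT1 : 1 ≤ T * η ^ 2 / 2 := by linarith
  have hνle : avg ν ≤ 2 := by
    have := (abs_le.1 (hν _ hone)).2
    simp only [mul_one] at this
    rw [avg_sub, avg_const] at this
    linarith
  have hpoly : |avg fun x => (ν x - 1) * p.eval (Ψ x)| ≤ C * κ := by
    have h4 : (avg fun x => (ν x - 1) * p.eval (Ψ x)) = ∑ j ∈ range (p.natDegree + 1),
        p.coeff j * avg fun x => (ν x - 1) * (Ψ x ^ j * 1) := by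
      simp only [← avg_mul_left]
      rw [← avg_sum]
      refine avg_congr fun x => ?_
      rw [Polynomial.eval_eq_sum_range, Finset.mul_sum]
      exact Finset.sum_congr rfl fun j _ => by ring
    rw [h4, hC, Finset.sum_mul]
    refine (Finset.abs_sum_le_sum_abs _ _).trans (Finset.sum_le_sum fun j _ => ?_)
    rw [abs_mul, mul_assoc]
    refine mul_le_mul_of_nonneg_left ((h1 j _ hone).trans_eq (mul_comm _ _)) (abs_nonneg _)
  have hp' : ∀ x, |p.eval (Ψ x) - max (Ψ x) 0| ≤ 1 / 16 := fun x =>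
    (hp _ (abs_le.1 (h2 x))).le
  have hfΨ : (avg fun x => f x * Ψ x) ≤ avg (fun x => ν x * (1 / 16)) +
      ((avg fun x => (ν x - 1) * p.eval (Ψ x)) + (avg fun x => unitClipPrim (Ψ x) + (1 / 2 + 1 / 16))) := by
    rw [← avg_add, ← avg_add]
    refine avg_mono fun x => ?_
    have h5 : f x * Ψ x ≤ ν x * max (Ψ x) 0 := by
        rcases le_total 0 (Ψ x) with h0 | h0
        · rw [max_eq_left h0]; exact mul_le_mul_of_nonneg_right (hfν x) h0
        · rw [max_eq_right h0, mul_zero]; exact mul_nonpos_of_nonneg_of_nonpos (hf0 x) h0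
    have h6 := abs_le.1 (hp' x)
    have h7 := max_zero_le_unitClipPrim_add_half (Ψ x)
    have h8 : 0 ≤ ν x := (hf0 x).trans (hfν x)
    nlinarith
  rw [avg_mul_right, avg_add, avg_const] at hfΨ
  have := (abs_le.1 hpoly).2
  linarith

end DenseModelTheorem

section SimplexAverage

variable {G : Type} [AddCommGroup G] [Finite G] {d : ℕ}

/-- The average of `∏ i, u i x` over the points `x` with coordinate sum `n`. -/
def simplexAvg (u : Fin (d + 1) → (Fin (d + 1) → G) → ℝ) (n : G) : ℝ :=
  avg fun x : Fin (d + 1) → G => ∏ i, u i (x + Pi.single 0 (n - ∑ i, x i))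

lemma sum_add_single_zero (x : Fin (d + 1) → G) (t : G) :
    ∑ i, (x + Pi.single 0 t : Fin (d + 1) → G) i = ∑ i, x i + t := by
  simp [Finset.sum_add_distrib]

lemma avg_mul_simplexAvg (F : G → ℝ) (u : Fin (d + 1) → (Fin (d + 1) → G) → ℝ) :
    (avg fun n => F n * simplexAvg u n) = avg fun x => F (∑ i, x i) * ∏ i, u i x := by
  simp only [simplexAvg, ← avg_mul_left]
  rw [avg_comm]
  have h1 : ∀ x : Fin (d + 1) → G, (avg fun n => F n * ∏ i, u i (x + Pi.single 0 (n - ∑ i, x i))) =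
      avg fun t => F (∑ i, (x + Pi.single 0 t : Fin (d + 1) → G) i) *
        ∏ i, u i (x + Pi.single 0 t) := fun x => by
    rw [← avg_equiv (Equiv.addLeft (∑ i, x i))]
    refine avg_congr fun t => ?_
    simp only [Equiv.coe_addLeft, sum_add_single_zero, add_sub_cancel_left]
  rw [avg_congr h1, avg_comm]
  have h2 : ∀ t : G, (avg fun x : Fin (d + 1) → G => F (∑ i, (x + Pi.single 0 t : Fin (d + 1) → G) i) *
      ∏ i, u i (x + Pi.single 0 t)) = avg fun x => F (∑ i, x i) * ∏ i, u i x := fun t =>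
    avg_equiv (Equiv.addRight (Pi.single (0 : Fin (d + 1)) t)) fun x => F (∑ i, x i) * ∏ i, u i x
  rw [avg_congr h2, avg_const]

lemma simplexAvg_mul (u v : Fin (d + 1) → (Fin (d + 1) → G) → ℝ) (n : G) :
    simplexAvg u n * simplexAvg v n =
      avg fun z : Fin (d + 1) → G =>
        simplexAvg (fun i x => u i x * v i (x + (z - Pi.single 0 (∑ i, z i)))) n := by
  simp only [simplexAvg]
  symm
  rw [avg_mul_avg, avg_comm]
  symm
  refine avg_congr fun x => ?_
  rw [← avg_equiv (Equiv.addLeft x)]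
  refine avg_congr fun z => ?_
  rw [← Finset.prod_mul_distrib]
  refine Finset.prod_congr rfl fun i _ => ?_
  congr 2
  simp only [Equiv.coe_addLeft, Pi.add_apply, Finset.sum_add_distrib]
  rw [sub_add_eq_sub_sub, Pi.single_sub]
  abel

/-- Convex combinations of averages of products of bounded lower-dimensional functions over the
fibres of the coordinate sum. -/
def simplexClass (G : Type) [AddCommGroup G] [Finite G] (d : ℕ) : Set (G → ℝ) :=
  {F | ∃ (Q : Type) (_ : Finite Q) (_ : Nonempty Q) (u : Q → Fin (d + 1) → (Fin (d + 1) → G) → ℝ),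
    (∀ q i, IndepCoord i (u q i)) ∧ (∀ q i x, 0 ≤ u q i x) ∧ (∀ q i x, u q i x ≤ 1) ∧
    ∀ n, F n = avg fun q => simplexAvg (u q) n}

lemma one_mem_simplexClass : (fun _ => 1) ∈ simplexClass G d :=
  ⟨Unit, inferInstance, inferInstance, fun _ _ _ => 1, fun _ _ _ _ => rfl, fun _ _ _ => zero_le_one,
    fun _ _ _ => le_rfl, fun n => by simp [simplexAvg, avg_const]⟩

lemma IndepCoord.comp_add {i : Fin d} {f : (Fin d → G) → ℝ} (hf : IndepCoord i f) (z : Fin d → G) :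
    IndepCoord i fun x => f (x + z) := fun x t => by
  change f _ = f _
  rw [← hf (x + z) (t + z i)]
  congr 1
  ext j
  rcases eq_or_ne j i with rfl | h <;> simp [*]

lemma mul_mem_simplexClass {F H : G → ℝ} (hF : F ∈ simplexClass G d) (hH : H ∈ simplexClass G d) :
    (fun n => F n * H n) ∈ simplexClass G d := by
  obtain ⟨Q, _, _, u, hu, hu0, hu1, huF⟩ := hF
  obtain ⟨R, _, _, v, hv, hv0, hv1, hvH⟩ := hH
  refine ⟨Q × R × (Fin (d + 1) → G), inferInstance, inferInstance,
    fun q i x => u q.1 i x * v q.2.1 i (x + (q.2.2 - Pi.single 0 (∑ i, q.2.2 i))),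
    fun q i x t => ?_, fun q i x => mul_nonneg (hu0 _ _ _) (hv0 _ _ _),
    fun q i x => mul_le_one₀ (hu1 _ _ _) (hv0 _ _ _) (hv1 _ _ _), fun n => ?_⟩
  · change u q.1 i _ * _ = u q.1 i _ * _
    rw [hu q.1 i x t]
    congr 1
    exact (hv q.2.1 i).comp_add _ x t
  · simp only [huF, hvH]
    rw [avg_prod, avg_mul_avg]
    refine avg_congr fun q => ?_
    rw [avg_prod]
    exact avg_congr fun r => simplexAvg_mul _ _ _

lemma abs_le_one_of_mem_simplexClass {F : G → ℝ} (hF : F ∈ simplexClass G d) (n : G) :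
    |F n| ≤ 1 := by
  obtain ⟨Q, _, _, u, hu, hu0, hu1, huF⟩ := hF
  have h0 : ∀ q, 0 ≤ simplexAvg (u q) n := fun q =>
    avg_nonneg fun x => Finset.prod_nonneg fun i _ => hu0 _ _ _
  have h1 : ∀ q, simplexAvg (u q) n ≤ 1 := fun q =>
    avg_le_of_forall_le zero_le_one fun x => Finset.prod_le_one (fun i _ => hu0 _ _ _)
      fun i _ => hu1 _ _ _
  rw [huF, abs_of_nonneg (avg_nonneg h0)]
  exact avg_le_of_forall_le zero_le_one h1

lemma IndepCoord.comp_apply {i : Fin d} {f : (Fin d → G) → ℝ} (hf : IndepCoord i f)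
    (c : Fin d → G → G) : IndepCoord i fun x => f fun j => c j (x j) := fun x t => by
  change f _ = f _
  rw [← hf (fun j => c j (x j)) (c i t)]
  congr 1
  ext j
  rcases eq_or_ne j i with rfl | h <;> simp [*]

end SimplexAverage

section ArithmeticForms

variable {m : ℕ} {d : ℕ}

/-- The linear form `∑ i, (i - j) x_i`, which does not involve `x_j`. -/
def apForm (j : Fin (d + 1)) (x : Fin (d + 1) → ZMod m) : ZMod m :=
  ∑ i : Fin (d + 1), (((i : ℕ) : ZMod m) - ((j : ℕ) : ZMod m)) * x i

lemma indepCoord_apForm (j : Fin (d + 1)) (f : ZMod m → ℝ) :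
    IndepCoord j fun x => f (apForm j x) := fun x t => by
  change f _ = f _
  congr 1
  refine Finset.sum_congr rfl fun i _ => ?_
  rcases eq_or_ne i j with rfl | h
  · simp
  · rw [Function.update_of_ne h]

lemma apForm_insertNth (j : Fin (d + 1)) (y : ZMod m) (x : Fin d → ZMod m) :
    apForm j (j.insertNth y x) =
      ∑ i, (((j.succAbove i : ℕ) : ZMod m) - ((j : ℕ) : ZMod m)) * x i := by
  rw [apForm, Fin.sum_univ_succAbove _ j]
  simp

lemma apForm_eq (j : Fin (d + 1)) (x : Fin (d + 1) → ZMod m) :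
    apForm j x = (∑ i : Fin (d + 1), ((i : ℕ) : ZMod m) * x i) + (j : ℕ) • (-∑ i, x i) := by
  simp only [apForm, sub_mul, Finset.sum_sub_distrib, ← Finset.mul_sum, nsmul_eq_mul]
  ring

lemma natCast_sub_natCast_ne_zero {a b : ℕ} (ha : a < m) (hb : b < m) (hab : a ≠ b) :
    (a : ZMod m) - b ≠ 0 := by
  rw [sub_ne_zero, Ne, ZMod.natCast_eq_natCast_iff]
  intro h
  exact hab (Nat.ModEq.eq_of_lt_of_lt h ha hb)

variable [hm : Fact m.Prime]

lemma avg_scale {d : ℕ} (c : Fin d → ZMod m) (hc : ∀ i, c i ≠ 0) (F : (Fin d → ZMod m) → ℝ) :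
    (avg fun x : Fin d → ZMod m => F fun i => c i * x i) = avg F :=
  avg_equiv (Equiv.piCongrRight fun i => Equiv.mulLeft₀ (c i) (hc i)) F

lemma avg_apForm_mul_prod (hdm : d + 1 < m) (j : Fin (d + 2))
    (u : Fin (d + 2) → (Fin (d + 2) → ZMod m) → ℝ) (hu : ∀ i, IndepCoord i (u i))
    (hu0 : ∀ i x, 0 ≤ u i x) (hu1 : ∀ i x, u i x ≤ 1) :
    ∃ F ∈ simplexClass (ZMod m) d, ∀ h : ZMod m → ℝ,
      (avg fun x => h (apForm j x) * ∏ i, u (j.succAbove i) x) = avg fun n => h n * F n := by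
  obtain ⟨c, hc⟩ : ∃ c : Fin (d + 1) → ZMod m,
    c = fun i => ((j.succAbove i : ℕ) : ZMod m) - ((j : ℕ) : ZMod m) := ⟨_, rfl⟩
  have hc0 : ∀ i, c i ≠ 0 := fun i => by
    rw [hc]
    refine natCast_sub_natCast_ne_zero ?_ ?_ ?_
    · have := (j.succAbove i).2; omega
    · have := j.2; omega
    · exact fun h => Fin.succAbove_ne j i (Fin.ext h)
  obtain ⟨v, hv⟩ : ∃ v : ZMod m → Fin (d + 1) → (Fin (d + 1) → ZMod m) → ℝ,
    v = fun y i z => u (j.succAbove i) (j.insertNth y fun l => (c l)⁻¹ * z l) := ⟨_, rfl⟩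
  refine ⟨fun n => avg fun y => simplexAvg (v y) n, ⟨ZMod m, inferInstance, inferInstance, v,
    fun y i => ?_, fun y i x => ?_, fun y i x => ?_, fun n => rfl⟩, fun h => ?_⟩
  · rw [hv]
    exact ((hu (j.succAbove i)).insertNth_succAbove y).comp_apply fun l z => (c l)⁻¹ * z
  · rw [hv]; exact hu0 _ _
  · rw [hv]; exact hu1 _ _
  · simp only [← avg_mul_left]
    rw [avg_insertNth j, avg_comm (X := ZMod m) (Y := ZMod m)]
    refine avg_congr fun y => ?_
    rw [avg_mul_simplexAvg]
    refine Eq.trans (avg_congr fun x => ?_) (avg_scale c hc0 _)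
    rw [apForm_insertNth, hv, hc]
    refine congrArg₂ _ rfl (Finset.prod_congr rfl fun i _ => ?_)
    have : ∀ l, (c l)⁻¹ * (c l * x l) = x l := fun l => inv_mul_cancel_left₀ (hc0 l) _
    rw [hc] at this
    simp only [this]

lemma CubePseudorandom.abs_avg_sub_one_mul_le (hdm : d + 1 < m) {ν : ZMod m → ℝ} {η : ℝ}
    (hη : η ≤ 1) (h : CubePseudorandom (fun (j : Fin (d + 2)) x => ν (apForm j x)) η)
    {κ : ℝ} (hκ : 0 ≤ κ) (hηκ : 4 ^ 2 ^ (d + 1) * η ≤ κ ^ 2 ^ (d + 1)) {F : ZMod m → ℝ}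
    (hF : F ∈ simplexClass (ZMod m) d) : |avg fun n => (ν n - 1) * F n| ≤ κ := by
  obtain ⟨Q, _, _, u, hu, hu0, hu1, huF⟩ := hF
  have key : ∀ q, |avg fun n => (ν n - 1) * simplexAvg (u q) n| ≤ κ := by
    intro q
    obtain ⟨c, hc⟩ : ∃ c : Fin (d + 1) → ZMod m,
      c = fun i => (((0 : Fin (d + 2)).succAbove i : ℕ) : ZMod m) -
        (((0 : Fin (d + 2)) : ℕ) : ZMod m) := ⟨_, rfl⟩
    have hc0 : ∀ i, c i ≠ 0 := fun i => by
      rw [hc]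
      refine natCast_sub_natCast_ne_zero ?_ ?_ ?_
      · have := ((0 : Fin (d + 2)).succAbove i).2; omega
      · have := (0 : Fin (d + 2)).2; omega
      · exact fun h => Fin.succAbove_ne 0 i (Fin.ext h)
    have h1 := abs_avg_sub_one_mul_prod_pow_le (P := Bool → ZMod m) (n := d + 1)
      (Nat.succ_ne_zero d) hη
      (fun p x => ν (apForm 0 ((0 : Fin (d + 2)).insertNth (α := fun _ => ZMod m) (p false) x)))
      (fun i _ x => u q i fun l => c l * x l) (fun _ _ _ => 1)
      (fun i p => (hu q i).comp_apply fun l z => c l * z) (fun i p x t => rfl)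
      (fun i p x => by rw [abs_of_nonneg (hu0 _ _ _)]; exact hu1 _ _ _)
      (fun S A hA => by simpa using h.abs_insertNth_le 0 S (fun _ _ _ => false) (by simp))
    have h2 : (avg fun p : Bool → ZMod m => avg fun x : Fin (d + 1) → ZMod m =>
        (ν (apForm 0 ((0 : Fin (d + 2)).insertNth (α := fun _ => ZMod m) (p false) x)) - 1) *
        ∏ i, u q i fun l => c l * x l) = avg fun n => (ν n - 1) * simplexAvg (u q) n := by
      rw [avg_mul_simplexAvg (fun n => ν n - 1), ← avg_scale c hc0]
      refine Eq.trans (avg_congr fun p => avg_congr fun x => ?_)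
        (avg_const (X := Bool → ZMod m) _)
      rw [apForm_insertNth, hc]
    rw [h2] at h1
    exact (pow_le_pow_iff_left₀ (abs_nonneg _) hκ (by positivity)).1 (h1.trans hηκ)
  simp only [huF, ← avg_mul_left]
  rw [avg_comm]
  exact (abs_avg_le _).trans (avg_le_of_forall_le hκ key)

lemma avg_prod_apForm (f : ZMod m → ℝ) :
    (avg fun x : Fin (d + 2) → ZMod m => ∏ j, f (apForm j x)) =
      avg fun p : ZMod m × ZMod m => ∏ j : Fin (d + 2), f (p.1 + (j : ℕ) • p.2) := by
  let φ : (Fin (d + 2) → ZMod m) →+ ZMod m × ZMod m :=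
    { toFun := fun x => (∑ i : Fin (d + 2), ((i : ℕ) : ZMod m) * x i, -∑ i, x i)
      map_zero' := by simp
      map_add' := fun x y => by
        simp only [Pi.add_apply, mul_add, Finset.sum_add_distrib, neg_add, Prod.mk_add_mk] }
  rw [← avg_addMonoidHom φ]
  · exact avg_congr fun x => Finset.prod_congr rfl fun j _ => by rw [apForm_eq]; rfl
  · rintro ⟨a, r⟩
    refine ⟨Pi.single 1 a + Pi.single 0 (-r - a), Prod.ext ?_ ?_⟩
    · change ∑ i : Fin (d + 2), _ = a
      simp [mul_add, Finset.sum_add_distrib, Pi.single_apply]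
    · change -∑ i : Fin (d + 2), _ = r
      simp [Finset.sum_add_distrib]

end ArithmeticForms

/-- Relative Szemerédi theorem. -/
theorem exists_pos_le_avg_prod_of_pseudorandom (d : ℕ) {δ : ℝ} (hδ : 0 < δ) :
    ∃ c : ℝ, 0 < c ∧ ∃ η : ℝ, 0 < η ∧ ∀ (m : ℕ) [Fact m.Prime], d + 1 < m → ∀ ν f : ZMod m → ℝ,
      CubePseudorandom (fun (j : Fin (d + 2)) x => ν (apForm j x)) η → (∀ x, 0 ≤ f x) →
      (∀ x, f x ≤ ν x) → δ ≤ avg f →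
      c ≤ avg fun p : ZMod m × ZMod m => ∏ j : Fin (d + 2), f (p.1 + (j : ℕ) • p.2) := by
  obtain ⟨c, hc, hvar⟩ := exists_pos_le_avg_prod_progression (d + 2) (by omega) (half_pos hδ)
  obtain ⟨η₁, hη₁, hη₁', hcount⟩ := abs_avg_prod_sub_le (d := d + 1) (Nat.succ_ne_zero d) (d + 2)
    (c / 2 ^ (d + 3)) (by positivity)
  obtain ⟨κ, hκ, hdense⟩ := exists_dense_model (lt_min hη₁ (half_pos hδ))
  refine ⟨c / 2, by positivity, min η₁ ((κ / 4) ^ 2 ^ (d + 1)), by positivity,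
    fun m _ hdm ν f hν hf0 hfν hfδ => ?_⟩
  have hηκ : 4 ^ 2 ^ (d + 1) * min η₁ ((κ / 4) ^ 2 ^ (d + 1)) ≤ κ ^ 2 ^ (d + 1) :=
    calc _ ≤ 4 ^ 2 ^ (d + 1) * (κ / 4) ^ 2 ^ (d + 1) := by gcongr; exact min_le_right _ _
      _ = _ := by rw [← mul_pow]; congr 1; ring
  obtain ⟨g, hg0, hg1, hfg⟩ := hdense (ZMod m) (simplexClass (ZMod m) d) ν f one_mem_simplexClass
    (fun F hF H hH => mul_mem_simplexClass hF hH) (fun F hF => abs_le_one_of_mem_simplexClass hF)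
    (fun F hF => hν.abs_avg_sub_one_mul_le hdm ((min_le_left _ _).trans hη₁') hκ.le hηκ hF)
    hf0 hfν
  have hg : δ / 2 ≤ avg g := by
    have := (abs_le.1 ((hfg _ one_mem_simplexClass).trans (min_le_right _ _))).2
    simp only [mul_one] at this
    rw [avg_sub] at this
    linarith
  have h1 := hcount (ZMod m) (fun j x => (1 + ν (apForm j x)) / 2) (fun j x => f (apForm j x) / 2)
    (fun j x => g (apForm j x) / 2)
    { indep_majorant := fun j => indepCoord_apForm j fun n => (1 + ν n) / 2
      indep_left := fun j => indepCoord_apForm j fun n => f n / 2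
      indep_right := fun j => indepCoord_apForm j fun n => g n / 2
      left_nonneg := fun j x => by have := hf0 (apForm j x); linarith
      right_nonneg := fun j x => by have := hg0 (apForm j x); linarith
      left_le := fun j x => by have := hfν (apForm j x); linarith
      right_le := fun j x => by
        have := hf0 (apForm j x); have := hfν (apForm j x); have := hg1 (apForm j x); linarith
      right_le_one := fun j x => by have := hg1 (apForm j x); linarith
      pseudorandom := fun A hA => (hν.half_one_add A hA).trans (min_le_left _ _)
      cut := fun j u hu hu0 hu1 => by
        obtain ⟨F, hF, hFh⟩ := avg_apForm_mul_prod hdm j u hu hu0 hu1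
        rw [hFh fun n => f n / 2 - g n / 2]
        have h2 : (avg fun n => (f n / 2 - g n / 2) * F n) =
            1 / 2 * avg fun n => (f n - g n) * F n := by
          rw [← avg_mul_left]; exact avg_congr fun n => by ring
        have h3 := (hfg F hF).trans (min_le_left _ _)
        rw [h2, abs_mul, abs_of_pos one_half_pos]
        linarith [abs_nonneg (avg fun n => (f n - g n) * F n)] }
    univ (by simp) (by simp)
  have h2 : ∀ q : ZMod m → ℝ, (avg fun x : Fin (d + 2) → ZMod m => ∏ j, q (apForm j x) / 2) =
      (avg fun p : ZMod m × ZMod m => ∏ j : Fin (d + 2), q (p.1 + (j : ℕ) • p.2)) / 2 ^ (d + 2) :=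
    fun q => by
      rw [← avg_prod_apForm, div_eq_mul_inv, ← avg_mul_right]
      exact avg_congr fun x => by rw [Finset.prod_div_distrib]; simp [div_eq_mul_inv]
  rw [h2 f, h2 g, ← sub_div, abs_div, abs_of_pos (by positivity : (0 : ℝ) < 2 ^ (d + 2)),
    div_le_iff₀ (by positivity), pow_succ 2 (d + 2), ← div_div, div_right_comm,
    div_mul_cancel₀ _ (by positivity)] at h1
  have h3 := hvar (ZMod m) g hg0 hg1 hg
  have h4 := (abs_le.1 h1).1
  linarith

section SelbergWeights

/-- The product of the elements of a finite set of primes. -/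
def setProd (s : Finset ℕ) : ℝ := ∏ p ∈ s, (p : ℝ)

/-- The value of Euler's totient function at the product of a finite set of primes. -/
def setTot (s : Finset ℕ) : ℝ := ∏ p ∈ s, ((p : ℝ) - 1)

/-- The subsets of `P` whose product is at most `R`. -/
def sieveSupport (P : Finset ℕ) (R : ℝ) : Finset (Finset ℕ) :=
  P.powerset.filter fun h => setProd h ≤ R

/-- The normalising factor of Selberg's weights. -/
def sieveMass (P : Finset ℕ) (R : ℝ) : ℝ := ∑ h ∈ sieveSupport P R, (setTot h)⁻¹

/-- Selberg's weights. -/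
def sieveWeight (P : Finset ℕ) (R : ℝ) (d : Finset ℕ) : ℝ :=
  (-1) ^ #d * setProd d / sieveMass P R *
    ∑ h ∈ sieveSupport P R, if d ⊆ h then (setTot h)⁻¹ else 0

variable {P : Finset ℕ} {R : ℝ}

lemma setProd_union {s t : Finset ℕ} (h : Disjoint s t) :
    setProd (s ∪ t) = setProd s * setProd t := Finset.prod_union h

lemma setTot_union {s t : Finset ℕ} (h : Disjoint s t) :
    setTot (s ∪ t) = setTot s * setTot t := Finset.prod_union h

lemma one_le_setProd {s : Finset ℕ} (h : ∀ p ∈ s, 2 ≤ p) : 1 ≤ setProd s :=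
  Finset.one_le_prod fun p hp => by exact_mod_cast one_le_two.trans (h p hp)

lemma one_le_setTot {s : Finset ℕ} (h : ∀ p ∈ s, 2 ≤ p) : 1 ≤ setTot s :=
  Finset.one_le_prod fun p hp => by
    have : (2 : ℝ) ≤ p := by exact_mod_cast h p hp
    linarith

lemma setProd_mono {s t : Finset ℕ} (hst : s ⊆ t) (h : ∀ p ∈ t, 2 ≤ p) :
    setProd s ≤ setProd t := by
  rw [← Finset.union_sdiff_of_subset hst, setProd_union Finset.disjoint_sdiff]
  exact le_mul_of_one_le_right (zero_le_one.trans (one_le_setProd fun p hp => h p (hst hp)))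
    (one_le_setProd fun p hp => h p (Finset.sdiff_subset hp))

lemma setTot_mono {s t : Finset ℕ} (hst : s ⊆ t) (h : ∀ p ∈ t, 2 ≤ p) :
    setTot s ≤ setTot t := by
  rw [← Finset.union_sdiff_of_subset hst, setTot_union Finset.disjoint_sdiff]
  exact le_mul_of_one_le_right (zero_le_one.trans (one_le_setTot fun p hp => h p (hst hp)))
    (one_le_setTot fun p hp => h p (Finset.sdiff_subset hp))

lemma setProd_le_two_pow_mul_setTot {s : Finset ℕ} (h : ∀ p ∈ s, 2 ≤ p) :
    setProd s ≤ 2 ^ #s * setTot s := by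
  rw [setTot, setProd, ← Finset.prod_const, ← Finset.prod_mul_distrib]
  refine Finset.prod_le_prod (fun p _ => by positivity) fun p hp => ?_
  have : (2 : ℝ) ≤ p := by exact_mod_cast h p hp
  linarith

lemma setProd_union_mul_inter (s t : Finset ℕ) :
    setProd (s ∪ t) * setProd (s ∩ t) = setProd s * setProd t := Finset.prod_union_inter

lemma setProd_eq_sum_setTot (s : Finset ℕ) : setProd s = ∑ g ∈ s.powerset, setTot g := by
  refine Eq.trans (Finset.prod_congr rfl fun p _ => ?_)
    (Finset.prod_add_one (f := fun p : ℕ => (p : ℝ) - 1) s)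
  ring

lemma sum_powerset_eq_sum_sum {m Q : Finset ℕ} (hm : m ⊆ Q) (F : Finset ℕ → ℝ) :
    ∑ d ∈ Q.powerset, F d = ∑ a ∈ m.powerset, ∑ b ∈ (Q \ m).powerset, F (a ∪ b) := by
  rw [← Finset.sum_product']
  refine Finset.sum_nbij' (fun d => (d ∩ m, d \ m)) (fun ab => ab.1 ∪ ab.2) ?_ ?_ ?_ ?_ ?_
  · intro d hd
    rw [Finset.mem_powerset] at hd
    rw [Finset.mem_product, Finset.mem_powerset, Finset.mem_powerset]
    exact ⟨Finset.inter_subset_right, Finset.sdiff_subset_sdiff hd le_rfl⟩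
  · intro ab hab
    rw [Finset.mem_product, Finset.mem_powerset, Finset.mem_powerset] at hab
    rw [Finset.mem_powerset]
    exact Finset.union_subset (hab.1.trans hm) (hab.2.trans Finset.sdiff_subset)
  · intro d _
    ext p; simp only [Finset.mem_union, Finset.mem_inter, Finset.mem_sdiff]; tauto
  · rintro ⟨a, b⟩ hab
    rw [Finset.mem_product, Finset.mem_powerset, Finset.mem_powerset] at hab
    obtain ⟨ha, hb⟩ := hab
    refine Prod.ext ?_ ?_ <;> ext p <;> have h1 := @ha p <;> have h2 := @hb p <;>
      simp only [Finset.mem_union, Finset.mem_inter, Finset.mem_sdiff] at * <;> tauto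
  · intro d _
    congr 1
    ext p; simp only [Finset.mem_union, Finset.mem_inter, Finset.mem_sdiff]; tauto

lemma sum_neg_one_pow_card_interval {g e Q : Finset ℕ} (he : e ⊆ Q) :
    ∑ b ∈ Q.powerset, (if g ⊆ b ∧ b ⊆ e then (-1 : ℝ) ^ #b else 0) =
      if e = g then (-1) ^ #g else 0 := by
  rw [← Finset.sum_filter]
  by_cases hge : g ⊆ e
  · have h1 : ∑ b ∈ Q.powerset with g ⊆ b ∧ b ⊆ e, (-1 : ℝ) ^ #b =
        ∑ c ∈ (e \ g).powerset, (-1) ^ #g * (-1) ^ #c := by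
      refine Finset.sum_nbij' (fun b => b \ g) (fun c => g ∪ c) ?_ ?_ ?_ ?_ ?_
      · intro b hb
        rw [Finset.mem_filter] at hb
        exact Finset.mem_powerset.2 (Finset.sdiff_subset_sdiff hb.2.2 le_rfl)
      · intro c hc
        rw [Finset.mem_powerset] at hc
        have : g ∪ c ⊆ e := Finset.union_subset hge (hc.trans Finset.sdiff_subset)
        exact Finset.mem_filter.2 ⟨Finset.mem_powerset.2 (this.trans he),
          Finset.subset_union_left, this⟩
      · intro b hb
        exact Finset.union_sdiff_of_subset (Finset.mem_filter.1 hb).2.1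
      · intro c hc
        rw [Finset.mem_powerset] at hc
        exact Finset.union_sdiff_cancel_left (Finset.disjoint_of_subset_right hc Finset.disjoint_sdiff)
      · intro b hb
        rw [← pow_add, Finset.card_sdiff_of_subset (Finset.mem_filter.1 hb).2.1,
          Nat.add_sub_of_le (Finset.card_le_card (Finset.mem_filter.1 hb).2.1)]
    have h2 : ∑ c ∈ (e \ g).powerset, (-1 : ℝ) ^ #c = if e \ g = ∅ then 1 else 0 := by
      exact_mod_cast congrArg (Int.cast (R := ℝ)) (Finset.sum_powerset_neg_one_pow_card (x := e \ g))
    rw [h1, ← Finset.mul_sum, h2]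
    by_cases heg : e ⊆ g
    · rw [if_pos (Finset.sdiff_eq_empty_iff_subset.2 heg), if_pos (heg.antisymm hge), mul_one]
    · rw [if_neg (mt Finset.sdiff_eq_empty_iff_subset.1 heg), if_neg fun h => heg h.le, mul_zero]
  · rw [if_neg fun h => hge h.ge]
    refine Finset.sum_eq_zero fun b hb => ?_
    rw [Finset.mem_filter] at hb
    exact absurd (hb.2.1.trans hb.2.2) hge

lemma sum_sieveWeight_div_eq {m a g : Finset ℕ} (hP : ∀ p ∈ P, 2 ≤ p) (ha : a ⊆ m) :
    ∑ b ∈ (P \ m).powerset, (if g ⊆ b then sieveWeight P R (a ∪ b) / setProd b else 0) =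
      (-1) ^ (#a + #g) * setProd a / sieveMass P R *
        ∑ h ∈ sieveSupport P R, if a ⊆ h ∧ h \ m = g then (setTot h)⁻¹ else 0 := by
  have h1 : ∀ b ∈ (P \ m).powerset, (if g ⊆ b then sieveWeight P R (a ∪ b) / setProd b else 0) =
      ∑ h ∈ sieveSupport P R, (-1) ^ #a * setProd a / sieveMass P R *
        ((if a ⊆ h then (setTot h)⁻¹ else 0) *
          if g ⊆ b ∧ b ⊆ h \ m then (-1) ^ #b else 0) := fun b hb => by
    rw [Finset.mem_powerset] at hb
    have hd : Disjoint a b :=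
      Finset.disjoint_of_subset_left ha (Finset.disjoint_of_subset_right hb Finset.disjoint_sdiff)
    have hbm : Disjoint b m := Finset.disjoint_of_subset_left hb Finset.sdiff_disjoint
    by_cases hg : g ⊆ b
    · rw [if_pos hg, sieveWeight, setProd_union hd, Finset.card_union_of_disjoint hd,
        Finset.mul_sum, Finset.sum_div]
      refine Finset.sum_congr rfl fun h _ => ?_
      have hb0 : setProd b ≠ 0 := (zero_lt_one.trans_le (one_le_setProd fun p hp =>
        hP p (Finset.sdiff_subset (hb hp)))).ne'
      have hbh : b ⊆ h \ m ↔ b ⊆ h := by rw [Finset.subset_sdiff]; exact and_iff_left hbm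
      simp only [Finset.union_subset_iff, hg, true_and, hbh]
      by_cases h2 : a ⊆ h <;> by_cases h3 : b ⊆ h <;> simp only [h2, h3, and_self, and_true,
        and_false, if_true, if_false, mul_zero, zero_mul, zero_div]
      rw [pow_add]
      field_simp
    · simp [hg]
  rw [Finset.sum_congr rfl h1, Finset.sum_comm, pow_add]
  rw [Finset.mul_sum]
  refine Finset.sum_congr rfl fun h hh => ?_
  rw [sieveSupport, Finset.mem_filter, Finset.mem_powerset] at hh
  simp only [← Finset.mul_sum]
  rw [sum_neg_one_pow_card_interval (Finset.sdiff_subset_sdiff hh.1 le_rfl)]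
  by_cases h2 : a ⊆ h <;> by_cases h3 : h \ m = g <;> simp [h2, h3]
  ring

lemma inv_setProd_union (hP : ∀ p ∈ P, 2 ≤ p) {Q b b' : Finset ℕ} (hQ : Q ⊆ P) (hb : b ⊆ Q)
    (hb' : b' ⊆ Q) : (setProd (b ∪ b'))⁻¹ = ∑ g ∈ Q.powerset, setTot g *
      ((if g ⊆ b then (setProd b)⁻¹ else 0) * if g ⊆ b' then (setProd b')⁻¹ else 0) := by
  have h0 : ∀ c ⊆ Q, setProd c ≠ 0 := fun c hc =>
    (zero_lt_one.trans_le (one_le_setProd fun p hp => hP p (hQ (hc hp)))).ne'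
  have h1 : ∀ g : Finset ℕ, setTot g *
      ((if g ⊆ b then (setProd b)⁻¹ else 0) * if g ⊆ b' then (setProd b')⁻¹ else 0) =
      if g ⊆ b ∩ b' then setTot g * ((setProd b)⁻¹ * (setProd b')⁻¹) else 0 := fun g => by
    simp only [Finset.subset_inter_iff]
    by_cases h2 : g ⊆ b <;> by_cases h3 : g ⊆ b' <;> simp [h2, h3]
  simp only [h1]
  rw [← Finset.sum_filter, ← Finset.sum_mul]
  have h4 : Q.powerset.filter (fun g => g ⊆ b ∩ b') = (b ∩ b').powerset := by
    ext g
    simp only [Finset.mem_filter, Finset.mem_powerset]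
    exact and_iff_right_of_imp fun h => h.trans (Finset.inter_subset_left.trans hb)
  rw [h4, ← setProd_eq_sum_setTot, ← mul_inv, ← setProd_union_mul_inter]
  have := h0 _ (Finset.union_subset hb hb')
  have := h0 _ (Finset.inter_subset_left.trans hb : b ∩ b' ⊆ Q)
  field_simp

lemma sum_sum_sieveWeight_eq (hP : ∀ p ∈ P, 2 ≤ p) {m s : Finset ℕ} (hm : m ⊆ P) :
    ∑ d ∈ P.powerset, ∑ d' ∈ P.powerset, (if (d ∪ d') ∩ m = s then
      sieveWeight P R d * sieveWeight P R d' / setProd (d ∪ d') else 0) =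
    ∑ a ∈ m.powerset, ∑ a' ∈ m.powerset, if a ∪ a' = s then (setProd s)⁻¹ *
      ∑ g ∈ (P \ m).powerset, setTot g *
        ((∑ b ∈ (P \ m).powerset, if g ⊆ b then sieveWeight P R (a ∪ b) / setProd b else 0) *
        ∑ b ∈ (P \ m).powerset, if g ⊆ b then sieveWeight P R (a' ∪ b) / setProd b else 0)
      else 0 := by
  rw [sum_powerset_eq_sum_sum hm]
  simp only [sum_powerset_eq_sum_sum hm]
  refine Finset.sum_congr rfl fun a ha => ?_
  rw [Finset.sum_comm]
  refine Finset.sum_congr rfl fun a' ha' => ?_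
  rw [Finset.mem_powerset] at ha ha'
  have h1 : ∀ b ∈ (P \ m).powerset, ∀ b' ∈ (P \ m).powerset,
      ((a ∪ b ∪ (a' ∪ b')) ∩ m = s ↔ a ∪ a' = s) ∧
      (setProd (a ∪ b ∪ (a' ∪ b')))⁻¹ = (setProd (a ∪ a'))⁻¹ *
        ∑ g ∈ (P \ m).powerset, setTot g *
          ((if g ⊆ b then (setProd b)⁻¹ else 0) * if g ⊆ b' then (setProd b')⁻¹ else 0) := by
    intro b hb b' hb'
    rw [Finset.mem_powerset] at hb hb'
    constructor
    · have : (a ∪ b ∪ (a' ∪ b')) ∩ m = a ∪ a' := by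
        ext p
        have h1 := @ha p; have h2 := @ha' p; have h3 := @hb p; have h4 := @hb' p
        simp only [Finset.mem_union, Finset.mem_inter, Finset.mem_sdiff] at *
        tauto
      rw [this]
    · rw [← inv_setProd_union hP Finset.sdiff_subset hb hb', ← mul_inv, ← setProd_union,
        Finset.union_union_union_comm]
      exact Finset.disjoint_of_subset_left (Finset.union_subset ha ha')
        (Finset.disjoint_of_subset_right (Finset.union_subset hb hb') Finset.disjoint_sdiff)
  by_cases hs : a ∪ a' = s
  · rw [if_pos hs]
    have h2 : ∀ b ∈ (P \ m).powerset, ∀ b' ∈ (P \ m).powerset,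
        (if (a ∪ b ∪ (a' ∪ b')) ∩ m = s then sieveWeight P R (a ∪ b) * sieveWeight P R (a' ∪ b') /
          setProd (a ∪ b ∪ (a' ∪ b')) else 0) = ∑ g ∈ (P \ m).powerset, (setProd s)⁻¹ * (setTot g *
          ((if g ⊆ b then sieveWeight P R (a ∪ b) / setProd b else 0) *
          if g ⊆ b' then sieveWeight P R (a' ∪ b') / setProd b' else 0)) := by
      intro b hb b' hb'
      rw [if_pos ((h1 b hb b' hb').1.2 hs), div_eq_mul_inv, (h1 b hb b' hb').2, hs, Finset.mul_sum,
        Finset.mul_sum]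
      refine Finset.sum_congr rfl fun g _ => ?_
      by_cases h3 : g ⊆ b <;> by_cases h4 : g ⊆ b' <;>
        simp only [h3, h4, if_true, if_false, mul_zero, zero_mul]
      ring
    rw [Finset.sum_congr rfl fun b hb => Finset.sum_congr rfl fun b' hb' => h2 b hb b' hb',
      Finset.mul_sum]
    simp only [Finset.sum_mul_sum]
    simp only [Finset.mul_sum]
    rw [Finset.sum_congr rfl fun b _ => Finset.sum_comm, Finset.sum_comm]
  · rw [if_neg hs]
    exact Finset.sum_eq_zero fun b hb => Finset.sum_eq_zero fun b' hb' =>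
      if_neg fun h => hs ((h1 b hb b' hb').1.1 h)

end SelbergWeights

section SelbergBracket

variable {P : Finset ℕ} {R : ℝ}

/-- The contribution to the Selberg quadratic form of the pairs of sets whose union meets `m`
in `s`, with the primes in `m` removed from the denominators. -/
def sieveBracket (P : Finset ℕ) (R : ℝ) (m s : Finset ℕ) : ℝ :=
  ∑ d ∈ P.powerset, ∑ d' ∈ P.powerset, if (d ∪ d') ∩ m = s then
    sieveWeight P R d * sieveWeight P R d' * (setProd ((d ∪ d') \ m))⁻¹ else 0

lemma sum_inv_setTot_le {m a g : Finset ℕ} (hP : ∀ p ∈ P, 2 ≤ p) (hm : m ⊆ P)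
    (ha : a ⊆ m) :
    ∑ h ∈ sieveSupport P R, (if a ⊆ h ∧ h \ m = g then (setTot h)⁻¹ else 0) ≤
      2 ^ #m * ((setTot a)⁻¹ * if g ∈ sieveSupport P R then (setTot g)⁻¹ else 0) := by
  rw [← Finset.sum_filter]
  by_cases hg : g ∈ sieveSupport P R
  · rw [if_pos hg]
    have hc : #((sieveSupport P R).filter fun h => a ⊆ h ∧ h \ m = g) ≤ 2 ^ #m := by
      rw [← Finset.card_powerset]
      refine Finset.card_le_card_of_injOn (fun h => h ∩ m)
        (fun h _ => Finset.mem_coe.2 (Finset.mem_powerset.2 Finset.inter_subset_right)) ?_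
      intro h hh h' hh' heq
      have h1 := (Finset.mem_filter.1 hh).2.2
      have h2 := (Finset.mem_filter.1 hh').2.2
      have heq : h ∩ m = h' ∩ m := heq
      rw [← Finset.sdiff_union_inter h m, ← Finset.sdiff_union_inter h' m, h1, h2, heq]
    have hb : ∀ h ∈ (sieveSupport P R).filter (fun h => a ⊆ h ∧ h \ m = g),
        (setTot h)⁻¹ ≤ (setTot a)⁻¹ * (setTot g)⁻¹ := by
      intro h hh
      rw [Finset.mem_filter, sieveSupport, Finset.mem_filter, Finset.mem_powerset] at hh
      obtain ⟨⟨h1, -⟩, h2, h3⟩ := hh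
      have hd : Disjoint a g := h3 ▸ Finset.disjoint_of_subset_left ha Finset.disjoint_sdiff
      rw [← mul_inv, ← setTot_union hd]
      have hsub : a ∪ g ⊆ h := Finset.union_subset h2 (h3 ▸ Finset.sdiff_subset)
      exact inv_anti₀ (zero_lt_one.trans_le (one_le_setTot fun p hp => hP p (h1 (hsub hp))))
        (setTot_mono hsub fun p hp => hP p (h1 hp))
    refine (Finset.sum_le_card_nsmul _ _ _ hb).trans ?_
    rw [nsmul_eq_mul]
    have h0 : ∀ c ⊆ P, 0 ≤ (setTot c)⁻¹ := fun c hc =>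
      inv_nonneg.2 (zero_le_one.trans (one_le_setTot fun p hp => hP p (hc hp)))
    rw [sieveSupport, Finset.mem_filter, Finset.mem_powerset] at hg
    exact mul_le_mul_of_nonneg_right (by exact_mod_cast hc)
      (mul_nonneg (h0 a (ha.trans hm)) (h0 g hg.1))
  · rw [if_neg hg, mul_zero, mul_zero]
    refine (Finset.sum_eq_zero fun h hh => ?_).le
    rw [Finset.mem_filter, sieveSupport, Finset.mem_filter, Finset.mem_powerset] at hh
    refine absurd ?_ hg
    have h3 : g ⊆ h := hh.2.2 ▸ Finset.sdiff_subset
    rw [sieveSupport, Finset.mem_filter, Finset.mem_powerset]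
    exact ⟨h3.trans hh.1.1, (setProd_mono h3 fun p hp => hP p (hh.1.1 hp)).trans hh.1.2⟩

lemma sum_inv_setTot_nonneg (hP : ∀ p ∈ P, 2 ≤ p) (q : Finset ℕ → Prop)
    [DecidablePred q] :
    0 ≤ ∑ h ∈ sieveSupport P R, (if q h then (setTot h)⁻¹ else 0) := by
  refine Finset.sum_nonneg fun h hh => ?_
  rw [sieveSupport, Finset.mem_filter, Finset.mem_powerset] at hh
  have := inv_nonneg.2 (zero_le_one.trans (one_le_setTot fun p hp => hP p (hh.1 hp)))
  split_ifs
  · exact this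
  · exact le_rfl

lemma abs_sum_sieveWeight_le {m a g : Finset ℕ} (hP : ∀ p ∈ P, 2 ≤ p) (hG : 0 < sieveMass P R)
    (hm : m ⊆ P) (ha : a ⊆ m) :
    |∑ b ∈ (P \ m).powerset, (if g ⊆ b then sieveWeight P R (a ∪ b) / setProd b else 0)| ≤
      4 ^ #m / sieveMass P R * if g ∈ sieveSupport P R then (setTot g)⁻¹ else 0 := by
  rw [sum_sieveWeight_div_eq hP ha, abs_mul, abs_div, abs_mul, abs_pow, abs_neg, abs_one, one_pow,
    one_mul, 
    abs_of_nonneg (sum_inv_setTot_nonneg hP fun h => a ⊆ h ∧ h \ m = g), abs_of_pos hG]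
  have haP := ha.trans hm
  have ha0 : 0 < setTot a := zero_lt_one.trans_le (one_le_setTot fun p hp => hP p (haP hp))
  have ha1 : 0 < setProd a := zero_lt_one.trans_le (one_le_setProd fun p hp => hP p (haP hp))
  rw [abs_of_pos ha1]
  refine (mul_le_mul_of_nonneg_left (sum_inv_setTot_le hP hm ha) (by positivity)).trans ?_
  have hX : 0 ≤ if g ∈ sieveSupport P R then (setTot g)⁻¹ else 0 := by
    split_ifs with hg
    · rw [sieveSupport, Finset.mem_filter, Finset.mem_powerset] at hg
      exact inv_nonneg.2 (zero_le_one.trans (one_le_setTot fun p hp => hP p (hg.1 hp)))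
    · exact le_rfl
  have h1 : setProd a * (setTot a)⁻¹ ≤ 2 ^ #m := by
    rw [← div_eq_mul_inv, div_le_iff₀ ha0]
    refine (setProd_le_two_pow_mul_setTot fun p hp => hP p (haP hp)).trans
      (mul_le_mul_of_nonneg_right ?_ ha0.le)
    exact pow_le_pow_right₀ one_le_two (Finset.card_le_card ha)
  calc setProd a / sieveMass P R * (2 ^ #m * ((setTot a)⁻¹ *
        if g ∈ sieveSupport P R then (setTot g)⁻¹ else 0))
      = setProd a * (setTot a)⁻¹ * (2 ^ #m / sieveMass P R *
        if g ∈ sieveSupport P R then (setTot g)⁻¹ else 0) := by ring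
    _ ≤ 2 ^ #m * (2 ^ #m / sieveMass P R *
        if g ∈ sieveSupport P R then (setTot g)⁻¹ else 0) :=
        mul_le_mul_of_nonneg_right h1 (by positivity)
    _ = _ := by rw [show (4 : ℝ) = 2 * 2 by norm_num, mul_pow]; ring

lemma sieveBracket_eq (hP : ∀ p ∈ P, 2 ≤ p) {m s : Finset ℕ} (hm : m ⊆ P) (hs : s ⊆ m) :
    sieveBracket P R m s = ∑ a ∈ m.powerset, ∑ a' ∈ m.powerset, if a ∪ a' = s then
      ∑ g ∈ (P \ m).powerset, setTot g *
        ((∑ b ∈ (P \ m).powerset, if g ⊆ b then sieveWeight P R (a ∪ b) / setProd b else 0) *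
        ∑ b ∈ (P \ m).powerset, if g ⊆ b then sieveWeight P R (a' ∪ b) / setProd b else 0)
      else 0 := by
  have h0 : ∀ c ⊆ P, setProd c ≠ 0 := fun c hc =>
    (zero_lt_one.trans_le (one_le_setProd fun p hp => hP p (hc hp))).ne'
  have h1 : sieveBracket P R m s = setProd s *
      ∑ d ∈ P.powerset, ∑ d' ∈ P.powerset, (if (d ∪ d') ∩ m = s then
        sieveWeight P R d * sieveWeight P R d' / setProd (d ∪ d') else 0) := by
    rw [sieveBracket, Finset.mul_sum]
    refine Finset.sum_congr rfl fun d hd => ?_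
    rw [Finset.mul_sum]
    refine Finset.sum_congr rfl fun d' hd' => ?_
    rw [Finset.mem_powerset] at hd hd'
    by_cases h : (d ∪ d') ∩ m = s
    · rw [if_pos h, if_pos h]
      have h2 : setProd (d ∪ d') = setProd ((d ∪ d') \ m) * setProd s := by
        rw [← h, ← setProd_union (Finset.disjoint_sdiff_inter _ _), Finset.sdiff_union_inter]
      have h3 := h0 s (hs.trans hm)
      have h4 := h0 ((d ∪ d') \ m) (Finset.sdiff_subset.trans (Finset.union_subset hd hd'))
      rw [h2]
      field_simp
    · rw [if_neg h, if_neg h, mul_zero]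
  rw [h1, sum_sum_sieveWeight_eq hP hm, Finset.mul_sum]
  refine Finset.sum_congr rfl fun a _ => ?_
  rw [Finset.mul_sum]
  refine Finset.sum_congr rfl fun a' _ => ?_
  by_cases h : a ∪ a' = s
  · rw [if_pos h, if_pos h, mul_inv_cancel_left₀ (h0 s (hs.trans hm))]
  · rw [if_neg h, if_neg h, mul_zero]

lemma sieveBracket_empty (hP : ∀ p ∈ P, 2 ≤ p) (hG : 0 < sieveMass P R) :
    sieveBracket P R ∅ ∅ = (sieveMass P R)⁻¹ := by
  rw [sieveBracket_eq hP (Finset.empty_subset _) (Finset.empty_subset _)]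
  simp only [Finset.powerset_empty, Finset.sum_singleton, Finset.union_idempotent, if_true,
    Finset.sdiff_empty]
  have h1 : ∀ g : Finset ℕ, ∑ b ∈ P.powerset, (if g ⊆ b then sieveWeight P R (∅ ∪ b) / setProd b
      else 0) = (-1) ^ #g / sieveMass P R *
        if g ∈ sieveSupport P R then (setTot g)⁻¹ else 0 := fun g => by
    have := sum_sieveWeight_div_eq (R := R) (g := g) hP (Finset.empty_subset (∅ : Finset ℕ))
    simp only [Finset.sdiff_empty, Finset.card_empty, zero_add, Finset.empty_subset, true_and,
      Finset.sum_ite_eq'] at this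
    rw [this, setProd, Finset.prod_empty, mul_one]
  simp only [h1]
  have h2 : ∀ g ∈ P.powerset, setTot g * ((-1) ^ #g / sieveMass P R *
      (if g ∈ sieveSupport P R then (setTot g)⁻¹ else 0) * ((-1) ^ #g / sieveMass P R *
      if g ∈ sieveSupport P R then (setTot g)⁻¹ else 0)) =
      (sieveMass P R)⁻¹ ^ 2 * if setProd g ≤ R then (setTot g)⁻¹ else 0 := fun g hg => by
    have hg' := Finset.mem_powerset.1 hg
    have h3 : setTot g ≠ 0 := (zero_lt_one.trans_le (one_le_setTot fun p hp => hP p (hg' hp))).ne'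
    have h4 : ((-1 : ℝ) ^ #g) * (-1) ^ #g = 1 := by rw [← mul_pow]; norm_num
    by_cases h : setProd g ≤ R
    · rw [if_pos h, if_pos (by rw [sieveSupport, Finset.mem_filter]; exact ⟨hg, h⟩)]
      calc _ = ((-1 : ℝ) ^ #g) * (-1) ^ #g * (sieveMass P R)⁻¹ ^ 2 *
            (setTot g * (setTot g)⁻¹) * (setTot g)⁻¹ := by ring
        _ = _ := by rw [h4, mul_inv_cancel₀ h3]; ring
    · rw [if_neg h, if_neg (by rw [sieveSupport, Finset.mem_filter]; exact fun h' => h h'.2)]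
      ring
  rw [Finset.sum_congr rfl h2, ← Finset.mul_sum, ← Finset.sum_filter]
  change _ * sieveMass P R = _
  field_simp

lemma abs_sieveBracket_le (hP : ∀ p ∈ P, 2 ≤ p) (hG : 0 < sieveMass P R) {m s : Finset ℕ}
    (hm : m ⊆ P) (hs : s ⊆ m) : |sieveBracket P R m s| ≤ 64 ^ #m / sieveMass P R := by
  rw [sieveBracket_eq hP hm hs]
  have key : ∀ a ∈ m.powerset, ∀ a' ∈ m.powerset, |if a ∪ a' = s then
      ∑ g ∈ (P \ m).powerset, setTot g *
        ((∑ b ∈ (P \ m).powerset, if g ⊆ b then sieveWeight P R (a ∪ b) / setProd b else 0) *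
        ∑ b ∈ (P \ m).powerset, if g ⊆ b then sieveWeight P R (a' ∪ b) / setProd b else 0)
      else 0| ≤ 16 ^ #m / sieveMass P R := by
    intro a ha a' ha'
    rw [Finset.mem_powerset] at ha ha'
    by_cases h : a ∪ a' = s
    · rw [if_pos h]
      refine (Finset.abs_sum_le_sum_abs _ _).trans ?_
      have h1 : ∀ g ∈ (P \ m).powerset, |setTot g *
          ((∑ b ∈ (P \ m).powerset, if g ⊆ b then sieveWeight P R (a ∪ b) / setProd b else 0) *
          ∑ b ∈ (P \ m).powerset, if g ⊆ b then sieveWeight P R (a' ∪ b) / setProd b else 0)| ≤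
          16 ^ #m / sieveMass P R ^ 2 * if g ∈ sieveSupport P R then (setTot g)⁻¹ else 0 := by
        intro g hg
        have hg' := (Finset.mem_powerset.1 hg).trans Finset.sdiff_subset
        have h3 : 0 < setTot g := zero_lt_one.trans_le (one_le_setTot fun p hp => hP p (hg' hp))
        rw [abs_mul, abs_mul, abs_of_pos h3]
        have e1 := abs_sum_sieveWeight_le (g := g) hP hG hm ha
        have e2 := abs_sum_sieveWeight_le (g := g) hP hG hm ha'
        refine (mul_le_mul_of_nonneg_left (mul_le_mul e1 e2 (abs_nonneg _)
          ((abs_nonneg _).trans e1)) h3.le).trans (le_of_eq ?_)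
        rw [show (16 : ℝ) = 4 * 4 by norm_num, mul_pow]
        by_cases hgs : g ∈ sieveSupport P R
        · simp only [if_pos hgs]
          field_simp
        · simp only [if_neg hgs]
          ring
      refine (Finset.sum_le_sum h1).trans ?_
      rw [← Finset.mul_sum]
      have h2 : ∑ g ∈ (P \ m).powerset, (if g ∈ sieveSupport P R then (setTot g)⁻¹ else 0) ≤
          sieveMass P R := by
        rw [← Finset.sum_filter, sieveMass]
        refine Finset.sum_le_sum_of_subset_of_nonneg
          (fun g hg => (Finset.mem_filter.1 hg).2) fun g hg _ => ?_
        rw [sieveSupport, Finset.mem_filter, Finset.mem_powerset] at hg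
        exact inv_nonneg.2 (zero_le_one.trans (one_le_setTot fun p hp => hP p (hg.1 hp)))
      refine (mul_le_mul_of_nonneg_left h2 (by positivity)).trans (le_of_eq ?_)
      field_simp
    · rw [if_neg h, abs_zero]
      positivity
  refine (Finset.abs_sum_le_sum_abs _ _).trans ((Finset.sum_le_sum fun a ha =>
    (Finset.abs_sum_le_sum_abs _ _).trans (Finset.sum_le_sum fun a' ha' => key a ha a' ha')).trans
    (le_of_eq ?_))
  simp only [Finset.sum_const, Finset.card_powerset, nsmul_eq_mul]
  push_cast
  rw [show (64 : ℝ) = 2 * 2 * 16 by norm_num, mul_pow, mul_pow]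
  ring

end SelbergBracket

section SelbergModel

variable {P : Finset ℕ} {R : ℝ} {S : Type*} [Fintype S]

/-- The set of indices `s` for which `p` lies in the `s`-th pair of sets. -/
def pairSupport (e : S → Finset ℕ × Finset ℕ) (p : ℕ) : Finset S :=
  univ.filter fun s => p ∈ (e s).1 ∪ (e s).2

/-- The product of the Selberg weights along a family of pairs of sets. -/
def pairWeight (P : Finset ℕ) (R : ℝ) (e : S → Finset ℕ × Finset ℕ) : ℝ :=
  ∏ s, sieveWeight P R (e s).1 * sieveWeight P R (e s).2

/-- The families of pairs of subsets of `P`. -/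
def pairFamilies (S : Type*) [Fintype S] (P : Finset ℕ) : Finset (S → Finset ℕ × Finset ℕ) :=
  Fintype.piFinset fun _ => P.powerset ×ˢ P.powerset

lemma union_subset_of_mem_pairFamilies {e : S → Finset ℕ × Finset ℕ} (he : e ∈ pairFamilies S P)
    (s : S) : (e s).1 ∪ (e s).2 ⊆ P := by
  have := Fintype.mem_piFinset.1 he s
  rw [Finset.mem_product, Finset.mem_powerset, Finset.mem_powerset] at this
  exact Finset.union_subset this.1 this.2

lemma prod_inv_pow_card_pairSupport {m : Finset ℕ} {e : S → Finset ℕ × Finset ℕ}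
    (he : e ∈ pairFamilies S P) : ∏ p ∈ P \ m, ((p : ℝ)⁻¹) ^ #(pairSupport e p) =
      ∏ s, (setProd (((e s).1 ∪ (e s).2) \ m))⁻¹ := by
  have h1 : ∀ p ∈ P \ m, ((p : ℝ)⁻¹) ^ #(pairSupport e p) =
      ∏ s, if p ∈ (e s).1 ∪ (e s).2 then (p : ℝ)⁻¹ else 1 := fun p _ => by
    rw [pairSupport, ← Finset.prod_filter, Finset.prod_const]
  rw [Finset.prod_congr rfl h1, Finset.prod_comm]
  refine Finset.prod_congr rfl fun s _ => ?_
  rw [← Finset.prod_filter, setProd, ← Finset.prod_inv_distrib]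
  refine Finset.prod_congr ?_ fun _ _ => rfl
  ext p
  have := @union_subset_of_mem_pairFamilies _ _ _ _ he s p
  simp only [Finset.mem_filter, Finset.mem_sdiff] at *
  tauto

lemma sum_pairFamilies_mul_eq (m : Finset ℕ) (K : (S → Finset ℕ) → ℝ) :
    ∑ e ∈ pairFamilies S P, pairWeight P R e * (∏ s, (setProd (((e s).1 ∪ (e s).2) \ m))⁻¹) *
      K (fun s => ((e s).1 ∪ (e s).2) ∩ m) =
    ∑ σ ∈ Fintype.piFinset (fun _ : S => m.powerset), K σ * ∏ s, sieveBracket P R m (σ s) := by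
  have h1 : ∀ σ : S → Finset ℕ, ∏ s, sieveBracket P R m (σ s) = ∑ e ∈ pairFamilies S P,
      ∏ s, if ((e s).1 ∪ (e s).2) ∩ m = σ s then sieveWeight P R (e s).1 * sieveWeight P R (e s).2 *
        (setProd (((e s).1 ∪ (e s).2) \ m))⁻¹ else 0 := fun σ => by
    rw [pairFamilies, ← Finset.prod_univ_sum (fun _ => P.powerset ×ˢ P.powerset)
      (fun s x => if (x.1 ∪ x.2) ∩ m = σ s then sieveWeight P R x.1 * sieveWeight P R x.2 *
        (setProd ((x.1 ∪ x.2) \ m))⁻¹ else 0)]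
    refine Finset.prod_congr rfl fun s _ => ?_
    rw [Finset.sum_product, sieveBracket]
  simp only [h1, Finset.mul_sum]
  rw [Finset.sum_comm]
  refine Finset.sum_congr rfl fun e he => ?_
  rw [Finset.sum_eq_single fun s => ((e s).1 ∪ (e s).2) ∩ m]
  · simp only [if_true]
    rw [Finset.prod_mul_distrib, pairWeight]
    ring
  · intro σ _ hσ
    obtain ⟨s, hs⟩ := Function.ne_iff.1 hσ
    rw [Finset.prod_eq_zero (Finset.mem_univ s) (if_neg (Ne.symm hs)), mul_zero]
  · intro h
    exact absurd (Fintype.mem_piFinset.2 fun s =>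
      Finset.mem_powerset.2 Finset.inter_subset_right) h

/-- The Selberg sieve asymptotic for products of local densities close to the independent ones. -/
theorem abs_sieve_model_sub_one_le (hP : ∀ p ∈ P, 2 ≤ p) (hG : 0 < sieveMass P R)
    (ρ : ℕ → Finset S → ℝ)
    (hρ : ∀ p ∈ P, ∀ T, |ρ p T - ((p : ℝ)⁻¹) ^ #T| ≤ ((p : ℝ) ^ 2)⁻¹) :
    |sieveMass P R ^ Fintype.card S * ∑ e ∈ pairFamilies S P,
      pairWeight P R e * ∏ p ∈ P, ρ p (pairSupport e p) - 1| ≤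
      ∏ p ∈ P, (1 + 128 ^ Fintype.card S * ((p : ℝ) ^ 2)⁻¹) - 1 := by
  set G := sieveMass P R
  set r := Fintype.card S
  have h1 : ∀ e ∈ pairFamilies S P, pairWeight P R e * ∏ p ∈ P, ρ p (pairSupport e p) =
      ∑ m ∈ P.powerset, pairWeight P R e * (∏ s, (setProd (((e s).1 ∪ (e s).2) \ m))⁻¹) *
        ∏ p ∈ m, (ρ p (pairSupport e p) - ((p : ℝ)⁻¹) ^ #(pairSupport e p)) := fun e he => by
    have h2 : ∀ p ∈ P, ρ p (pairSupport e p) =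
        (ρ p (pairSupport e p) - ((p : ℝ)⁻¹) ^ #(pairSupport e p)) +
          ((p : ℝ)⁻¹) ^ #(pairSupport e p) := fun p _ => by ring
    rw [Finset.prod_congr rfl h2, Finset.prod_add, Finset.mul_sum]
    refine Finset.sum_congr rfl fun m _ => ?_
    rw [prod_inv_pow_card_pairSupport he]
    ring
  let T : (S → Finset ℕ) → ℕ → Finset S := fun σ p => univ.filter fun s => p ∈ σ s
  let K : Finset ℕ → (S → Finset ℕ) → ℝ := fun m σ =>
    ∏ p ∈ m, (ρ p (T σ p) - ((p : ℝ)⁻¹) ^ #(T σ p))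
  have h2 : ∀ m e, ∏ p ∈ m, (ρ p (pairSupport e p) - ((p : ℝ)⁻¹) ^ #(pairSupport e p)) =
      K m fun s => ((e s).1 ∪ (e s).2) ∩ m := fun m e => by
    refine Finset.prod_congr rfl fun p hp => ?_
    have : pairSupport e p = T (fun s => ((e s).1 ∪ (e s).2) ∩ m) p := by
      ext s
      simp only [pairSupport, T, Finset.mem_filter, Finset.mem_univ, true_and, Finset.mem_inter, hp,
        and_true]
    rw [this]
  rw [Finset.sum_congr rfl h1, Finset.sum_comm]
  simp only [h2, sum_pairFamilies_mul_eq]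
  have hG' : ∀ m, G ^ r * (G⁻¹) ^ r * m = m := fun m => by
    rw [← mul_pow, mul_inv_cancel₀ hG.ne', one_pow, one_mul]
  have h3 : ∑ σ ∈ Fintype.piFinset (fun _ : S => (∅ : Finset ℕ).powerset),
      K ∅ σ * ∏ s, sieveBracket P R ∅ (σ s) = (G⁻¹) ^ r := by
    rw [Finset.sum_eq_single fun _ => ∅]
    · simp only [K, Finset.prod_empty, one_mul, sieveBracket_empty hP hG, Finset.prod_const,
        Finset.card_univ]
      rfl
    · intro σ hσ hne
      refine absurd (funext fun s => ?_) hne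
      have := Fintype.mem_piFinset.1 hσ s
      rwa [Finset.powerset_empty, Finset.mem_singleton] at this
    · intro h
      exact absurd (Fintype.mem_piFinset.2 fun s => Finset.mem_powerset.2 (Finset.empty_subset _)) h
  have h4 : ∀ m ∈ P.powerset, |G ^ r * ∑ σ ∈ Fintype.piFinset (fun _ : S => m.powerset),
      K m σ * ∏ s, sieveBracket P R m (σ s)| ≤ ∏ p ∈ m, (128 ^ r * ((p : ℝ) ^ 2)⁻¹) := by
    intro m hm
    rw [Finset.mem_powerset] at hm
    rw [abs_mul, abs_of_nonneg (by positivity : 0 ≤ G ^ r)]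
    have h5 : ∀ σ ∈ Fintype.piFinset (fun _ : S => m.powerset),
        |K m σ * ∏ s, sieveBracket P R m (σ s)| ≤
          (∏ p ∈ m, ((p : ℝ) ^ 2)⁻¹) * (64 ^ #m / G) ^ r := by
      intro σ hσ
      rw [abs_mul, Finset.abs_prod, Finset.abs_prod]
      refine mul_le_mul (Finset.prod_le_prod (fun _ _ => abs_nonneg _) fun p hp => hρ p (hm hp) _)
        ?_ (Finset.prod_nonneg fun _ _ => abs_nonneg _)
        (Finset.prod_nonneg fun _ _ => by positivity)
      rw [show r = #(univ : Finset S) from rfl, ← Finset.prod_const]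
      exact Finset.prod_le_prod (fun _ _ => abs_nonneg _) fun s _ =>
        abs_sieveBracket_le hP hG hm (Finset.mem_powerset.1 (Fintype.mem_piFinset.1 hσ s))
    refine (mul_le_mul_of_nonneg_left ((Finset.abs_sum_le_sum_abs _ _).trans
      (Finset.sum_le_sum h5)) (by positivity)).trans (le_of_eq ?_)
    rw [Finset.sum_const, Fintype.card_piFinset, Finset.prod_const, Finset.card_univ,
      Finset.card_powerset, nsmul_eq_mul,
      Finset.prod_mul_distrib, Finset.prod_const]
    push_cast
    calc G ^ r * (((2 ^ #m : ℝ) ^ r) * ((∏ p ∈ m, ((p : ℝ) ^ 2)⁻¹) * (64 ^ #m / G) ^ r))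
        = G ^ r * (G⁻¹) ^ r * ((2 ^ #m * 64 ^ #m) ^ r * ∏ p ∈ m, ((p : ℝ) ^ 2)⁻¹) := by
          rw [mul_pow, div_eq_mul_inv, mul_pow]; ring
      _ = _ := by
          rw [hG', ← mul_pow, ← pow_mul, ← pow_mul, mul_comm #m r]
          norm_num
  rw [← Finset.sum_erase_add _ _ (Finset.empty_mem_powerset P), h3, mul_add]
  have h6 : G ^ r * (G⁻¹) ^ r = 1 := by rw [← mul_pow, mul_inv_cancel₀ hG.ne', one_pow]
  rw [h6, add_sub_cancel_right, Finset.prod_one_add,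
    ← Finset.sum_erase_add _ _ (Finset.empty_mem_powerset P), Finset.prod_empty,
    add_sub_cancel_right, Finset.mul_sum]
  exact (Finset.abs_sum_le_sum_abs _ _).trans
    (Finset.sum_le_sum fun m hm => h4 m (Finset.mem_of_mem_erase hm))

end SelbergModel

section LocalDensity

/-- The indicator of a proposition. -/
def ind (q : Prop) : ℝ := if q then 1 else 0

lemma ind_of {q : Prop} (h : q) : ind q = 1 := if_pos h

lemma ind_of_not {q : Prop} (h : ¬q) : ind q = 0 := if_neg h

lemma ind_nonneg (q : Prop) : 0 ≤ ind q := by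
  unfold ind; split_ifs <;> norm_num

lemma ind_le_one (q : Prop) : ind q ≤ 1 := by
  unfold ind; split_ifs <;> norm_num

lemma ind_and (q q' : Prop) : ind (q ∧ q') = ind q * ind q' := by
  by_cases h : q <;> by_cases h' : q' <;> simp [ind, h, h']

lemma prod_ind {ι : Type*} (s : Finset ι) (q : ι → Prop) :
    ∏ i ∈ s, ind (q i) = ind (∀ i ∈ s, q i) := by
  by_cases h : ∀ i ∈ s, q i
  · rw [ind_of h]
    exact Finset.prod_eq_one fun i hi => ind_of (h i hi)
  · rw [ind_of_not h]
    push Not at h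
    obtain ⟨i, hi, hq⟩ := h
    exact Finset.prod_eq_zero hi (ind_of_not hq)

variable {S V : Type} [Fintype V]

/-- The proportion of shifts modulo `p` for which all the values `W (n s + c s · y) + 1` with
`s ∈ T` are divisible by `p`. -/
def localDensity (c : S → V → ℤ) (W : ℕ) (n : S → ℤ) (p : ℕ) (T : Finset S) : ℝ :=
  avg fun y : V → Fin p =>
    ind (∀ s ∈ T, (p : ℤ) ∣ W * (n s + ∑ v, c s v * ((y v : ℕ) : ℤ)) + 1)

lemma avg_comp_fin_natCast {p : ℕ} [NeZero p] (F : (V → ZMod p) → ℝ) :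
    (avg fun y : V → Fin p => F fun v => ((y v : ℕ) : ZMod p)) = avg F := by
  let e : Fin p ≃ ZMod p :=
    { toFun := fun i => ((i : ℕ) : ZMod p)
      invFun := fun z => ⟨z.val, ZMod.val_lt z⟩
      left_inv := fun i => Fin.ext (ZMod.val_cast_of_lt i.2)
      right_inv := fun z => ZMod.natCast_zmod_val z }
  exact avg_equiv (Equiv.piCongrRight fun _ : V => e) F

lemma dvd_mul_add_sum_iff {p : ℕ} (W : ℕ) (n u : ℤ) (c : V → ℤ) (y : V → ℕ) :
    (p : ℤ) ∣ W * (n + u * ∑ v, c v * (y v : ℤ)) + 1 ↔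
      (W : ZMod p) * (n + u * ∑ v, (c v : ZMod p) * (y v : ZMod p)) + 1 = 0 := by
  rw [← ZMod.intCast_zmod_eq_zero_iff_dvd]
  push_cast
  rfl

lemma localDensity_eq_avg {p : ℕ} [Fact p.Prime] (c : S → V → ℤ) (W : ℕ) (n : S → ℤ) {u : ℕ}
    (hu : u.Coprime p) (T : Finset S) : (avg fun y : V → Fin p =>
      ind (∀ s ∈ T, (p : ℤ) ∣ W * (n s + u * ∑ v, c s v * ((y v : ℕ) : ℤ)) + 1)) =
    avg fun z : V → ZMod p =>
      ind (∀ s ∈ T, (W : ZMod p) * ((n s : ZMod p) + ∑ v, (c s v : ZMod p) * z v) + 1 = 0) := by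
  simp only [dvd_mul_add_sum_iff]
  rw [avg_comp_fin_natCast (p := p) (V := V) fun z => ind (∀ s ∈ T, (W : ZMod p) *
    ((n s : ZMod p) + ((u : ℤ) : ZMod p) * ∑ v, (c s v : ZMod p) * z v) + 1 = 0)]
  have hu0 : (u : ZMod p) ≠ 0 := fun h => by
    rw [ZMod.natCast_eq_zero_iff] at h
    exact (Nat.Prime.coprime_iff_not_dvd Fact.out).1 hu.symm h
  rw [← avg_equiv (Equiv.piCongrRight fun _ : V => Equiv.mulLeft₀ (u : ZMod p) hu0)
    fun z => ind (∀ s ∈ T, (W : ZMod p) * ((n s : ZMod p) + ∑ v, (c s v : ZMod p) * z v) + 1 = 0)]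
  refine avg_congr fun z => ?_
  have hz : ∀ v, Equiv.mulLeft₀ (u : ZMod p) hu0 (z v) = u * z v := fun v => rfl
  simp only [hz, Equiv.piCongrRight_apply, Pi.map_apply, Finset.mul_sum, Int.cast_natCast, mul_left_comm]

lemma localDensity_eq {p : ℕ} [Fact p.Prime] (c : S → V → ℤ) (W : ℕ) (n : S → ℤ)
    (T : Finset S) : localDensity c W n p T = avg fun z : V → ZMod p =>
      ind (∀ s ∈ T, (W : ZMod p) * ((n s : ZMod p) + ∑ v, (c s v : ZMod p) * z v) + 1 = 0) := by
  have := localDensity_eq_avg c W n (Nat.coprime_one_left p) T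
  simpa only [localDensity, Nat.cast_one, one_mul] using this

/-- The linear form on `(ZMod p) ^ V` with coefficients `c`. -/
def modForm (p : ℕ) (c : V → ℤ) : (V → ZMod p) →+ ZMod p where
  toFun z := ∑ v, (c v : ZMod p) * z v
  map_zero' := by simp
  map_add' x y := by simp [mul_add, Finset.sum_add_distrib]

lemma modForm_single {p : ℕ} (c : V → ℤ) (v : V) (t : ZMod p) :
    modForm p c (Pi.single v t) = c v * t := by
  change ∑ i, (c i : ZMod p) * (Pi.single v t : V → ZMod p) i = _
  rw [Finset.sum_eq_single v (fun i _ hi => by rw [Pi.single_eq_of_ne hi, mul_zero])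
    (fun h => absurd (Finset.mem_univ v) h), Pi.single_eq_same]

lemma modForm_surjective {p : ℕ} [Fact p.Prime] {c : V → ℤ} {v : V} (hv : (c v : ZMod p) ≠ 0) :
    Function.Surjective (modForm p c) := fun t =>
  ⟨Pi.single v ((c v : ZMod p)⁻¹ * t), by rw [modForm_single, mul_inv_cancel_left₀ hv]⟩

lemma modForm_prod_surjective {p : ℕ} [Fact p.Prime] {c c' : V → ℤ} {v v' : V}
    (hv : (c v : ZMod p) ≠ 0) (hv' : (c' v : ZMod p) = 0) (hw : (c' v' : ZMod p) ≠ 0)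
    (hw' : (c v' : ZMod p) = 0) :
    Function.Surjective ((modForm p c).prod (modForm p c')) := fun t =>
  ⟨Pi.single v ((c v : ZMod p)⁻¹ * t.1) + Pi.single v' ((c' v' : ZMod p)⁻¹ * t.2), by
    simp only [AddMonoidHom.prod_apply, map_add, modForm_single, mul_inv_cancel_left₀ hv,
      mul_inv_cancel_left₀ hw, hv', hw', zero_mul, Prod.mk_add_mk, add_zero, zero_add]⟩

lemma avg_ind_eq {p : ℕ} [NeZero p] (a : ZMod p) :
    (avg fun t : ZMod p => ind (t = a)) = (p : ℝ)⁻¹ := by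
  rw [avg_eq_sum_div, Finset.sum_eq_single a (fun t _ ht => ind_of_not ht)
    (fun h => absurd (Finset.mem_univ a) h), ind_of rfl, ZMod.card, one_div]

lemma mul_add_add_one_eq_zero_iff {p : ℕ} [Fact p.Prime] {W : ZMod p} (hW : W ≠ 0) (n t : ZMod p) :
    W * (n + t) + 1 = 0 ↔ t = -W⁻¹ - n := by
  constructor
  · intro h
    have : W * (t - (-W⁻¹ - n)) = 0 := by
      rw [← h]; field_simp; ring
    rcases mul_eq_zero.1 this with h' | h'
    · exact absurd h' hW
    · exact sub_eq_zero.1 h'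
  · rintro rfl
    field_simp
    ring

lemma abs_localDensity_sub_le {p : ℕ} [Fact p.Prime] {c : S → V → ℤ} {W : ℕ}
    (hW : (W : ZMod p) ≠ 0) (h1 : ∀ s, ∃ v, (c s v : ZMod p) ≠ 0)
    (h2 : ∀ s s', s ≠ s' → ∃ v, (c s v : ZMod p) ≠ 0 ∧ (c s' v : ZMod p) = 0) (n : S → ℤ)
    (T : Finset S) : |localDensity c W n p T - ((p : ℝ)⁻¹) ^ #T| ≤ ((p : ℝ) ^ 2)⁻¹ := by
  have hp0 : (0 : ℝ) < p := by exact_mod_cast (Fact.out : p.Prime).pos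
  have hp1 : (p : ℝ)⁻¹ ≤ 1 := inv_le_one_of_one_le₀ (by exact_mod_cast (Fact.out : p.Prime).one_le)
  rw [localDensity_eq]
  simp only [mul_add_add_one_eq_zero_iff hW]
  rcases Nat.lt_or_ge 1 #T with hT | hT
  · obtain ⟨s, hs, s', hs', hne⟩ := Finset.one_lt_card.1 hT
    obtain ⟨v, hv, hv'⟩ := h2 s s' hne
    obtain ⟨w, hw, hw'⟩ := h2 s' s hne.symm
    have hle : (avg fun z : V → ZMod p => ind (∀ s ∈ T, ∑ v, (c s v : ZMod p) * z v =
        -(W : ZMod p)⁻¹ - (n s : ZMod p))) ≤ ((p : ℝ) ^ 2)⁻¹ := by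
      have h3 : (avg fun q : ZMod p × ZMod p => ind (q.1 = -(W : ZMod p)⁻¹ - (n s : ZMod p)) *
          ind (q.2 = -(W : ZMod p)⁻¹ - (n s' : ZMod p))) =
          ((p : ℝ) ^ 2)⁻¹ := by
        rw [avg_prod, ← avg_mul_avg (fun t => ind (t = -(W : ZMod p)⁻¹ - (n s : ZMod p)))
          fun t => ind (t = -(W : ZMod p)⁻¹ - (n s' : ZMod p)),
          avg_ind_eq, avg_ind_eq, sq, mul_inv]
      rw [← h3, ← avg_addMonoidHom _ (modForm_prod_surjective hv hv' hw hw')]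
      refine avg_mono fun z => ?_
      change _ ≤ ind (∑ v, (c s v : ZMod p) * z v = _) *
        ind (∑ v, (c s' v : ZMod p) * z v = _)
      by_cases h : ∀ s ∈ T, ∑ v, (c s v : ZMod p) * z v = -(W : ZMod p)⁻¹ - (n s : ZMod p)
      · rw [ind_of h, ind_of (h s hs), ind_of (h s' hs'), mul_one]
      · rw [ind_of_not h]
        exact mul_nonneg (ind_nonneg _) (ind_nonneg _)
    have hge : 0 ≤ (avg fun z : V → ZMod p => ind (∀ s ∈ T, ∑ v, (c s v : ZMod p) * z v =
        -(W : ZMod p)⁻¹ - (n s : ZMod p))) :=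
      avg_nonneg fun z => ind_nonneg _
    have hpow : ((p : ℝ)⁻¹) ^ #T ≤ ((p : ℝ) ^ 2)⁻¹ := by
      rw [← inv_pow]
      exact pow_le_pow_of_le_one (by positivity) hp1 hT
    rw [abs_le]
    constructor <;> linarith [show 0 ≤ ((p : ℝ)⁻¹) ^ #T by positivity]
  · have h0 : ∀ x : ℝ, x = ((p : ℝ)⁻¹) ^ #T → |x - ((p : ℝ)⁻¹) ^ #T| ≤ ((p : ℝ) ^ 2)⁻¹ := by
      rintro x rfl
      rw [sub_self, abs_zero]
      positivity
    refine h0 _ ?_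
    rcases Finset.eq_empty_or_nonempty T with rfl | hne
    · rw [Finset.card_empty, pow_zero]
      exact (avg_congr fun z => ind_of (by simp)).trans (avg_const _)
    · have hc : #T = 1 := le_antisymm hT hne.card_pos
      obtain ⟨s, rfl⟩ := Finset.card_eq_one.1 hc
      obtain ⟨v, hv⟩ := h1 s
      rw [Finset.card_singleton, pow_one, ← avg_ind_eq (-(W : ZMod p)⁻¹ - (n s : ZMod p)),
        ← avg_addMonoidHom _ (modForm_surjective hv)]
      simp only [Finset.mem_singleton, forall_eq]
      rfl

/-- The combination of residues modulo the elements of `Q`. -/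
def crtShift (Q : Finset ℕ) (h : ∀ p : Q, V → Fin p) (v : V) : ℕ :=
  ∑ p : Q, (∏ q ∈ Q.erase p, q) * (h p v : ℕ)

lemma crtShift_le {Q : Finset ℕ} (hQ : ∀ p ∈ Q, p.Prime) (h : ∀ p : Q, V → Fin p) (v : V) :
    crtShift Q h v ≤ (∏ p ∈ Q, p) ^ 2 := by
  have h1 : ∀ p : Q, (∏ q ∈ Q.erase p, q) * (h p v : ℕ) ≤ ∏ q ∈ Q, q := fun p => by
    rw [← Finset.prod_erase_mul Q (fun q => q) p.2]
    exact Nat.mul_le_mul_left _ (h p v).2.le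
  refine (Finset.sum_le_sum fun p _ => h1 p).trans ?_
  rw [Finset.sum_const, Finset.card_univ, Fintype.card_coe, smul_eq_mul, sq]
  refine Nat.mul_le_mul_right _ ?_
  have h2 : 2 ^ #Q ≤ ∏ p ∈ Q, p := by
    rw [← Finset.prod_const]
    exact Finset.prod_le_prod' fun p hp => (hQ p hp).two_le
  exact Nat.lt_two_pow_self.le.trans h2

lemma dvd_shift_iff {Q : Finset ℕ} (h : ∀ p : Q, V → Fin p) (p : Q) (W : ℕ) (n : ℤ) (c : V → ℤ) :
    ((p : ℕ) : ℤ) ∣ W * (n + ∑ v, c v * (crtShift Q h v : ℤ)) + 1 ↔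
      ((p : ℕ) : ℤ) ∣ W * (n + ((∏ q ∈ Q.erase p, q : ℕ) : ℤ) *
        ∑ v, c v * ((h p v : ℕ) : ℤ)) + 1 := by
  have h1 : ∀ v, (crtShift Q h v : ZMod p) = ((∏ q ∈ Q.erase p, q : ℕ) : ZMod p) * (h p v : ℕ) := by
    intro v
    rw [crtShift, Nat.cast_sum, Finset.sum_eq_single p]
    · push_cast; rfl
    · intro q _ hqp
      rw [ZMod.natCast_eq_zero_iff]
      refine Dvd.dvd.mul_right (Finset.dvd_prod_of_mem _ ?_) _
      exact Finset.mem_erase.2 ⟨fun h => hqp (Subtype.ext h.symm), p.2⟩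
    · exact fun h => absurd (Finset.mem_univ p) h
  rw [dvd_mul_add_sum_iff, ← ZMod.intCast_zmod_eq_zero_iff_dvd]
  push_cast
  simp only [h1]
  push_cast
  simp only [Finset.mul_sum, mul_left_comm]

lemma avg_crtShift_eq_prod {Q : Finset ℕ} (hQ : ∀ p ∈ Q, p.Prime) (c : S → V → ℤ) (W : ℕ)
    (n : S → ℤ) (T : ℕ → Finset S) : (avg fun h : ∀ p : Q, V → Fin p =>
      ind (∀ p ∈ Q, ∀ s ∈ T p, (p : ℤ) ∣ W * (n s + ∑ v, c s v * (crtShift Q h v : ℤ)) + 1)) =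
        ∏ p ∈ Q, localDensity c W n p (T p) := by
  have h1 : ∀ h : ∀ p : Q, V → Fin p,
      (ind (∀ p ∈ Q, ∀ s ∈ T p, (p : ℤ) ∣ W * (n s + ∑ v, c s v * (crtShift Q h v : ℤ)) + 1)) =
        ∏ p : Q, ind (∀ s ∈ T p, ((p : ℕ) : ℤ) ∣ W * (n s +
          ((∏ q ∈ Q.erase p, q : ℕ) : ℤ) * ∑ v, c s v * ((h p v : ℕ) : ℤ)) + 1) := fun h => by
    simp only [← dvd_shift_iff]
    rw [prod_ind]
    exact congrArg ind (propext
      ⟨fun h p _ => h p p.2, fun h p hp => h ⟨p, hp⟩ (Finset.mem_univ _)⟩)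
  rw [avg_congr h1, avg_pi_prod (fun (p : Q) (y : V → Fin p) => ind (∀ s ∈ T p, ((p : ℕ) : ℤ) ∣
    W * (n s + ((∏ q ∈ Q.erase p, q : ℕ) : ℤ) * ∑ v, c s v * ((y v : ℕ) : ℤ)) + 1)),
    ← Finset.prod_coe_sort Q fun p => localDensity c W n p (T p)]
  refine Finset.prod_congr rfl fun p _ => ?_
  have : Fact (p : ℕ).Prime := ⟨hQ p p.2⟩
  rw [localDensity_eq]
  refine localDensity_eq_avg c W n (Nat.Coprime.symm ?_) (T p)
  refine Nat.Coprime.prod_right fun q hq => ?_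
  rw [Finset.mem_erase] at hq
  exact (Nat.coprime_primes (hQ p p.2) (hQ q hq.2)).2 hq.1.symm

end LocalDensity

section SelbergMajorant

variable {P : Finset ℕ} {R : ℝ}

lemma sieveMass_pos (hR : 1 ≤ R) (hP : ∀ p ∈ P, 2 ≤ p) : 0 < sieveMass P R := by
  refine Finset.sum_pos (fun h hh => ?_) ⟨∅, ?_⟩
  · rw [sieveSupport, Finset.mem_filter, Finset.mem_powerset] at hh
    exact inv_pos.2 (zero_lt_one.trans_le (one_le_setTot fun p hp => hP p (hh.1 hp)))
  · rw [sieveSupport, Finset.mem_filter]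
    exact ⟨Finset.empty_mem_powerset P, by rwa [setProd, Finset.prod_empty]⟩

lemma sieveWeight_eq_zero (hP : ∀ p ∈ P, 2 ≤ p) {d : Finset ℕ} (hd : R < setProd d) :
    sieveWeight P R d = 0 := by
  rw [sieveWeight, Finset.sum_eq_zero, mul_zero]
  intro h hh
  rw [sieveSupport, Finset.mem_filter, Finset.mem_powerset] at hh
  exact if_neg fun hdh => (hd.trans_le (setProd_mono hdh fun p hp => hP p (hh.1 hp))).not_ge hh.2

lemma abs_sieveWeight_le (hR : 1 ≤ R) (hP : ∀ p ∈ P, 2 ≤ p) (d : Finset ℕ) :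
    |sieveWeight P R d| ≤ R := by
  rcases lt_or_ge R (setProd d) with h | h
  · rw [sieveWeight_eq_zero hP h, abs_zero]
    exact zero_le_one.trans hR
  · have hG := sieveMass_pos hR hP
    have h0 : 0 ≤ setProd d := Finset.prod_nonneg fun p _ => Nat.cast_nonneg p
    have h1 := sum_inv_setTot_nonneg (R := R) hP fun h => d ⊆ h
    have h2 : ∑ h ∈ sieveSupport P R, (if d ⊆ h then (setTot h)⁻¹ else 0) ≤ sieveMass P R := by
      refine Finset.sum_le_sum fun h hh => ?_
      rw [sieveSupport, Finset.mem_filter, Finset.mem_powerset] at hh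
      have := inv_nonneg.2 (zero_le_one.trans (one_le_setTot fun p hp => hP p (hh.1 hp)))
      split_ifs
      · exact le_rfl
      · exact this
    rw [sieveWeight, abs_mul, abs_div, abs_mul, abs_pow, abs_neg, abs_one, one_pow, one_mul,
      abs_of_nonneg h0, abs_of_pos hG, abs_of_nonneg h1]
    calc setProd d / sieveMass P R * _ ≤ setProd d / sieveMass P R * sieveMass P R :=
          mul_le_mul_of_nonneg_left h2 (by positivity)
      _ = setProd d := by field_simp
      _ ≤ R := h

lemma card_sieveSupport_le (hR : 1 ≤ R) (hP : ∀ p ∈ P, p.Prime) : (#(sieveSupport P R) : ℝ) ≤ R := by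
  have h1 : #(sieveSupport P R) ≤ #(Finset.Icc 1 ⌊R⌋₊) := by
    refine Finset.card_le_card_of_injOn (fun d => ∏ p ∈ d, p) (fun d hd => ?_)
      fun d hd d' hd' heq => ?_
    · rw [Finset.mem_coe, sieveSupport, Finset.mem_filter, Finset.mem_powerset] at hd
      rw [Finset.mem_coe, Finset.mem_Icc]
      refine ⟨Finset.prod_pos fun p hp => (hP p (hd.1 hp)).pos, Nat.le_floor ?_⟩
      rw [Nat.cast_prod]
      exact hd.2
    · rw [Finset.mem_coe, sieveSupport, Finset.mem_filter, Finset.mem_powerset] at hd hd'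
      rw [← Nat.primeFactors_prod fun p hp => hP p (hd.1 hp),
        ← Nat.primeFactors_prod fun p hp => hP p (hd'.1 hp)]
      exact congrArg _ heq
  rw [Nat.card_Icc, Nat.add_sub_cancel] at h1
  exact (Nat.cast_le.2 h1).trans (Nat.floor_le (zero_le_one.trans hR))

lemma sum_abs_sieveWeight_le (hR : 1 ≤ R) (hP : ∀ p ∈ P, p.Prime) :
    ∑ d ∈ P.powerset, |sieveWeight P R d| ≤ R ^ 2 := by
  have hP2 : ∀ p ∈ P, 2 ≤ p := fun p hp => (hP p hp).two_le
  have h1 : ∑ d ∈ P.powerset, |sieveWeight P R d| = ∑ d ∈ sieveSupport P R, |sieveWeight P R d| := by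
    refine (Finset.sum_subset (Finset.filter_subset _ _) fun d hd hd' => ?_).symm
    rw [sieveWeight_eq_zero hP2, abs_zero]
    by_contra h
    exact hd' (Finset.mem_filter.2 ⟨hd, not_lt.1 h⟩)
  rw [h1, sq]
  refine (Finset.sum_le_card_nsmul _ _ _ fun d _ => abs_sieveWeight_le hR hP2 d).trans ?_
  rw [nsmul_eq_mul]
  exact mul_le_mul_of_nonneg_right (card_sieveSupport_le hR hP) (zero_le_one.trans hR)

lemma sieveMass_le (hR : 1 ≤ R) (hP : ∀ p ∈ P, p.Prime) : sieveMass P R ≤ R := by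
  refine (Finset.sum_le_card_nsmul _ _ 1 fun d hd => ?_).trans ?_
  · rw [sieveSupport, Finset.mem_filter, Finset.mem_powerset] at hd
    exact inv_le_one_of_one_le₀ (one_le_setTot fun p hp => (hP p (hd.1 hp)).two_le)
  · rw [nsmul_one]
    exact card_sieveSupport_le hR hP

lemma setProd_biUnion_le {S : Type*} (t : Finset S) (U : S → Finset ℕ)
    (hU : ∀ s, ∀ p ∈ U s, 2 ≤ p) : setProd (t.biUnion U) ≤ ∏ s ∈ t, setProd (U s) := by
  induction t using Finset.induction_on with
  | empty => simp [setProd]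
  | insert s t hs ih =>
    rw [Finset.biUnion_insert, Finset.prod_insert hs]
    have h1 : ∀ p ∈ U s ∩ t.biUnion U, 2 ≤ p := fun p hp => hU s p (Finset.mem_inter.1 hp).1
    have h0 : 0 ≤ setProd (U s) := zero_le_one.trans (one_le_setProd (hU s))
    have h2 : 0 ≤ setProd (U s ∪ t.biUnion U) := Finset.prod_nonneg fun p _ => Nat.cast_nonneg p
    calc setProd (U s ∪ t.biUnion U)
        ≤ setProd (U s ∪ t.biUnion U) * setProd (U s ∩ t.biUnion U) :=
          le_mul_of_one_le_right h2 (one_le_setProd h1)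
      _ = setProd (U s) * setProd (t.biUnion U) := setProd_union_mul_inter _ _
      _ ≤ _ := mul_le_mul_of_nonneg_left ih h0

variable {m : ℕ}

/-- The Selberg sieve majorant of the primes in the residue class `1` modulo `W`. -/
def selbergMajorant (P : Finset ℕ) (R : ℝ) (W N : ℕ) (y : ZMod m) : ℝ :=
  sieveMass P R *
    (∑ d ∈ P.powerset, ind (∀ p ∈ d, p ∣ W * reprN N y + 1) * sieveWeight P R d) ^ 2

lemma prod_selbergMajorant {S : Type} [Fintype S] (W N : ℕ) (y : S → ZMod m) :
    ∏ s, selbergMajorant P R W N (y s) = sieveMass P R ^ Fintype.card S *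
      ∑ e ∈ pairFamilies S P, pairWeight P R e *
        ind (∀ s, ∀ p ∈ (e s).1 ∪ (e s).2, p ∣ W * reprN N (y s) + 1) := by
  simp only [selbergMajorant]
  rw [Finset.prod_mul_distrib, Finset.prod_const, Finset.card_univ]
  congr 1
  have h1 : ∀ s, (∑ d ∈ P.powerset, ind (∀ p ∈ d, p ∣ W * reprN N (y s) + 1) *
      sieveWeight P R d) ^ 2 = ∑ x ∈ P.powerset ×ˢ P.powerset,
      sieveWeight P R x.1 * sieveWeight P R x.2 *
        ind (∀ p ∈ x.1 ∪ x.2, p ∣ W * reprN N (y s) + 1) := fun s => by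
    rw [sq, Finset.sum_mul_sum, ← Finset.sum_product']
    refine Finset.sum_congr rfl fun x _ => ?_
    have : ind (∀ p ∈ x.1 ∪ x.2, p ∣ W * reprN N (y s) + 1) =
        ind (∀ p ∈ x.1, p ∣ W * reprN N (y s) + 1) *
          ind (∀ p ∈ x.2, p ∣ W * reprN N (y s) + 1) := by
      simp only [Finset.mem_union, or_imp, forall_and]
      rw [← ind_and]
    rw [this]
    ring
  simp only [h1]
  rw [Finset.prod_univ_sum]
  refine Finset.sum_congr rfl fun e _ => ?_
  rw [Finset.prod_mul_distrib, prod_ind, pairWeight]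
  simp only [Finset.mem_univ, true_imp_iff]

lemma sum_abs_pairWeight_le {S : Type} [Fintype S] (hR : 1 ≤ R) (hP : ∀ p ∈ P, p.Prime) :
    ∑ e ∈ pairFamilies S P, |pairWeight P R e| ≤ R ^ (4 * Fintype.card S) := by
  have h1 : ∑ e ∈ pairFamilies S P, |pairWeight P R e| =
      ∏ _s : S, (∑ d ∈ P.powerset, |sieveWeight P R d|) ^ 2 := by
    simp only [sq, Finset.sum_mul_sum, ← Finset.sum_product']
    rw [Finset.prod_univ_sum]
    refine Finset.sum_congr rfl fun e _ => ?_
    simp only [pairWeight, Finset.abs_prod, abs_mul]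
  rw [h1, Finset.prod_const, Finset.card_univ, pow_mul, show R ^ 4 = (R ^ 2) ^ 2 by ring]
  have h0 : 0 ≤ ∑ d ∈ P.powerset, |sieveWeight P R d| :=
    Finset.sum_nonneg fun _ _ => abs_nonneg _
  exact pow_le_pow_left₀ (by positivity)
    (pow_le_pow_left₀ h0 (sum_abs_sieveWeight_le hR hP) 2) _

lemma setProd_le_of_pairWeight_ne_zero {S : Type} [Fintype S] (hP : ∀ p ∈ P, 2 ≤ p)
    {e : S → Finset ℕ × Finset ℕ} (he : e ∈ pairFamilies S P) (hw : pairWeight P R e ≠ 0) :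
    setProd (univ.biUnion fun s => (e s).1 ∪ (e s).2) ≤ R ^ (2 * Fintype.card S) := by
  have hU := union_subset_of_mem_pairFamilies he
  refine (setProd_biUnion_le _ _ fun s p hp => hP p (hU s hp)).trans ?_
  rw [pow_mul, ← Finset.card_univ, ← Finset.prod_const]
  refine Finset.prod_le_prod (fun s _ => Finset.prod_nonneg fun p _ => Nat.cast_nonneg p)
    fun s _ => ?_
  have h1 := Finset.prod_ne_zero_iff.1 hw s (Finset.mem_univ s)
  have h2 : setProd (e s).1 ≤ R := by
    by_contra h
    exact h1 (by rw [sieveWeight_eq_zero hP (not_le.1 h), zero_mul])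
  have h3 : setProd (e s).2 ≤ R := by
    by_contra h
    exact h1 (by rw [sieveWeight_eq_zero hP (not_le.1 h), mul_zero])
  have h4 : 1 ≤ setProd ((e s).1 ∩ (e s).2) := one_le_setProd fun p hp =>
    hP p (hU s (Finset.mem_union_left _ (Finset.mem_inter.1 hp).1))
  have h5 : ∀ d : Finset ℕ, 0 ≤ setProd d := fun d => Finset.prod_nonneg fun p _ => Nat.cast_nonneg p
  calc setProd ((e s).1 ∪ (e s).2)
      ≤ setProd ((e s).1 ∪ (e s).2) * setProd ((e s).1 ∩ (e s).2) :=
        le_mul_of_one_le_right (h5 _) h4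
    _ = setProd (e s).1 * setProd (e s).2 := setProd_union_mul_inter _ _
    _ ≤ R * R := mul_le_mul h2 h3 (h5 _) ((h5 _).trans h2)
    _ = R ^ 2 := (sq R).symm

end SelbergMajorant

section SelbergPseudorandom

variable {P : Finset ℕ} {R : ℝ} {S V : Type} [Fintype S] [Fintype V] {m : ℕ}

/-- The residues modulo `m` whose representatives are within `B` of the ends of the interval. -/
def NearEnds (N B : ℕ) (y : ZMod m) : Prop :=
  (y - (N : ZMod m)).val < B ∨ m ≤ (y - (N : ZMod m)).val + B

lemma sum_ind {X : Type*} (s : Finset X) (q : X → Prop) [DecidablePred q] :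
    ∑ x ∈ s, ind (q x) = #(s.filter q) := by
  rw [Finset.card_filter, Nat.cast_sum]
  refine Finset.sum_congr rfl fun x _ => ?_
  by_cases h : q x
  · rw [ind_of h, if_pos h, Nat.cast_one]
  · rw [ind_of_not h, if_neg h, Nat.cast_zero]

lemma avg_ind_nearEnds_le [NeZero m] (N B : ℕ) :
    (avg fun y : ZMod m => ind (NearEnds N B y)) ≤ 2 * B / m := by
  have h1 : (avg fun y : ZMod m => ind (NearEnds N B y)) =
      avg fun t : ZMod m => ind (t.val < B ∨ m ≤ t.val + B) :=
    avg_equiv (Equiv.subRight (N : ZMod m)) fun t => ind (t.val < B ∨ m ≤ t.val + B)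
  rw [h1, avg_eq_sum_div, ZMod.card, sum_ind]
  have h2 : #(univ.filter fun t : ZMod m => t.val < B ∨ m ≤ t.val + B) ≤
      #(Finset.range B ∪ Finset.Ico (m - B) m) := by
    refine Finset.card_le_card_of_injOn ZMod.val (fun t ht => ?_)
      ((ZMod.val_injective m).injOn)
    have h3 := (Finset.mem_filter.1 ht).2
    have h4 := ZMod.val_lt t
    rw [Finset.mem_coe, Finset.mem_union, Finset.mem_range, Finset.mem_Ico]
    omega
  have h3 := h2.trans (Finset.card_union_le _ _)
  rw [Finset.card_range, Nat.card_Ico] at h3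
  have h4 : #(univ.filter fun t : ZMod m => t.val < B ∨ m ≤ t.val + B) ≤ 2 * B := by omega
  exact div_le_div_of_nonneg_right (by exact_mod_cast h4) (Nat.cast_nonneg m)

lemma reprN_add_of_not_nearEnds [NeZero m] {N B : ℕ} {y : ZMod m} (hy : ¬NearEnds N B y) {t : ℤ}
    (ht : |t| ≤ B) : (reprN N (y + (t : ZMod m)) : ℤ) = reprN N y + t := by
  rw [NearEnds, not_or, not_lt, not_le] at hy
  rw [abs_le] at ht
  set u := y - (N : ZMod m)
  have h1 : y + (t : ZMod m) - (N : ZMod m) = (((u.val : ℤ) + t : ℤ) : ZMod m) := by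
    push_cast
    rw [ZMod.natCast_zmod_val]
    ring
  have h2 : ((y + (t : ZMod m) - (N : ZMod m)).val : ℤ) = u.val + t := by
    rw [h1, ZMod.val_intCast]
    exact Int.emod_eq_of_lt (by omega) (by omega)
  rw [reprN, reprN, Nat.cast_add, h2, Nat.cast_add, add_assoc]

lemma localDensity_nonneg (c : S → V → ℤ) (W : ℕ) (n : S → ℤ) (p : ℕ) (T : Finset S) :
    0 ≤ localDensity c W n p T := avg_nonneg fun _ => ind_nonneg _

lemma localDensity_le_one (c : S → V → ℤ) (W : ℕ) (n : S → ℤ) (p : ℕ) (T : Finset S) :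
    localDensity c W n p T ≤ 1 := avg_le_of_forall_le zero_le_one fun _ => ind_le_one _

lemma localDensity_empty {p : ℕ} [NeZero p] (c : S → V → ℤ) (W : ℕ) (n : S → ℤ) :
    localDensity c W n p ∅ = 1 :=
  (avg_congr fun _ => ind_of (by simp)).trans (avg_const _)

lemma abs_avg_ind_sub_le [Fact m.Prime] (hP : ∀ p ∈ P, p.Prime) {c : S → V → ℤ}
    (hm : ∀ s, ∃ v, (c s v : ZMod m) ≠ 0) (W N B : ℕ) {e : S → Finset ℕ × Finset ℕ}
    (he : e ∈ pairFamilies S P)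
    (hB : ∀ s, ∀ z : V → ℕ, (∀ v, z v ≤ (∏ p ∈ univ.biUnion fun s => (e s).1 ∪ (e s).2, p) ^ 2) →
      |∑ v, c s v * (z v : ℤ)| ≤ B) :
    |(avg fun x : V → ZMod m => ind (∀ s, ∀ p ∈ (e s).1 ∪ (e s).2,
        p ∣ W * reprN N (modForm m (c s) x) + 1)) -
      avg fun x : V → ZMod m => ∏ p ∈ P,
        localDensity c W (fun s => reprN N (modForm m (c s) x)) p (pairSupport e p)| ≤
      Fintype.card S * (2 * B / m) := by
  set Q := univ.biUnion fun s => (e s).1 ∪ (e s).2 with hQdef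
  have hQP : Q ⊆ P := Finset.biUnion_subset.2 fun s _ => union_subset_of_mem_pairFamilies he s
  have hQ : ∀ p ∈ Q, p.Prime := fun p hp => hP p (hQP hp)
  have hne : Nonempty (∀ p : Q, V → Fin p) :=
    ⟨fun p _ => ⟨0, (hQ p p.2).pos⟩⟩
  let A : (V → ZMod m) → ℝ := fun x => ind (∀ s, ∀ p ∈ (e s).1 ∪ (e s).2,
        p ∣ W * reprN N (modForm m (c s) x) + 1)
  let D : (V → ZMod m) → ℝ := fun x => ∏ p ∈ P,
        localDensity c W (fun s => reprN N (modForm m (c s) x)) p (pairSupport e p)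
  let z : (∀ p : Q, V → Fin p) → V → ZMod m := fun h v => (crtShift Q h v : ZMod m)
  have hA : avg A = avg fun x => avg fun h => A (x + z h) := by
    rw [avg_comm]
    exact ((avg_congr fun h => avg_equiv (Equiv.addRight (z h)) A).trans (avg_const _)).symm
  have hD : ∀ x, D x = ∏ p ∈ Q,
      localDensity c W (fun s => reprN N (modForm m (c s) x)) p (pairSupport e p) := fun x => by
    refine (Finset.prod_subset hQP fun p hp hpQ => ?_).symm
    have : NeZero p := ⟨(hP p hp).ne_zero⟩
    have h0 : pairSupport e p = ∅ := Finset.filter_eq_empty_iff.2 fun s _ hs =>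
      hpQ (Finset.mem_biUnion.2 ⟨s, Finset.mem_univ s, hs⟩)
    rw [h0, localDensity_empty]
  have hD0 : ∀ x, 0 ≤ D x := fun x => Finset.prod_nonneg fun p _ => localDensity_nonneg _ _ _ _ _
  have hD1 : ∀ x, D x ≤ 1 := fun x => Finset.prod_le_one (fun p _ => localDensity_nonneg _ _ _ _ _)
    fun p _ => localDensity_le_one _ _ _ _ _
  have hgood : ∀ x, (∀ s, ¬NearEnds N B (modForm m (c s) x)) → (avg fun h => A (x + z h)) = D x := by
    intro x hx
    rw [hD, ← avg_crtShift_eq_prod hQ]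
    refine avg_congr fun h => ?_
    have h1 : ∀ s, (reprN N (modForm m (c s) (x + z h)) : ℤ) =
        reprN N (modForm m (c s) x) + ∑ v, c s v * (crtShift Q h v : ℤ) := fun s => by
      rw [← reprN_add_of_not_nearEnds (hx s) (hB s _ fun v => crtShift_le hQ h v), map_add]
      congr 2
      simp [modForm, z]
    have h2 : ∀ s p, p ∣ W * reprN N (modForm m (c s) (x + z h)) + 1 ↔ (p : ℤ) ∣ W *
        (reprN N (modForm m (c s) x) + ∑ v, c s v * (crtShift Q h v : ℤ)) + 1 := fun s p => by
      rw [← h1 s]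
      exact_mod_cast (Int.natCast_dvd_natCast
        (m := p) (n := W * reprN N (modForm m (c s) (x + z h)) + 1)).symm
    refine congrArg ind (propext ?_)
    simp only [h2, pairSupport, Finset.mem_filter, Finset.mem_univ, true_and]
    constructor
    · exact fun h3 p _ s hs => h3 s p hs
    · exact fun h3 s p hs => h3 p (Finset.mem_biUnion.2 ⟨s, Finset.mem_univ s, hs⟩) s hs
  have hpt : ∀ x, |(avg fun h => A (x + z h)) - D x| ≤ ∑ s, ind (NearEnds N B (modForm m (c s) x)) := by
    intro x
    by_cases hx : ∀ s, ¬NearEnds N B (modForm m (c s) x)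
    · rw [hgood x hx, sub_self, abs_zero]
      exact Finset.sum_nonneg fun s _ => ind_nonneg _
    · push Not at hx
      obtain ⟨s, hs⟩ := hx
      have h3 : 0 ≤ avg fun h => A (x + z h) := avg_nonneg fun _ => ind_nonneg _
      have h4 : (avg fun h => A (x + z h)) ≤ 1 :=
        avg_le_of_forall_le zero_le_one fun _ => ind_le_one _
      have h5 := Finset.single_le_sum
        (f := fun s => ind (NearEnds N B (modForm m (c s) x))) (fun s _ => ind_nonneg _)
        (Finset.mem_univ s)
      simp only [ind_of hs] at h5
      refine le_trans (abs_le.2 ⟨?_, ?_⟩) h5 <;> linarith [hD0 x, hD1 x]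
  change |avg A - avg D| ≤ _
  rw [hA, ← avg_sub]
  refine (abs_avg_le _).trans ((avg_mono hpt).trans ?_)
  rw [avg_sum]
  have hs : ∀ s : S, (avg fun x : V → ZMod m => ind (NearEnds N B (modForm m (c s) x))) ≤
      2 * B / m := fun s => by
    obtain ⟨v, hv⟩ := hm s
    rw [avg_addMonoidHom _ (modForm_surjective hv) fun y => ind (NearEnds N B y)]
    exact avg_ind_nearEnds_le N B
  refine (Finset.sum_le_card_nsmul _ _ _ fun s _ => hs s).trans (le_of_eq ?_)
  rw [nsmul_eq_mul, Finset.card_univ]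

/-- The linear forms estimate for the Selberg sieve majorant. -/
theorem abs_avg_prod_selbergMajorant_sub_one_le [Fact m.Prime] (hR : 1 ≤ R)
    (hP : ∀ p ∈ P, p.Prime) {W : ℕ} (hW : ∀ p ∈ P, (W : ZMod p) ≠ 0) (N : ℕ) {c : S → V → ℤ}
    {C : ℕ} (hC : ∀ s v, |c s v| ≤ C) (hm : ∀ s, ∃ v, (c s v : ZMod m) ≠ 0)
    (h1 : ∀ p ∈ P, ∀ s, ∃ v, (c s v : ZMod p) ≠ 0)
    (h2 : ∀ p ∈ P, ∀ s s', s ≠ s' → ∃ v, (c s v : ZMod p) ≠ 0 ∧ (c s' v : ZMod p) = 0) :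
    |(avg fun x : V → ZMod m => ∏ s, selbergMajorant P R W N (modForm m (c s) x)) - 1| ≤
      (∏ p ∈ P, (1 + 128 ^ Fintype.card S * ((p : ℝ) ^ 2)⁻¹) - 1) +
      2 * Fintype.card S * (Fintype.card V * C) * R ^ (9 * Fintype.card S) / m := by
  have hP2 : ∀ p ∈ P, 2 ≤ p := fun p hp => (hP p hp).two_le
  have hG := sieveMass_pos hR hP2
  have hR0 : 0 < R := zero_lt_one.trans_le hR
  set r := Fintype.card S
  set G := sieveMass P R
  let D : (S → Finset ℕ × Finset ℕ) → (V → ZMod m) → ℝ := fun e x => ∏ p ∈ P,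
        localDensity c W (fun s => reprN N (modForm m (c s) x)) p (pairSupport e p)
  let A : (S → Finset ℕ × Finset ℕ) → (V → ZMod m) → ℝ := fun e x =>
    ind (∀ s, ∀ p ∈ (e s).1 ∪ (e s).2, p ∣ W * reprN N (modForm m (c s) x) + 1)
  have hmodel : |(avg fun x => G ^ r * ∑ e ∈ pairFamilies S P, pairWeight P R e * D e x) - 1| ≤
      ∏ p ∈ P, (1 + 128 ^ r * ((p : ℝ) ^ 2)⁻¹) - 1 := by
    rw [show (1 : ℝ) = avg fun _ : V → ZMod m => (1 : ℝ) from (avg_const _).symm, ← avg_sub]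
    simp only [avg_const]
    have hpt : ∀ x : V → ZMod m,
        |G ^ r * ∑ e ∈ pairFamilies S P, pairWeight P R e * D e x - 1| ≤
        ∏ p ∈ P, (1 + 128 ^ r * ((p : ℝ) ^ 2)⁻¹) - 1 := fun x =>
      abs_sieve_model_sub_one_le hP2 hG _ fun p hp T => by
        have : Fact p.Prime := ⟨hP p hp⟩
        exact abs_localDensity_sub_le (hW p hp) (h1 p hp) (h2 p hp) _ T
    exact (abs_avg_le _).trans ((avg_mono hpt).trans_eq (avg_const _))
  set B := ⌊(Fintype.card V * C) * R ^ (4 * r)⌋₊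
  have hB : (B : ℝ) ≤ (Fintype.card V * C) * R ^ (4 * r) := Nat.floor_le (by positivity)
  have herr : ∀ e ∈ pairFamilies S P, |pairWeight P R e * (avg (A e) - avg (D e))| ≤
      |pairWeight P R e| * (r * (2 * B / m)) := by
    intro e he
    by_cases hw : pairWeight P R e = 0
    · rw [hw, zero_mul, abs_zero, zero_mul]
    rw [abs_mul]
    refine mul_le_mul_of_nonneg_left (abs_avg_ind_sub_le hP hm W N B he fun s z hz => ?_)
      (abs_nonneg _)
    have hQ := setProd_le_of_pairWeight_ne_zero hP2 he hw
    set Q := univ.biUnion fun s => (e s).1 ∪ (e s).2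
    have hQ' : ((∏ p ∈ Q, p : ℕ) : ℝ) ≤ R ^ (2 * r) := by
      rw [Nat.cast_prod]; exact hQ
    have h3 : |∑ v, c s v * (z v : ℤ)| ≤ ((Fintype.card V * (C * (∏ p ∈ Q, p) ^ 2) : ℕ) : ℤ) := by
      refine (Finset.abs_sum_le_sum_abs _ _).trans ((Finset.sum_le_card_nsmul _ _
        ((C * (∏ p ∈ Q, p) ^ 2 : ℕ) : ℤ) fun v _ => ?_).trans (le_of_eq ?_))
      · rw [abs_mul, Nat.abs_cast, Nat.cast_mul]
        exact mul_le_mul (hC s v) (by exact_mod_cast hz v) (Nat.cast_nonneg _) (Nat.cast_nonneg _)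
      · rw [nsmul_eq_mul, Finset.card_univ, Nat.cast_mul (Fintype.card V)]
    refine h3.trans (Nat.cast_le.2 (Nat.le_floor ?_))
    push_cast at hQ' ⊢
    rw [mul_assoc, show R ^ (4 * r) = (R ^ (2 * r)) ^ 2 by rw [← pow_mul]; ring_nf]
    have h0 : (0 : ℝ) ≤ ∏ p ∈ Q, (p : ℝ) := Finset.prod_nonneg fun p _ => Nat.cast_nonneg p
    gcongr
  have hsplit : (avg fun x : V → ZMod m => ∏ s, selbergMajorant P R W N (modForm m (c s) x)) =
      (avg fun x => G ^ r * ∑ e ∈ pairFamilies S P, pairWeight P R e * D e x) +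
      G ^ r * ∑ e ∈ pairFamilies S P, pairWeight P R e * (avg (A e) - avg (D e)) := by
    simp only [prod_selbergMajorant, avg_mul_left, avg_sum, mul_sub, Finset.sum_sub_distrib]
    change G ^ r * ∑ e ∈ pairFamilies S P, pairWeight P R e * avg (A e) =
      G ^ r * ∑ e ∈ pairFamilies S P, pairWeight P R e * avg (D e) + _
    ring
  have herr' : |G ^ r * ∑ e ∈ pairFamilies S P, pairWeight P R e * (avg (A e) - avg (D e))| ≤
      2 * r * (Fintype.card V * C) * R ^ (9 * r) / m := by
    rw [abs_mul, abs_of_nonneg (by positivity : 0 ≤ G ^ r)]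
    calc G ^ r * |∑ e ∈ pairFamilies S P, pairWeight P R e * (avg (A e) - avg (D e))|
        ≤ R ^ r * (R ^ (4 * r) * (r * (2 * B / m))) := by
          refine mul_le_mul (pow_le_pow_left₀ hG.le (sieveMass_le hR hP) r) ?_ (abs_nonneg _)
            (by positivity)
          refine (Finset.abs_sum_le_sum_abs _ _).trans ((Finset.sum_le_sum herr).trans ?_)
          rw [← Finset.sum_mul]
          exact mul_le_mul_of_nonneg_right (sum_abs_pairWeight_le hR hP) (by positivity)
      _ ≤ R ^ r * (R ^ (4 * r) * (r * (2 * ((Fintype.card V * C) * R ^ (4 * r)) / m))) := by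
          gcongr
      _ = _ := by
          rw [show 9 * r = r + 4 * r + 4 * r by ring, pow_add, pow_add]
          ring
  rw [hsplit, add_sub_right_comm]
  exact (abs_add_le _ _).trans (add_le_add hmodel herr')

end SelbergPseudorandom

section CubeForms

variable {d : ℕ}

/-- The coefficients of the vertex `s` of the cube attached to a linear form of the progression. -/
def cubeCoeff (s : Fin (d + 1) × (Fin (d + 1) → Bool)) (v : Fin (d + 1) × Bool) : ℤ :=
  if s.2 v.1 = v.2 then ((v.1 : ℕ) : ℤ) - ((s.1 : ℕ) : ℤ) else 0

lemma modForm_cubeCoeff {m : ℕ} (s : Fin (d + 1) × (Fin (d + 1) → Bool))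
    (x : Fin (d + 1) → Bool → ZMod m) :
    modForm m (cubeCoeff s) (fun v => x v.1 v.2) = apForm s.1 (cubeVertex x s.2) := by
  change ∑ v : Fin (d + 1) × Bool, (cubeCoeff s v : ZMod m) * x v.1 v.2 = _
  rw [Fintype.sum_prod_type, apForm]
  refine Finset.sum_congr rfl fun i _ => ?_
  rw [Finset.sum_eq_single (s.2 i)]
  · simp [cubeCoeff, cubeVertex]
  · intro b _ hb
    rw [cubeCoeff, if_neg (Ne.symm hb), Int.cast_zero, zero_mul]
  · exact fun h => absurd (Finset.mem_univ _) h

lemma abs_cubeCoeff_le (s : Fin (d + 1) × (Fin (d + 1) → Bool)) (v : Fin (d + 1) × Bool) :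
    |cubeCoeff s v| ≤ ((d + 1 : ℕ) : ℤ) := by
  rw [cubeCoeff]
  split_ifs
  · rw [abs_le]
    have h1 := v.1.2
    have h2 := s.1.2
    omega
  · rw [abs_zero]
    exact Int.natCast_nonneg _

lemma cubeCoeff_cast_ne_zero {p : ℕ} (hp : d < p) {s : Fin (d + 1) × (Fin (d + 1) → Bool)}
    {i : Fin (d + 1)} (hi : i ≠ s.1) : (cubeCoeff s (i, s.2 i) : ZMod p) ≠ 0 := by
  rw [cubeCoeff, if_pos rfl]
  push_cast
  exact natCast_sub_natCast_ne_zero (by omega) (by omega) fun h => hi (Fin.ext h)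

lemma exists_cubeCoeff_ne_zero {p : ℕ} (hp : d < p) (hd : 1 ≤ d)
    (s : Fin (d + 1) × (Fin (d + 1) → Bool)) : ∃ v, (cubeCoeff s v : ZMod p) ≠ 0 := by
  have : Nontrivial (Fin (d + 1)) := Fin.nontrivial_iff_two_le.2 (by omega)
  obtain ⟨i, hi⟩ := exists_ne s.1
  exact ⟨_, cubeCoeff_cast_ne_zero hp hi⟩

lemma exists_cubeCoeff_ne_zero_and_eq_zero {p : ℕ} (hp : d < p)
    {s s' : Fin (d + 1) × (Fin (d + 1) → Bool)} (hs : s.2 s.1 = false) (hs' : s'.2 s'.1 = false)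
    (hne : s ≠ s') : ∃ v, (cubeCoeff s v : ZMod p) ≠ 0 ∧ (cubeCoeff s' v : ZMod p) = 0 := by
  by_cases hj : s.1 = s'.1
  · have h2 : s.2 ≠ s'.2 := fun h => hne (Prod.ext hj h)
    obtain ⟨i, hi⟩ := Function.ne_iff.1 h2
    refine ⟨(i, s.2 i), cubeCoeff_cast_ne_zero hp ?_, ?_⟩
    · rintro rfl
      rw [hs, hj, hs'] at hi
      exact hi rfl
    · rw [cubeCoeff, if_neg (Ne.symm hi), Int.cast_zero]
  · refine ⟨(s'.1, s.2 s'.1), cubeCoeff_cast_ne_zero hp (Ne.symm hj), ?_⟩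
    rw [cubeCoeff]
    split_ifs <;> simp

theorem cubePseudorandom_selbergMajorant {P : Finset ℕ} {R : ℝ} {m : ℕ} [Fact m.Prime] (hd : 1 ≤ d)
    (hdm : d < m) (hR : 1 ≤ R) (hP : ∀ p ∈ P, p.Prime) (hdP : ∀ p ∈ P, d < p) {W : ℕ}
    (hW : ∀ p ∈ P, (W : ZMod p) ≠ 0) (N : ℕ) {K : ℕ} (hK : (d + 1) * 2 ^ (d + 1) ≤ K) :
    CubePseudorandom (fun (j : Fin (d + 1)) x => selbergMajorant P R W N (apForm (m := m) j x))
      ((∏ p ∈ P, (1 + 128 ^ K * ((p : ℝ) ^ 2)⁻¹) - 1) +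
        2 * K * ((2 * (d + 1)) * (d + 1)) * R ^ (9 * K) / m) := by
  intro A hA
  let S := {s : Fin (d + 1) × (Fin (d + 1) → Bool) // A s.1 s.2 = true}
  let c : S → Fin (d + 1) × Bool → ℤ := fun s => cubeCoeff s.1
  have hcard : Fintype.card S ≤ K := by
    refine le_trans (Fintype.card_subtype_le _) (le_trans (le_of_eq ?_) hK)
    simp
  have hkey := abs_avg_prod_selbergMajorant_sub_one_le (c := c) (C := d + 1) hR hP hW N
    (fun s v => abs_cubeCoeff_le s.1 v) (fun s => exists_cubeCoeff_ne_zero hdm hd s.1)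
    (fun p hp s => exists_cubeCoeff_ne_zero (hdP p hp) hd s.1)
    (fun p hp s s' hss => exists_cubeCoeff_ne_zero_and_eq_zero (hdP p hp) (hA _ _ s.2) (hA _ _ s'.2)
      fun h => hss (Subtype.ext h)) (m := m)
  have hprod : ∀ x : Fin (d + 1) → Bool → ZMod m,
      ∏ s : S, selbergMajorant P R W N (modForm m (c s) fun v => x v.1 v.2) =
      ∏ j, ∏ ω, if A j ω then selbergMajorant P R W N (apForm j (cubeVertex x ω)) else 1 := by
    intro x
    rw [← Fintype.prod_prod_type' fun j ω =>
      if A j ω then selbergMajorant P R W N (apForm j (cubeVertex x ω)) else 1,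
      ← Finset.prod_filter (fun s : Fin (d + 1) × (Fin (d + 1) → Bool) => A s.1 s.2 = true)
      fun s => selbergMajorant P R W N (apForm s.1 (cubeVertex x s.2))]
    refine Eq.trans (Finset.prod_congr rfl fun s _ =>
      congrArg (selbergMajorant P R W N) (modForm_cubeCoeff s.1 x)) ?_
    exact (Finset.prod_subtype (p := fun s : Fin (d + 1) × (Fin (d + 1) → Bool) => A s.1 s.2 = true)
      _ (fun s => by rw [Finset.mem_filter, and_iff_right (Finset.mem_univ s)])
      fun s => selbergMajorant P R W N (apForm s.1 (cubeVertex x s.2))).symm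
  have heq : (avg fun x : Fin (d + 1) → Bool → ZMod m =>
      ∏ j, ∏ ω, if A j ω then selbergMajorant P R W N (apForm j (cubeVertex x ω)) else 1) =
      avg fun x : Fin (d + 1) × Bool → ZMod m =>
        ∏ s, selbergMajorant P R W N (modForm m (c s) x) := by
    exact (avg_congr fun x => (hprod x).symm).trans
      (avg_equiv (Equiv.curry (Fin (d + 1)) Bool (ZMod m)).symm
        fun x => ∏ s, selbergMajorant P R W N (modForm m (c s) x))
  rw [heq]
  refine hkey.trans ?_
  have hm0 : (0 : ℝ) < m := by exact_mod_cast (Fact.out : m.Prime).pos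
  have hV : (Fintype.card (Fin (d + 1) × Bool) : ℝ) = 2 * (d + 1) := by
    simp [mul_comm]
  rw [hV]
  have hcard' : (Fintype.card S : ℝ) ≤ K := by exact_mod_cast hcard
  refine add_le_add (sub_le_sub_right (Finset.prod_le_prod (fun p _ => by positivity)
    fun p _ => ?_) 1) ?_
  · have : (1 : ℝ) ≤ 128 := by norm_num
    gcongr
  · push_cast
    gcongr

lemma prod_one_add_inv_sq_le {P : Finset ℕ} {C : ℝ} (hC : 0 ≤ C) {w : ℕ} (hw : ∀ p ∈ P, w < p) :
    ∏ p ∈ P, (1 + C * ((p : ℝ) ^ 2)⁻¹) ≤ Real.exp (C * (2 / (w + 1))) := by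
  refine (Real.prod_one_add_le_exp_sum P fun p => by positivity).trans (Real.exp_le_exp.2 ?_)
  rw [← Finset.mul_sum]
  refine mul_le_mul_of_nonneg_left ?_ hC
  refine le_trans ?_ (sum_Ioo_inv_sq_le w (P.sup id + 1))
  refine Finset.sum_le_sum_of_subset_of_nonneg (fun p hp => ?_) fun p _ _ => by positivity
  rw [Finset.mem_Ioo]
  exact ⟨hw p hp, Nat.lt_succ_of_le (Finset.le_sup (f := id) hp)⟩

end CubeForms

section SieveMassLowerBound

/-- The primes up to `n`. -/
def primesLE (n : ℕ) : Finset ℕ := (Finset.range (n + 1)).filter Nat.Prime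

lemma mem_primesLE {n p : ℕ} : p ∈ primesLE n ↔ p ≤ n ∧ p.Prime := by
  rw [primesLE, Finset.mem_filter, Finset.mem_range, Nat.lt_succ_iff]

lemma cast_totient_prod_primes {T : Finset ℕ} (hT : ∀ p ∈ T, p.Prime) :
    (Nat.totient (∏ p ∈ T, p) : ℝ) = setTot T := by
  have h := Nat.totient_mul_prod_primeFactors (∏ p ∈ T, p)
  rw [Nat.primeFactors_prod hT, mul_comm] at h
  have h0 : 0 < ∏ p ∈ T, p := Finset.prod_pos fun p hp => (hT p hp).pos
  rw [Nat.eq_of_mul_eq_mul_left h0 h, setTot, Nat.cast_prod]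
  exact Finset.prod_congr rfl fun p hp => by rw [Nat.cast_sub (hT p hp).one_lt.le, Nat.cast_one]

lemma sum_powerset_inv_setTot {T : Finset ℕ} (hT : ∀ p ∈ T, p.Prime) :
    ∑ a ∈ T.powerset, (setTot a)⁻¹ = setProd T / setTot T := by
  rw [setProd, setTot, ← Finset.prod_div_distrib]
  refine Eq.trans (Finset.sum_congr rfl fun a _ => ?_)
    ((Finset.prod_add_one (f := fun p : ℕ => ((p : ℝ) - 1)⁻¹) T).symm.trans
      (Finset.prod_congr rfl fun p hp => ?_))
  · rw [setTot, Finset.prod_inv_distrib]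
  · have : (2 : ℝ) ≤ p := by exact_mod_cast (hT p hp).two_le
    have h1 : (p : ℝ) - 1 ≠ 0 := by linarith
    field_simp
    ring

lemma sum_inv_filter_primeFactors_le (n : ℕ) (s : Finset ℕ) (hs : ∀ p ∈ s, p.Prime) :
    ∑ i ∈ (Finset.Icc 1 n).filter (fun i => i.primeFactors = s), (i : ℝ)⁻¹ ≤ (setTot s)⁻¹ := by
  have hf : ∀ {p : ℕ}, p.Prime →
      ‖((Nat.castRingHom ℝ : ℕ →* ℝ) p)⁻¹‖ < 1 := fun {p} hp => by
    have : (1 : ℝ) < p := by exact_mod_cast hp.one_lt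
    simpa using inv_lt_one_of_one_lt₀ this
  let f : ℕ →* ℝ := (invMonoidWithZeroHom : ℝ →*₀ ℝ).toMonoidHom.comp (Nat.castRingHom ℝ : ℕ →* ℝ)
  have hsum := (EulerProduct.summable_and_hasSum_factoredNumbers_prod_filter_prime_geometric
    (f := f) hf s).2
  have h0 : 0 < ∏ p ∈ s, p := Finset.prod_pos fun p hp => (hs p hp).pos
  set u := ∏ p ∈ s, p
  have hdvd : ∀ i ∈ (Finset.Icc 1 n).filter (fun i => i.primeFactors = s), u ∣ i := fun i hi => by
    have h := Nat.prod_primeFactors_dvd i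
    rwa [(Finset.mem_filter.1 hi).2] at h
  have hmem : ∀ i ∈ (Finset.Icc 1 n).filter (fun i => i.primeFactors = s),
      i / u ∈ Nat.factoredNumbers s := fun i hi => by
    obtain ⟨h1, h2⟩ := Finset.mem_filter.1 hi
    have h3 : i ≠ 0 := by have := (Finset.mem_Icc.1 h1).1; omega
    refine Nat.mem_factoredNumbers_of_dvd (Nat.mem_factoredNumbers_of_primeFactors_subset h3 h2.subset)
      (Nat.div_dvd_of_dvd (hdvd i hi))
  set I := (Finset.Icc 1 n).filter (fun i => i.primeFactors = s)
  let g : {i // i ∈ I} → Nat.factoredNumbers s := fun i => ⟨i.1 / u, hmem i.1 i.2⟩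
  have hg : Function.Injective g := fun i j hij => by
    have h := congrArg Subtype.val hij
    exact Subtype.ext (by
      rw [← Nat.div_mul_cancel (hdvd i.1 i.2), ← Nat.div_mul_cancel (hdvd j.1 j.2)]
      exact congrArg (· * u) h)
  have hle := sum_le_hasSum (I.attach.map ⟨g, hg⟩) (fun i _ => by
    change (0 : ℝ) ≤ ((i.1 : ℕ) : ℝ)⁻¹
    positivity) hsum
  rw [Finset.sum_map, Finset.filter_true_of_mem hs] at hle
  have h1 : ∑ i ∈ I, (i : ℝ)⁻¹ = (u : ℝ)⁻¹ * ∑ i ∈ I.attach, f (g i).1 := by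
    rw [← Finset.sum_attach, Finset.mul_sum]
    refine Finset.sum_congr rfl fun i _ => ?_
    change _ = (u : ℝ)⁻¹ * ((i.1 / u : ℕ) : ℝ)⁻¹
    rw [← mul_inv, ← Nat.cast_mul, Nat.mul_div_cancel' (hdvd i.1 i.2)]
  rw [h1]
  refine (mul_le_mul_of_nonneg_left hle (by positivity)).trans (le_of_eq ?_)
  rw [Nat.cast_prod, ← Finset.prod_inv_distrib, ← Finset.prod_mul_distrib, setTot,
    ← Finset.prod_inv_distrib]
  refine Finset.prod_congr rfl fun p hp => ?_
  change (p : ℝ)⁻¹ * (1 - (p : ℝ)⁻¹)⁻¹ = _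
  have : (2 : ℝ) ≤ p := by exact_mod_cast (hs p hp).two_le
  rw [← mul_inv, mul_sub, mul_one, mul_inv_cancel₀ (by linarith)]

lemma log_le_sum_sieveSupport {R : ℝ} (hR : 0 ≤ R) :
    Real.log R ≤ ∑ s ∈ sieveSupport (primesLE ⌊R⌋₊) R, (setTot s)⁻¹ := by
  have h1 := log_le_harmonic_floor R hR
  rw [harmonic_eq_sum_Icc] at h1
  push_cast at h1
  refine h1.trans ?_
  have hmaps : ∀ i ∈ Finset.Icc 1 ⌊R⌋₊, i.primeFactors ∈ sieveSupport (primesLE ⌊R⌋₊) R := by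
    intro i hi
    obtain ⟨hi1, hi2⟩ := Finset.mem_Icc.1 hi
    rw [sieveSupport, Finset.mem_filter, Finset.mem_powerset]
    refine ⟨fun p hp => mem_primesLE.2 ⟨(Nat.le_of_mem_primeFactors hp).trans hi2,
      Nat.prime_of_mem_primeFactors hp⟩, ?_⟩
    rw [setProd, ← Nat.cast_prod]
    refine le_trans ?_ (Nat.floor_le hR)
    exact_mod_cast (Nat.le_of_dvd hi1 (Nat.prod_primeFactors_dvd i)).trans hi2
  rw [← Finset.sum_fiberwise_of_maps_to hmaps]
  refine Finset.sum_le_sum fun s hs => sum_inv_filter_primeFactors_le _ s fun p hp => ?_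
  rw [sieveSupport, Finset.mem_filter, Finset.mem_powerset] at hs
  exact (mem_primesLE.1 (hs.1 hp)).2

/-- The lower bound for the normalising factor of Selberg's weights. -/
lemma log_le_mul_sieveMass {R : ℝ} (hR : 0 ≤ R) (w : ℕ) :
    Real.log R ≤ setProd (primesLE w) / setTot (primesLE w) *
      sieveMass (primesLE ⌊R⌋₊ \ primesLE w) R := by
  refine (log_le_sum_sieveSupport hR).trans ?_
  have hpr : ∀ n, ∀ p ∈ primesLE n, p.Prime := fun n p hp => (mem_primesLE.1 hp).2
  have h2 : ∀ n, ∀ p ∈ primesLE n, 2 ≤ p := fun n p hp => (hpr n p hp).two_le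
  rw [← sum_powerset_inv_setTot (hpr w), sieveMass, Finset.sum_mul_sum, ← Finset.sum_product']
  have hinj : Set.InjOn (fun s : Finset ℕ => (s ∩ primesLE w, s \ primesLE w))
      (sieveSupport (primesLE ⌊R⌋₊) R) := fun s _ t _ hst => by
    have h := Prod.ext_iff.1 hst
    rw [← Finset.sdiff_union_inter s (primesLE w), ← Finset.sdiff_union_inter t (primesLE w)]
    exact congrArg₂ _ h.2 h.1
  have hterm : ∀ s ∈ sieveSupport (primesLE ⌊R⌋₊) R,
      (setTot s)⁻¹ = (setTot (s ∩ primesLE w))⁻¹ * (setTot (s \ primesLE w))⁻¹ := fun s _ => by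
    rw [← mul_inv, ← setTot_union (Finset.disjoint_sdiff_inter s _).symm, Finset.union_comm,
      Finset.sdiff_union_inter]
  rw [Finset.sum_congr rfl hterm]
  refine le_trans (le_of_eq (Finset.sum_image (g := fun s => (s ∩ primesLE w, s \ primesLE w))
    (f := fun x : Finset ℕ × Finset ℕ => (setTot x.1)⁻¹ * (setTot x.2)⁻¹) hinj).symm) ?_
  refine Finset.sum_le_sum_of_subset_of_nonneg ?_ fun x hx _ => ?_
  · intro x hx
    obtain ⟨s, hs, rfl⟩ := Finset.mem_image.1 hx
    rw [sieveSupport, Finset.mem_filter, Finset.mem_powerset] at hs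
    rw [Finset.mem_product, Finset.mem_powerset, sieveSupport, Finset.mem_filter,
      Finset.mem_powerset]
    exact ⟨Finset.inter_subset_right, Finset.sdiff_subset_sdiff hs.1 subset_rfl,
      (setProd_mono Finset.sdiff_subset fun p hp => h2 _ p (hs.1 hp)).trans hs.2⟩
  · rw [Finset.mem_product, Finset.mem_powerset, sieveSupport, Finset.mem_filter,
      Finset.mem_powerset] at hx
    have h3 := one_le_setTot fun p hp => h2 w p (hx.1 hp)
    have h4 := one_le_setTot fun p hp => h2 _ p (Finset.mem_sdiff.1 (hx.2.1 hp)).1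
    positivity

lemma log_le_setProd_div_setTot (w : ℕ) :
    Real.log w ≤ setProd (primesLE w) / setTot (primesLE w) := by
  have hpr : ∀ p ∈ primesLE w, p.Prime := fun p hp => (mem_primesLE.1 hp).2
  have h := log_le_sum_sieveSupport (Nat.cast_nonneg (α := ℝ) w)
  rw [Nat.floor_natCast] at h
  rw [← sum_powerset_inv_setTot hpr]
  refine h.trans (Finset.sum_le_sum_of_subset_of_nonneg (Finset.filter_subset _ _) fun s hs _ => ?_)
  exact inv_nonneg.2 (zero_le_one.trans
    (one_le_setTot fun p hp => (hpr p (Finset.mem_powerset.1 hs hp)).two_le))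

end SieveMassLowerBound

section Window

lemma selbergMajorant_nonneg {P : Finset ℕ} {R : ℝ} {m : ℕ} (hR : 1 ≤ R) (hP : ∀ p ∈ P, 2 ≤ p)
    (W N : ℕ) (y : ZMod m) : 0 ≤ selbergMajorant P R W N y :=
  mul_nonneg (sieveMass_pos hR hP).le (sq_nonneg _)

lemma selbergMajorant_eq_of_prime {P : Finset ℕ} {R : ℝ} {m : ℕ} (hR : 1 ≤ R)
    (hP : ∀ p ∈ P, p.Prime) (hPR : ∀ p ∈ P, (p : ℝ) ≤ R) {W N : ℕ} {y : ZMod m}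
    (hq : (W * reprN N y + 1).Prime) (hqR : R < ((W * reprN N y + 1 : ℕ) : ℝ)) :
    selbergMajorant P R W N y = sieveMass P R := by
  have hG := sieveMass_pos hR fun p hp => (hP p hp).two_le
  rw [selbergMajorant, Finset.sum_eq_single ∅]
  · have h0 : sieveWeight P R ∅ = 1 := by
      rw [sieveWeight, setProd, Finset.card_empty, Finset.prod_empty]
      simp only [Finset.empty_subset, if_true, pow_zero, one_mul]
      exact one_div_mul_cancel hG.ne'
    rw [h0, ind_of fun p hp => absurd hp (Finset.notMem_empty p)]
    ring
  · intro d hd hd0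
    obtain ⟨p, hp⟩ := Finset.nonempty_iff_ne_empty.2 hd0
    have hpP := Finset.mem_powerset.1 hd hp
    rw [ind_of_not, zero_mul]
    intro h
    have h1 := (Nat.prime_dvd_prime_iff_eq (hP p hpP) hq).1 (h p hp)
    rw [← h1] at hqR
    exact hqR.not_ge (hPR p hpP)
  · exact fun h => absurd (Finset.empty_mem_powerset P) h

lemma epsk_pos (k : ℕ) : 0 < epsk k := by
  rw [epsk]
  positivity

lemma epsk_le {k : ℕ} (hk : 3 < k) : epsk k ≤ 1 / 8 := by
  rw [epsk]
  refine one_div_le_one_div_of_le (by norm_num) ?_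
  have h1 : (2 : ℝ) ^ 3 ≤ 2 ^ k := pow_le_pow_right₀ (by norm_num) hk.le
  have h2 : (1 : ℝ) ≤ (Nat.factorial (k + 4) : ℝ) := by
    exact_mod_cast Nat.succ_le_of_lt (Nat.factorial_pos _)
  nlinarith

lemma tildeLambda_nonneg (W n : ℕ) : 0 ≤ tildeLambda W n := by
  rw [tildeLambda]
  split_ifs
  · have : 0 ≤ Real.log (W * n + 1) := Real.log_nonneg (by
      have : (0 : ℝ) ≤ (W : ℝ) * n := by positivity
      linarith)
    positivity
  · exact le_rfl

/-- The normalised indicator function of the primes in the window. -/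
def windowPrimes (k N W : ℕ) (c : ℝ) {m : ℕ} (y : ZMod m) : ℝ :=
  if inWindow k N y then c * tildeLambda W (reprN N y) else 0

lemma windowPrimes_nonneg {k N W : ℕ} {c : ℝ} (hc : 0 ≤ c) {m : ℕ} (y : ZMod m) :
    0 ≤ windowPrimes k N W c y := by
  rw [windowPrimes]
  split_ifs
  · exact mul_nonneg hc (tildeLambda_nonneg _ _)
  · exact le_rfl

lemma sub_one_le_card_windowSet {k N m : ℕ} (hk : 3 < k) :
    epsk k * m - 1 ≤ #(windowSet k N m) := by
  have he := epsk_pos k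
  have he' := epsk_le hk
  have hm : (0 : ℝ) ≤ m := Nat.cast_nonneg m
  have hsub : (Finset.Icc ⌈epsk k * m⌉₊ ⌊2 * epsk k * m⌋₊).map (addLeftEmbedding N) ⊆
      windowSet k N m := by
    intro n hn
    obtain ⟨t, ht, rfl⟩ := Finset.mem_map.1 hn
    obtain ⟨h1, h2⟩ := Finset.mem_Icc.1 ht
    have h3 := Nat.ceil_le.1 h1
    have h4 := (Nat.le_floor_iff (by positivity)).1 h2
    have h5 : (t : ℝ) ≤ m := by nlinarith
    have h6 : t ≤ m := by exact_mod_cast h5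
    rw [windowSet, Finset.mem_filter, Finset.mem_range, addLeftEmbedding_apply]
    refine ⟨by omega, ?_⟩
    push_cast
    rw [add_sub_cancel_left]
    exact ⟨h3, h4⟩
  have h1 := Finset.card_le_card hsub
  rw [Finset.card_map, Nat.card_Icc] at h1
  have h2 := Nat.ceil_lt_add_one (by positivity : 0 ≤ epsk k * m)
  have h3 := Nat.lt_floor_add_one (2 * epsk k * m)
  have h4 : (⌊2 * epsk k * m⌋₊ + 1 : ℝ) ≤ #(windowSet k N m) + ⌈epsk k * m⌉₊ := by
    exact_mod_cast (by omega : ⌊2 * epsk k * m⌋₊ + 1 ≤ #(windowSet k N m) + ⌈epsk k * m⌉₊)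
  linarith

lemma avgWindow_mul_le_avg {k N m W : ℕ} [NeZero m] (hk : 3 < k) {c : ℝ} (hc : 0 ≤ c) :
    c * avgWindow k N m W * (#(windowSet k N m) / m) ≤
      avg fun y : ZMod m => windowPrimes k N W c y := by
  have he := epsk_pos k
  have he' := epsk_le hk
  have hm : (0 : ℝ) < m := by exact_mod_cast Nat.pos_of_ne_zero (NeZero.ne m)
  have hval : ∀ n ∈ windowSet k N m, ((n : ZMod m) - (N : ZMod m)).val + N = n := by
    intro n hn
    obtain ⟨h1, h2⟩ := (Finset.mem_filter.1 hn).2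
    have h3 : (N : ℝ) ≤ n := by nlinarith
    have h4 : N ≤ n := by exact_mod_cast h3
    have h5 : (n : ℝ) < N + m := by nlinarith
    have h6 : n < N + m := by exact_mod_cast h5
    rw [← Nat.cast_sub h4, ZMod.val_natCast, Nat.mod_eq_of_lt (by omega)]
    omega
  have hinj : Set.InjOn (fun n : ℕ => (n : ZMod m)) (windowSet k N m) := fun n hn n' hn' h => by
    rw [← hval n hn, ← hval n' hn']
    exact congrArg (fun y : ZMod m => (y - (N : ZMod m)).val + N) h
  have hf : ∀ n ∈ windowSet k N m, windowPrimes k N W c (n : ZMod m) = c * tildeLambda W n := by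
    intro n hn
    have h1 := (Finset.mem_filter.1 hn).2
    have h2 : (((n : ZMod m) - (N : ZMod m)).val : ℝ) = n - N := by
      rw [eq_sub_iff_add_eq]
      exact_mod_cast hval n hn
    rw [windowPrimes, if_pos, reprN, add_comm, hval n hn]
    rw [inWindow, h2]
    exact h1
  have hsum : c * ∑ n ∈ windowSet k N m, tildeLambda W n ≤ ∑ y : ZMod m, windowPrimes k N W c y := by
    rw [Finset.mul_sum, ← Finset.sum_congr rfl hf]
    refine le_trans (le_of_eq (Finset.sum_image (f := fun y : ZMod m => windowPrimes k N W c y)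
      hinj).symm) ?_
    exact Finset.sum_le_sum_of_subset_of_nonneg (Finset.subset_univ _)
      fun y _ _ => windowPrimes_nonneg hc y
  rw [avg_eq_sum_div, ZMod.card]
  refine le_trans (le_of_eq ?_) (div_le_div_of_nonneg_right hsum hm.le)
  rcases eq_or_ne (#(windowSet k N m)) 0 with h0 | h0
  · rw [Finset.card_eq_zero.1 h0, avgWindow]
    simp
  · rw [avgWindow]
    have : (#(windowSet k N m) : ℝ) ≠ 0 := Nat.cast_ne_zero.2 h0
    field_simp

end Window

section LiftProgressions

/-- The points of the window which correspond to primes. -/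
def IsWindowPrime (k N W : ℕ) {m : ℕ} (y : ZMod m) : Prop :=
  inWindow k N y ∧ (W * reprN N y + 1).Prime

/-- A progression modulo `m` inside a short window lifts to a progression of integers. -/
lemma reprN_progression {k N m : ℕ} [NeZero m] (hk : 3 < k) {a r : ZMod m}
    (h : ∀ j < k, inWindow k N (a + j • r)) {j : ℕ} (hj : j < k) :
    (reprN N (a + j • r) : ℤ) = reprN N a + j * ((reprN N (a + r) : ℤ) - reprN N a) := by
  have he := epsk_pos k
  have he' := epsk_le hk
  have hm : (0 : ℝ) < m := by exact_mod_cast Nat.pos_of_ne_zero (NeZero.ne m)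
  have hcast : ∀ y : ZMod m, ((reprN N y : ℤ) : ZMod m) = y := fun y => by
    rw [reprN]
    push_cast
    rw [ZMod.natCast_zmod_val]
    ring
  have hclose : ∀ i < k, ∀ i' < k,
      |((reprN N (a + i • r) : ℤ) : ℝ) - (reprN N (a + i' • r) : ℤ)| ≤ epsk k * m := by
    intro i hi i' hi'
    obtain ⟨h1, h2⟩ := h i hi
    obtain ⟨h3, h4⟩ := h i' hi'
    rw [reprN, reprN]
    push_cast
    rw [abs_le]
    constructor <;> linarith
  induction j with
  | zero => simp
  | succ j ih =>
    have ih := ih (by omega)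
    have h1 := hclose (j + 1) hj j (by omega)
    have h2 := hclose 1 (by omega) 0 (by omega)
    rw [one_smul, zero_smul, add_zero] at h2
    have h3 : (m : ℤ) ∣ (reprN N (a + (j + 1) • r) : ℤ) - reprN N (a + j • r) -
        ((reprN N (a + r) : ℤ) - reprN N a) := by
      rw [← ZMod.intCast_zmod_eq_zero_iff_dvd]
      push_cast [hcast]
      simp only [succ_nsmul]
      ring
    have h4 : |(reprN N (a + (j + 1) • r) : ℤ) - reprN N (a + j • r) -
        ((reprN N (a + r) : ℤ) - reprN N a)| < m := by
      have h5 : |((reprN N (a + (j + 1) • r) : ℤ) : ℝ) - (reprN N (a + j • r) : ℤ) -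
        (((reprN N (a + r) : ℤ) : ℝ) - (reprN N a : ℤ))| < m := by
        refine (abs_sub _ _).trans_lt ((add_le_add h1 h2).trans_lt ?_)
        nlinarith
      exact_mod_cast h5
    have h6 := Int.eq_zero_of_abs_lt_dvd h3 h4
    push_cast
    linarith

lemma card_increasing_le_apCount {k N W m : ℕ} [Fact m.Prime] (hk : 3 < k) (hW : 0 < W) :
    #(univ.filter fun p : ZMod m × ZMod m => (∀ j < k, IsWindowPrime k N W (p.1 + j • p.2)) ∧
      reprN N p.1 < reprN N (p.1 + p.2)) ≤ apCount k W N m := by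
  have he := epsk_pos k
  have he' := epsk_le hk
  have hm2 : (2 : ℝ) ≤ m := by exact_mod_cast (Fact.out : m.Prime).two_le
  have hcast : ∀ y : ZMod m, (reprN N y : ZMod m) = y := fun y => by
    rw [reprN]
    push_cast
    rw [ZMod.natCast_zmod_val]
    ring
  refine Finset.card_le_card_of_injOn (fun p => (W * reprN N p.1 + 1,
    W * (reprN N (p.1 + p.2) - reprN N p.1))) (fun p hp => ?_) fun p hp q hq hpq => ?_
  · obtain ⟨h, hlt⟩ := (Finset.mem_filter.1 hp).2
    have hterm : ∀ j < k, W * reprN N p.1 + 1 + j * (W * (reprN N (p.1 + p.2) - reprN N p.1)) =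
        W * reprN N (p.1 + j • p.2) + 1 := fun j hj => by
      have h1 := reprN_progression hk (fun j hj => (h j hj).1) hj
      zify [hlt.le]
      rw [h1]
      ring
    have hbd : ∀ j < k, N ≤ reprN N (p.1 + j • p.2) ∧ reprN N (p.1 + j • p.2) + 1 ≤ N + m := by
      intro j hj
      have h1 := (h j hj).1.2
      refine ⟨Nat.le_add_right _ _, ?_⟩
      have h2 : (((p.1 + j • p.2) - (N : ZMod m)).val : ℝ) + 1 ≤ m := by nlinarith
      have h3 : ((p.1 + j • p.2) - (N : ZMod m)).val + 1 ≤ m := by exact_mod_cast h2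
      rw [reprN]
      omega
    have hbd' : ∀ j < k, W * N < W * reprN N (p.1 + j • p.2) + 1 ∧
        W * reprN N (p.1 + j • p.2) + 1 ≤ W * (N + m) := fun j hj => by
      obtain ⟨h1, h2⟩ := hbd j hj
      have h3 := Nat.mul_le_mul_left W h1
      have h4 := Nat.mul_le_mul_left W h2
      rw [mul_add W _ 1, mul_one] at h4
      exact ⟨Nat.lt_succ_of_le h3, by omega⟩
    have h0 := hbd' 0 (by omega)
    have h1 := hbd' 1 (by omega)
    rw [← hterm 0 (by omega), zero_mul, add_zero] at h0
    rw [← hterm 1 (by omega), one_mul] at h1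
    have hpos : 0 < W * (reprN N (p.1 + p.2) - reprN N p.1) :=
      Nat.mul_pos hW (Nat.sub_pos_of_lt hlt)
    simp only [Finset.mem_coe, Finset.mem_filter, Finset.mem_product, Finset.mem_Icc]
    refine ⟨⟨⟨by omega, h0.2⟩, hpos, by omega⟩, fun j hj => ?_⟩
    rw [hterm j hj]
    exact ⟨(h j hj).2, hbd' j hj⟩
  · have hp' := (Finset.mem_filter.1 hp).2.2
    have hq' := (Finset.mem_filter.1 hq).2.2
    obtain ⟨h1, h2⟩ := Prod.ext_iff.1 hpq
    have h3 := Nat.eq_of_mul_eq_mul_left hW (Nat.succ_injective h1)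
    have h4 := Nat.eq_of_mul_eq_mul_left hW h2
    have h5 : reprN N (p.1 + p.2) = reprN N (q.1 + q.2) := by omega
    have h6 : p.1 = q.1 := by rw [← hcast p.1, ← hcast q.1, h3]
    have h7 : p.1 + p.2 = q.1 + q.2 := by rw [← hcast (p.1 + p.2), ← hcast (q.1 + q.2), h5]
    exact Prod.ext h6 (by rwa [h6, add_right_inj] at h7)

lemma card_progressions_le {k N W m : ℕ} [Fact m.Prime] (hk : 3 < k) (hW : 0 < W) :
    #(univ.filter fun p : ZMod m × ZMod m => ∀ j < k, IsWindowPrime k N W (p.1 + j • p.2)) ≤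
      m + 2 * apCount k W N m := by
  have hinc := card_increasing_le_apCount (N := N) (m := m) hk hW
  set I := univ.filter fun p : ZMod m × ZMod m => (∀ j < k, IsWindowPrime k N W (p.1 + j • p.2)) ∧
      reprN N p.1 < reprN N (p.1 + p.2)
  let Z := univ.filter fun p : ZMod m × ZMod m => p.2 = 0
  let D := univ.filter fun p : ZMod m × ZMod m => (∀ j < k, IsWindowPrime k N W (p.1 + j • p.2)) ∧
      reprN N (p.1 + p.2) < reprN N p.1
  have hZ : #Z ≤ m := by
    refine (Finset.card_le_card_of_injOn (t := (univ : Finset (ZMod m))) Prod.fst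
      (fun p _ => Finset.mem_univ _) fun p hp q hq hpq => Prod.ext hpq ?_).trans_eq
      (by rw [Finset.card_univ, ZMod.card])
    rw [(Finset.mem_filter.1 hp).2, (Finset.mem_filter.1 hq).2]
  have hD : #D ≤ #I := by
    refine Finset.card_le_card_of_injOn (fun p => (p.1 + (k - 1) • p.2, -p.2)) (fun p hp => ?_)
      fun p _ q _ hpq => ?_
    · obtain ⟨h, hlt⟩ := (Finset.mem_filter.1 hp).2
      have hrev : ∀ j < k, p.1 + (k - 1) • p.2 + j • -p.2 = p.1 + (k - 1 - j) • p.2 := by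
        intro j hj
        obtain ⟨i, rfl⟩ : ∃ i, k = j + i + 1 := ⟨k - 1 - j, by omega⟩
        rw [show j + i + 1 - 1 = j + i by omega, show j + i - j = i by omega, add_nsmul]
        simp only [smul_neg]
        ring
      refine Finset.mem_filter.2 ⟨Finset.mem_univ _, fun j hj => ?_, ?_⟩
      · rw [hrev j hj]
        exact h _ (by omega)
      · have h1 := hrev 1 (by omega)
        rw [one_smul] at h1
        rw [h1]
        have h2 := reprN_progression hk (fun j hj => (h j hj).1) (show k - 1 < k by omega)
        have h3 := reprN_progression hk (fun j hj => (h j hj).1) (show k - 1 - 1 < k by omega)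
        zify at hlt ⊢
        rw [h2, h3, Nat.cast_sub (show 1 ≤ k - 1 by omega), Nat.cast_one]
        linarith
    · obtain ⟨h1, h2⟩ := Prod.ext_iff.1 hpq
      have h3 : p.2 = q.2 := neg_injective h2
      exact Prod.ext (by simpa [h3] using h1) h3
  have hsub : (univ.filter fun p : ZMod m × ZMod m =>
      ∀ j < k, IsWindowPrime k N W (p.1 + j • p.2)) ⊆ Z ∪ (I ∪ D) := by
    intro p hp
    have h := (Finset.mem_filter.1 hp).2
    rcases lt_trichotomy (reprN N p.1) (reprN N (p.1 + p.2)) with hlt | heq | hlt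
    · exact Finset.mem_union_right _ (Finset.mem_union_left _
        (Finset.mem_filter.2 ⟨Finset.mem_univ _, h, hlt⟩))
    · refine Finset.mem_union_left _ (Finset.mem_filter.2 ⟨Finset.mem_univ _, ?_⟩)
      have h1 := ZMod.val_injective m (Nat.add_left_cancel heq)
      have h2 := sub_left_injective h1
      exact (left_eq_add.1 h2)
    · exact Finset.mem_union_right _ (Finset.mem_union_right _
        (Finset.mem_filter.2 ⟨Finset.mem_univ _, h, hlt⟩))
  have h1 := (Finset.card_le_card hsub).trans (Finset.card_union_le _ _)
  have h2 := Finset.card_union_le I D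
  omega

end LiftProgressions

section FixedScale

lemma totient_div_eq {w W : ℕ} (hW : W = ∏ p ∈ primesLE w, p) :
    (Nat.totient W : ℝ) / W = (setProd (primesLE w) / setTot (primesLE w))⁻¹ := by
  rw [hW, cast_totient_prod_primes fun p hp => (mem_primesLE.1 hp).2, Nat.cast_prod, inv_div, setProd]

lemma natCast_prod_primesLE_ne_zero {w p : ℕ} (hp : p.Prime) (hpw : w < p) :
    ((∏ q ∈ primesLE w, q : ℕ) : ZMod p) ≠ 0 := by
  rw [Ne, ZMod.natCast_eq_zero_iff, hp.prime.dvd_finsetProd_iff]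
  rintro ⟨q, hq, hpq⟩
  obtain ⟨h1, h2⟩ := mem_primesLE.1 hq
  exact (((Nat.prime_dvd_prime_iff_eq hp h2).1 hpq).trans_le h1).not_gt hpw

lemma reprN_le_two_mul {N m : ℕ} [NeZero m] (hmN : m ≤ N) (y : ZMod m) : reprN N y ≤ 2 * N := by
  have := ZMod.val_lt (y - (N : ZMod m))
  rw [reprN]
  omega

lemma windowPrimes_le {k N W m : ℕ} [NeZero m] {c L : ℝ} (hc : 0 ≤ c) (hmN : m ≤ N) (hL0 : 0 ≤ L)
    (hL : ∀ n ≤ 2 * N, Real.log (W * n + 1) ≤ L) (y : ZMod m) :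
    windowPrimes k N W c y ≤ (Nat.totient W : ℝ) / W * (c * L) := by
  have h0 : 0 ≤ (Nat.totient W : ℝ) / W * (c * L) := by positivity
  rw [windowPrimes, tildeLambda]
  split_ifs
  · have h1 := hL _ (reprN_le_two_mul hmN y)
    rw [mul_left_comm]
    gcongr
  · rwa [mul_zero]
  · exact h0

lemma windowPrimes_le_selbergMajorant {k N w W m : ℕ} [NeZero m] {c L R : ℝ} (hc : 0 ≤ c)
    (hmN : m ≤ N) (hL0 : 0 ≤ L) (hL : ∀ n ≤ 2 * N, Real.log (W * n + 1) ≤ L)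
    (hW : W = ∏ p ∈ primesLE w, p) (hR : 1 ≤ R) (hRN : R ≤ N) (hcR : c * L ≤ Real.log R)
    (y : ZMod m) :
    windowPrimes k N W c y ≤ selbergMajorant (primesLE ⌊R⌋₊ \ primesLE w) R W N y := by
  have hP : ∀ p ∈ primesLE ⌊R⌋₊ \ primesLE w, p.Prime := fun p hp =>
    (mem_primesLE.1 (Finset.mem_sdiff.1 hp).1).2
  by_cases hq : (W * reprN N y + 1).Prime
  · have hW0 : 1 ≤ W := by
      rw [hW]
      exact Finset.prod_pos fun p hp => (mem_primesLE.1 hp).2.pos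
    have h1 : N ≤ W * reprN N y := (Nat.le_add_right _ _).trans (Nat.le_mul_of_pos_left _ hW0)
    rw [selbergMajorant_eq_of_prime hR hP (fun p hp => ?_) hq]
    · refine (windowPrimes_le hc hmN hL0 hL y).trans ?_
      have hpos : 0 < setProd (primesLE w) / setTot (primesLE w) := div_pos
        (zero_lt_one.trans_le (one_le_setProd fun p hp => (mem_primesLE.1 hp).2.two_le))
        (zero_lt_one.trans_le (one_le_setTot fun p hp => (mem_primesLE.1 hp).2.two_le))
      rw [totient_div_eq hW, inv_mul_le_iff₀ hpos]
      exact hcR.trans (log_le_mul_sieveMass (zero_le_one.trans hR) w)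
    · refine hRN.trans_lt ?_
      exact_mod_cast Nat.lt_succ_of_le h1
    · exact (Nat.le_floor_iff (zero_le_one.trans hR)).1 (mem_primesLE.1 (Finset.mem_sdiff.1 hp).1).1
  · rw [windowPrimes, tildeLambda, if_neg hq, mul_zero, ite_self]
    exact selbergMajorant_nonneg hR (fun p hp => (hP p hp).two_le) W N y

lemma div_le_card_progressions {k N W m : ℕ} [Fact m.Prime] (hk : 3 < k) (hW : 0 < W) {b c F : ℝ}
    (hc : 0 ≤ c) (hF : 0 < F) (hfF : ∀ y : ZMod m, windowPrimes k N W c y ≤ F)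
    (hb : b ≤ avg fun p : ZMod m × ZMod m =>
      ∏ j : Fin k, windowPrimes k N W c (p.1 + (j : ℕ) • p.2)) :
    b * (m : ℝ) ^ 2 / F ^ k ≤ m + 2 * apCount k W N m := by
  have hm : (0 : ℝ) < m := by exact_mod_cast (Fact.out : m.Prime).pos
  have hpt : ∀ p : ZMod m × ZMod m, ∏ j : Fin k, windowPrimes k N W c (p.1 + (j : ℕ) • p.2) ≤
      F ^ k * ind (∀ j < k, IsWindowPrime k N W (p.1 + j • p.2)) := by
    intro p
    by_cases h : ∀ j < k, IsWindowPrime k N W (p.1 + j • p.2)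
    · rw [ind_of h, mul_one]
      refine (Finset.prod_le_prod (fun j _ => windowPrimes_nonneg hc _)
        fun j _ => hfF _).trans_eq ?_
      rw [Finset.prod_const, Finset.card_univ, Fintype.card_fin]
    · rw [ind_of_not h, mul_zero]
      push Not at h
      obtain ⟨j, hj, h⟩ := h
      refine le_of_eq (Finset.prod_eq_zero (Finset.mem_univ ⟨j, hj⟩) ?_)
      rw [IsWindowPrime, not_and] at h
      rw [windowPrimes]
      split_ifs with hwin
      · rw [tildeLambda, if_neg (h hwin), mul_zero]
      · rfl
  have h1 := hb.trans (avg_mono hpt)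
  rw [avg_mul_left, avg_eq_sum_div, sum_ind, Fintype.card_prod, ZMod.card] at h1
  have h2 : (#(univ.filter fun p : ZMod m × ZMod m =>
      ∀ j < k, IsWindowPrime k N W (p.1 + j • p.2)) : ℝ) ≤ m + 2 * apCount k W N m := by
    exact_mod_cast card_progressions_le hk hW
  refine le_trans ?_ h2
  rw [div_le_iff₀ (by positivity)]
  calc b * (m : ℝ) ^ 2 ≤ _ * (m : ℝ) ^ 2 := mul_le_mul_of_nonneg_right h1 (by positivity)
    _ = _ := by push_cast; field_simp

end FixedScale

section Scales

lemma eventually_cubePseudorandom {d : ℕ} (hd : 1 ≤ d) {K : ℕ} (hK : (d + 1) * 2 ^ (d + 1) ≤ K)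
    {η : ℝ} (hη : 0 < η) {M w : ℕ → ℕ} (hM : Tendsto M atTop atTop) (hw : Tendsto w atTop atTop) :
    ∀ᶠ N in atTop, ∀ [Fact (M N).Prime], CubePseudorandom
      (fun (j : Fin (d + 1)) x => selbergMajorant
        (primesLE ⌊(M N : ℝ) ^ (1 / (10 * K) : ℝ)⌋₊ \ primesLE (w N))
        ((M N : ℝ) ^ (1 / (10 * K) : ℝ)) (∏ p ∈ primesLE (w N), p) N (apForm (m := M N) j x)) η := by
  have hK0 : (0 : ℝ) < K := by
    exact_mod_cast lt_of_lt_of_le (by positivity : 0 < (d + 1) * 2 ^ (d + 1)) hK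
  have hw' : Tendsto (fun N => (w N : ℝ)) atTop atTop := tendsto_natCast_atTop_atTop.comp hw
  have hM' : Tendsto (fun N => (M N : ℝ)) atTop atTop := tendsto_natCast_atTop_atTop.comp hM
  have h1 : Tendsto (fun N => Real.exp (128 ^ K * (2 / ((w N : ℝ) + 1))) - 1) atTop (nhds 0) := by
    have h2 : Tendsto (fun N => (128 : ℝ) ^ K * (2 / ((w N : ℝ) + 1))) atTop (nhds (128 ^ K * 0)) :=
      (Tendsto.div_atTop tendsto_const_nhds (tendsto_atTop_add_const_right _ 1 hw')).const_mul _
    rw [mul_zero] at h2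
    have h3 := ((Real.continuous_exp.tendsto 0).comp h2).sub_const 1
    rwa [Real.exp_zero, sub_self] at h3
  have h2 : Tendsto (fun N => 2 * K * ((2 * (d + 1)) * (d + 1)) * (M N : ℝ) ^ (-(1 / 10) : ℝ)) atTop
      (nhds 0) := by
    have h3 := ((tendsto_rpow_neg_atTop (y := 1 / 10) (by norm_num)).comp hM').const_mul
      ((2 : ℝ) * K * ((2 * (d + 1)) * (d + 1)))
    rwa [mul_zero] at h3
  have h3 := h1.add h2
  rw [add_zero] at h3
  filter_upwards [h3.eventually (eventually_le_nhds hη), hM.eventually_ge_atTop (d + 1),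
    hw.eventually_ge_atTop d] with N hN hdm hdw _ A hA
  have hM0 : (0 : ℝ) < M N := by exact_mod_cast lt_of_lt_of_le (Nat.succ_pos d) hdm
  have hM1 : (1 : ℝ) ≤ M N := by exact_mod_cast (Nat.succ_pos d).trans_le hdm
  have hP : ∀ p ∈ primesLE ⌊(M N : ℝ) ^ (1 / (10 * K) : ℝ)⌋₊ \ primesLE (w N),
      p.Prime ∧ w N < p := fun p hp => by
    obtain ⟨h4, h5⟩ := Finset.mem_sdiff.1 hp
    have h6 := (mem_primesLE.1 h4).2
    exact ⟨h6, lt_of_not_ge fun h => h5 (mem_primesLE.2 ⟨h, h6⟩)⟩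
  refine (cubePseudorandom_selbergMajorant hd hdm (Real.one_le_rpow hM1 (by positivity))
    (fun p hp => (hP p hp).1) (fun p hp => hdw.trans_lt (hP p hp).2)
    (fun p hp => natCast_prod_primesLE_ne_zero (hP p hp).1 (hP p hp).2) N hK A hA).trans ?_
  refine le_trans (add_le_add (sub_le_sub_right (prod_one_add_inv_sq_le (by positivity)
    fun p hp => (hP p hp).2) 1) (le_of_eq ?_)) hN
  rw [mul_div_assoc]
  congr 1
  rw [← Real.rpow_natCast, ← Real.rpow_mul hM0.le]
  nth_rewrite 2 [← Real.rpow_one (M N : ℝ)]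
  rw [← Real.rpow_sub hM0]
  congr 1
  push_cast
  field_simp
  norm_num

lemma prod_primesLE_le_log {w N : ℕ} (hN : 1 < Real.log N)
    (hw : (w : ℝ) ≤ Real.log (Real.log N) / 2) : ((∏ p ∈ primesLE w, p : ℕ) : ℝ) ≤ Real.log N := by
  have h1 : ((∏ p ∈ primesLE w, p : ℕ) : ℝ) ≤ 4 ^ w := by
    exact_mod_cast primorial_le_four_pow w
  refine h1.trans ?_
  rw [← Real.exp_log (zero_lt_one.trans hN)]
  have h2 : (4 : ℝ) ≤ Real.exp 2 := by
    rw [show (2 : ℝ) = 1 + 1 by norm_num, Real.exp_add]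
    nlinarith [Real.exp_one_gt_d9]
  calc (4 : ℝ) ^ w ≤ Real.exp 2 ^ w := by gcongr
    _ = Real.exp (2 * w) := by rw [← Real.exp_nat_mul, mul_comm]
    _ ≤ _ := Real.exp_le_exp.2 (by linarith)

lemma log_mul_add_one_le {N W n : ℕ} (hN : 2 ≤ N) (hW : (W : ℝ) ≤ Real.log N) (hn : n ≤ 2 * N) :
    Real.log (W * n + 1) ≤ 3 * Real.log N := by
  have h2 : (2 : ℝ) ≤ N := by exact_mod_cast hN
  have h3 : (n : ℝ) ≤ 2 * N := by exact_mod_cast hn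
  have h4 := Real.log_le_sub_one_of_pos (show (0 : ℝ) < N by linarith)
  have h5 : (W : ℝ) * n + 1 ≤ (N : ℝ) ^ 3 := by
    have : (W : ℝ) * n ≤ (N - 1) * (2 * N) := by
      gcongr
      · linarith
      · linarith
    have : 0 ≤ ((N : ℝ) - 2) * (N : ℝ) ^ 2 := mul_nonneg (by linarith) (sq_nonneg _)
    nlinarith
  calc Real.log (W * n + 1) ≤ Real.log ((N : ℝ) ^ 3) := Real.log_le_log (by positivity) h5
    _ = _ := by rw [Real.log_pow]; norm_num

lemma eventually_log_pow_le_rpow (k : ℕ) {ε : ℝ} (hε : 0 < ε) :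
    ∀ᶠ N : ℕ in atTop, Real.log N ^ k ≤ (N : ℝ) ^ ε := by
  have h := ((isLittleO_log_rpow_rpow_atTop (k : ℝ) hε).bound one_pos).natCast_atTop
  filter_upwards [h, eventually_ge_atTop 1] with N hN hN1
  rw [one_mul, Real.rpow_natCast, Real.norm_eq_abs, Real.norm_eq_abs] at hN
  refine (le_abs_self _).trans (hN.trans_eq (abs_of_nonneg (by positivity)))

end Scales

/-- there is `b_k > 0` depending only on `k` such that for all sufficiently
large `N` there are at least `b_k M²/(log N)^k` arithmetic progressions of length `k`
consisting of primes in `(W·N, W·(N+M)]`. -/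
theorem many_prime_APs_in_short_intervals (k : ℕ) (hk : 3 < k) :
    ∃ b : ℝ, 0 < b ∧
      ∀ (ε : ℝ), 0 < ε →
      ∀ (M w : ℕ → ℕ),
        (∀ N, Nat.Prime (M N)) →
        (∀ᶠ N : ℕ in atTop, (N : ℝ) ^ ε < M N ∧ M N ≤ N) →
        Tendsto w atTop atTop →
        (∀ᶠ N : ℕ in atTop, (w N : ℝ) ≤ Real.log (Real.log N) / 2) →
        Tendsto (fun N => avgWindow k N (M N) (Wprim w N)) atTop (nhds 1) →
        ∃ N₀ : ℕ, ∀ N ≥ N₀,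
          b * (M N : ℝ) ^ 2 / (Real.log N) ^ k ≤ (apCount k (Wprim w N) N (M N) : ℝ) := by
  refine ⟨1, one_pos, fun ε hε M w hMp hM hw hwlog havg => ?_⟩
  obtain ⟨d, rfl⟩ : ∃ d, k = d + 2 := ⟨k - 2, by omega⟩
  obtain ⟨K, hK⟩ : ∃ K, K = (d + 2) * 2 ^ (d + 2) := ⟨_, rfl⟩
  have hK0 : (0 : ℝ) < K := by
    rw [hK]
    positivity
  have he := epsk_pos (d + 2)
  obtain ⟨c₁, hc₁⟩ : ∃ c₁ : ℝ, c₁ = ε / (30 * K) := ⟨_, rfl⟩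
  have hc₁0 : 0 < c₁ := by
    rw [hc₁]
    positivity
  obtain ⟨c, hc, η, hη, hrel⟩ := exists_pos_le_avg_prod_of_pseudorandom d
    (δ := c₁ * (1 / 2) * (epsk (d + 2) / 2)) (by positivity)
  have hMtop : Tendsto M atTop atTop := by
    refine tendsto_natCast_atTop_iff.1 (tendsto_atTop_mono' atTop (hM.mono fun N hN => hN.1.le) ?_)
    exact (tendsto_rpow_atTop hε).comp tendsto_natCast_atTop_atTop
  have hlog : Tendsto (fun N : ℕ => Real.log N) atTop atTop :=
    Real.tendsto_log_atTop.comp tendsto_natCast_atTop_atTop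
  have hlogw : Tendsto (fun N : ℕ => Real.log (w N)) atTop atTop := hlog.comp hw
  rw [← eventually_atTop]
  filter_upwards [hM, hwlog, havg.eventually (eventually_ge_nhds (show (1 / 2 : ℝ) < 1 by norm_num)),
    eventually_cubePseudorandom (d := d + 1) (by omega) hK.ge hη hMtop hw,
    hlog.eventually_gt_atTop 1, eventually_log_pow_le_rpow (d + 2) hε,
    hlogw.eventually_ge_atTop (max 1 (3 * (3 * c₁) ^ (d + 2) / c)),
    hMtop.eventually_ge_atTop (d + 2), eventually_ge_atTop 2,
    (tendsto_natCast_atTop_atTop.comp hMtop).eventually_ge_atTop (2 / epsk (d + 2))]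
    with N hMN hwN havgN hcube hlogN hpow hΘ hdM hN2 hMe
  have hfact : Fact (M N).Prime := ⟨hMp N⟩
  set m := M N
  obtain ⟨hεm, hmN⟩ := hMN
  have hW : Wprim w N = ∏ p ∈ primesLE (w N), p := rfl
  set W := Wprim w N
  have hW0 : 0 < W := by
    rw [hW]
    exact Finset.prod_pos fun p hp => (mem_primesLE.1 hp).2.pos
  set L := Real.log N
  set R := (m : ℝ) ^ (1 / (10 * K) : ℝ) with hRdef
  have hm1 : (1 : ℝ) ≤ m := by exact_mod_cast (hMp N).one_lt.le
  have hN0 : (0 : ℝ) < N := by exact_mod_cast (by omega : 0 < N)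
  have hWL : (W : ℝ) ≤ L := prod_primesLE_le_log hlogN hwN
  have hL : ∀ n ≤ 2 * N, Real.log (W * n + 1) ≤ 3 * L := fun n hn => log_mul_add_one_le hN2 hWL hn
  have hR1 : 1 ≤ R := Real.one_le_rpow hm1 (by positivity)
  have hK1 : (1 : ℝ) ≤ K := by
    rw [hK]
    exact_mod_cast Nat.succ_le_of_lt (by positivity : 0 < (d + 2) * 2 ^ (d + 2))
  have hRN : R ≤ N := by
    refine (Real.rpow_le_rpow_of_exponent_le hm1 (y := 1 / (10 * K)) (z := 1) ?_).trans ?_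
    · rw [div_le_one (by positivity)]
      linarith
    · rw [Real.rpow_one]
      exact_mod_cast hmN
  have hcR : c₁ * (3 * L) ≤ Real.log R := by
    have h1 := Real.log_le_log (by positivity) hεm.le
    rw [Real.log_rpow hN0] at h1
    rw [hRdef, Real.log_rpow (by linarith), hc₁]
    calc ε / (30 * K) * (3 * L) = 1 / (10 * K) * (ε * L) := by field_simp; norm_num
      _ ≤ _ := mul_le_mul_of_nonneg_left h1 (by positivity)
  have hL0 : 0 < L := by linarith
  have hδ : c₁ * (1 / 2) * (epsk (d + 2) / 2) ≤
      avg fun y : ZMod m => windowPrimes (d + 2) N W c₁ y := by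
    refine le_trans ?_ (avgWindow_mul_le_avg hk hc₁0.le)
    have h1 := sub_one_le_card_windowSet (N := N) (m := m) hk
    have h2 : epsk (d + 2) / 2 ≤ #(windowSet (d + 2) N m) / m := by
      rw [le_div_iff₀ (by linarith)]
      have h3 := (div_le_iff₀ he).1 hMe
      change 2 ≤ (m : ℝ) * _ at h3
      linarith
    gcongr
  have hb := hrel m (by omega) _ _ hcube (fun y => windowPrimes_nonneg hc₁0.le y)
    (fun y => windowPrimes_le_selbergMajorant hc₁0.le hmN (by positivity) hL hW hR1 hRN hcR y) hδ
  set Θ := setProd (primesLE (w N)) / setTot (primesLE (w N))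
  have hΘ' := hΘ.trans (log_le_setProd_div_setTot (w N))
  have hΘ1 : 1 ≤ Θ := (le_max_left _ _).trans hΘ'
  have hΘ2 : 3 * (3 * c₁) ^ (d + 2) ≤ Θ * c := (div_le_iff₀ hc).1 ((le_max_right _ _).trans hΘ')
  have hF := windowPrimes_le (k := d + 2) (W := W) (m := m) hc₁0.le hmN (by positivity) hL
  rw [totient_div_eq hW] at hF
  have hΘ0 : 0 < Θ := by linarith
  have hcount := div_le_card_progressions hk hW0 hc₁0.le (F := Θ⁻¹ * (c₁ * (3 * L))) (by positivity)
    hF hb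
  have h1 : 3 * ((m : ℝ) ^ 2 / L ^ (d + 2)) ≤
      c * (m : ℝ) ^ 2 / (Θ⁻¹ * (c₁ * (3 * L))) ^ (d + 2) := by
    have h2 : Θ ≤ Θ ^ (d + 2) := le_self_pow₀ hΘ1 (by omega)
    have h3 : 3 * (3 * c₁) ^ (d + 2) ≤ Θ ^ (d + 2) * c :=
      hΘ2.trans (mul_le_mul_of_nonneg_right h2 hc.le)
    have h4 : (Θ⁻¹ * (c₁ * (3 * L))) ^ (d + 2) = (3 * c₁) ^ (d + 2) * L ^ (d + 2) / Θ ^ (d + 2) := by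
      rw [← mul_pow, ← div_pow]
      congr 1
      field_simp
    rw [h4, ← mul_div_assoc, div_div_eq_mul_div, div_le_div_iff₀ (by positivity) (by positivity)]
    have h5 : 0 ≤ (m : ℝ) ^ 2 * L ^ (d + 2) := by positivity
    nlinarith [mul_le_mul_of_nonneg_right h3 h5]
  have h2 : (m : ℝ) ≤ (m : ℝ) ^ 2 / L ^ (d + 2) := by
    rw [le_div_iff₀ (by positivity), sq]
    exact mul_le_mul_of_nonneg_left (hpow.trans hεm.le) (by linarith)
  rw [one_mul]
  linarith

end
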